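/- arXiv:1005.2987 — 3 statements merged into one kernel-verified Lean document; each statement's English description precedes it below -/
import Mathlib

section
/- (Arens) Let A be a unital commutative complex Banach algebra. For every n ≥ 1, the Gelfand transform A → C(X_A) induces a bijection π₀(GL_n(A)) → π₀(GL_n(C(X_A))) between the sets of path components of the invertible n×n matrix groups. -/
/-- The map induced on path components by a continuous map. -/
def pi0Map {X Y : Type*} [TopologicalSpace X] [TopologicalSpace Y] {f : X → Y}
    (hf : Continuous f) : ZerothHomotopy X → ZerothHomotopy Y :=
  Quotient.map f (fun _ _ h => Nonempty.map (fun p => p.map hf) h)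

/-- `GL_n(A)`: the group of invertible `n × n` matrices over `A`, topologized as a
subspace of `M_n(A)`. -/
abbrev GLn (A : Type*) [Ring A] [TopologicalSpace A] (n : ℕ) : Type _ :=
  {M : Matrix (Fin n) (Fin n) A // IsUnit M}

/-- The map `GL_n(A) → GL_n(B)` induced by a ring morphism `A → B` (applied entrywise). -/
def glMap {A B : Type*} [Ring A] [Ring B] [TopologicalSpace A] [TopologicalSpace B]
    (φ : A →+* B) (n : ℕ) : GLn A n → GLn B n :=
  fun M => ⟨M.1.map φ, φ.mapMatrix.isUnit_map M.2⟩

lemma continuous_glMap {A B : Type*} [Ring A] [Ring B] [TopologicalSpace A] [TopologicalSpace B]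
    (φ : A →+* B) (n : ℕ) (hφ : Continuous φ) : Continuous (glMap φ n) :=
  (continuous_subtype_val.matrix_map hφ).subtype_mk _

lemma gelfandTransform_continuous (A : Type*) [NormedCommRing A] [NormedAlgebra ℂ A]
    [CompleteSpace A] : Continuous (WeakDual.gelfandTransform ℂ A) := by
  refine AddMonoidHomClass.continuous_of_bound
    (WeakDual.gelfandTransform ℂ A).toLinearMap ‖(1 : A)‖ ?_
  intro a
  rw [mul_comm]
  refine (ContinuousMap.norm_le _ (by positivity)).2 fun χ => ?_
  exact AlgHom.norm_apply_le_self_mul_norm_one χ a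


section PartP1

/-! ### Approximation of null-homotopic elements by products of exponentials -/

open Filter Topology Set

section ApproxExp

set_option linter.unusedSectionVars false

variable {𝔸 𝔹 : Type*} [NormedRing 𝔸] [NormedAlgebra ℂ 𝔸] [CompleteSpace 𝔸]
  [NormedRing 𝔹] [NormedAlgebra ℂ 𝔹] [CompleteSpace 𝔹]

/-- Near `0`, `1 + e` is very well approximated by `exp e`. -/
lemma arens_exp_second_order (𝔹 : Type*) [NormedRing 𝔹] [NormedAlgebra ℂ 𝔹] [CompleteSpace 𝔹] :
    ∃ δ > 0, ∀ e : 𝔹, ‖e‖ < δ → ‖NormedSpace.exp (-e) * (1 + e) - 1‖ ≤ (1 / 2) * ‖e‖ := by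
  have h1 : HasFDerivAt (fun e : 𝔹 => NormedSpace.exp (-e)) (-1 : 𝔹 →L[ℂ] 𝔹) 0 := by
    have h := (hasStrictFDerivAt_exp_zero (𝕂 := ℂ) (𝔸 := 𝔹)).hasFDerivAt
    have h0 : HasFDerivAt (fun e : 𝔹 => -e) (-ContinuousLinearMap.id ℂ 𝔹) (0 : 𝔹) :=
      (hasFDerivAt_id (0 : 𝔹)).neg
    have h' : HasFDerivAt (NormedSpace.exp : 𝔹 → 𝔹) (1 : 𝔹 →L[ℂ] 𝔹) (-0 : 𝔹) := by simpa using h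
    have h3 := HasFDerivAt.comp (0 : 𝔹) h' h0
    refine HasFDerivAt.congr_fderiv h3 ?_
    ext x
    simp
  have h2 : HasFDerivAt (fun e : 𝔹 => 1 + e) (ContinuousLinearMap.id ℂ 𝔹) (0 : 𝔹) :=
    (hasFDerivAt_id (0 : 𝔹)).const_add 1
  have h3 := h1.mul' h2
  have h4 : HasFDerivAt (fun e : 𝔹 => NormedSpace.exp (-e) * (1 + e)) (0 : 𝔹 →L[ℂ] 𝔹) 0 := by
    refine HasFDerivAt.congr_fderiv h3 ?_
    ext x
    simp
  have h5 := h4.isLittleO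
  have h6 := h5.def (c := 1 / 2) (by norm_num)
  rw [Metric.eventually_nhds_iff] at h6
  obtain ⟨δ, hδ, h⟩ := h6
  refine ⟨δ, hδ, fun e he => ?_⟩
  have := @h e (by simpa using he)
  simpa using this

variable (ι : 𝔸 →+* 𝔹) (J : AddSubgroup 𝔸)

/-- the closure of the image of `J`. -/
lemma arens_E_left (hd : DenseRange ι)
    (hJ : ∀ x : 𝔸, ∀ b ∈ J, x * b ∈ J) {E : Set 𝔹} (hE : E = closure (ι '' (J : Set 𝔸)))
    (x e : 𝔹) (he : e ∈ E) : x * e ∈ E := by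
  subst hE
  have hc : IsClosed {p : 𝔹 × 𝔹 | p.1 * p.2 ∈ closure (ι '' (J : Set 𝔸))} :=
    isClosed_closure.preimage (continuous_fst.mul continuous_snd)
  have hsub : (range ι) ×ˢ (ι '' (J : Set 𝔸)) ⊆
      {p : 𝔹 × 𝔹 | p.1 * p.2 ∈ closure (ι '' (J : Set 𝔸))} := by
    rintro ⟨p, q⟩ ⟨⟨a, rfl⟩, ⟨b, hb, rfl⟩⟩
    exact subset_closure ⟨a * b, hJ a b hb, by simp⟩
  have := hc.closure_subset_iff.2 hsub
  rw [closure_prod_eq, hd.closure_range] at this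
  exact this (show (x, e) ∈ univ ×ˢ _ from ⟨trivial, he⟩)

lemma arens_approx_exp (hι : Continuous ι) (hd : DenseRange ι)
    (hJ : ∀ x : 𝔸, ∀ b ∈ J, x * b ∈ J)
    (hJexp : ∀ b ∈ J, NormedSpace.exp b - 1 ∈ J)
    (γ : unitInterval → 𝔹) (hγ : Continuous γ) (h0 : γ 0 = 1) (hu : ∀ τ, IsUnit (γ τ))
    (hE : ∀ τ, γ τ - 1 ∈ closure (ι '' (J : Set 𝔸))) (ε : ℝ) (hε : 0 < ε) :
    ∃ v ∈ Submonoid.closure (NormedSpace.exp '' (J : Set 𝔸)), ‖ι v - γ 1‖ < ε := by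
  letI : NormedAlgebra ℚ 𝔸 := NormedAlgebra.restrictScalars ℚ ℂ 𝔸
  letI : NormedAlgebra ℚ 𝔹 := NormedAlgebra.restrictScalars ℚ ℂ 𝔹
  set E : Set 𝔹 := closure (ι '' (J : Set 𝔸)) with hEdef
  set W : Submonoid 𝔹 :=
    ((Submonoid.closure (NormedSpace.exp '' (J : Set 𝔸))).map ι).topologicalClosure with hW
  have hWc : IsClosed (W : Set 𝔹) := Submonoid.isClosed_topologicalClosure _
  have hEl : ∀ x e : 𝔹, e ∈ E → x * e ∈ E := fun x e he => arens_E_left ι J hd hJ rfl x e he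
  have hEG : E = ((J.map (ι : 𝔸 →+ 𝔹)).topologicalClosure : Set 𝔹) := rfl
  have hEadd : ∀ x ∈ E, ∀ y ∈ E, x + y ∈ E := by
    intro x hx y hy
    rw [hEG] at *
    exact add_mem hx hy
  have hEsub : ∀ x ∈ E, ∀ y ∈ E, x - y ∈ E := by
    intro x hx y hy
    rw [hEG] at *
    exact sub_mem hx hy
  have hEneg : ∀ x ∈ E, -x ∈ E := by
    intro x hx
    rw [hEG] at *
    exact neg_mem hx
  -- exponentials
  have hexpE : ∀ e ∈ E, NormedSpace.exp e - 1 ∈ E := by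
    intro e he
    have hc : IsClosed {e : 𝔹 | NormedSpace.exp e - 1 ∈ E} :=
      isClosed_closure.preimage (NormedSpace.exp_continuous.sub continuous_const)
    refine hc.closure_subset_iff.2 ?_ he
    rintro _ ⟨b, hb, rfl⟩
    refine subset_closure ⟨NormedSpace.exp b - 1, hJexp b hb, ?_⟩
    rw [map_sub, map_one, NormedSpace.map_exp ι hι]
  have hexpW : ∀ e ∈ E, NormedSpace.exp e ∈ W := by
    intro e he
    have hc : IsClosed {e : 𝔹 | NormedSpace.exp e ∈ W} :=
      hWc.preimage NormedSpace.exp_continuous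
    refine hc.closure_subset_iff.2 ?_ he
    rintro _ ⟨b, hb, rfl⟩
    refine subset_closure ?_
    refine ⟨NormedSpace.exp b, Submonoid.subset_closure ⟨b, hb, rfl⟩, ?_⟩
    rw [NormedSpace.map_exp ι hι]
  obtain ⟨δ, hδ, hlog⟩ := arens_exp_second_order 𝔹
  have hmain : ∀ e ∈ E, ‖e‖ < δ → 1 + e ∈ W := by
    intro e he hn
    have key : ∀ m : ℕ, ∃ u ∈ W, ∃ f ∈ E, ‖f‖ < δ ∧ ‖f‖ ≤ (1 / 2) ^ m * ‖e‖ ∧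
        1 + e = u * (1 + f) := by
      intro m
      induction m with
      | zero => exact ⟨1, one_mem _, e, he, hn, by simp, by simp⟩
      | succ m ih =>
        obtain ⟨u, huW, f, hf, hfδ, hfm, heq⟩ := ih
        refine ⟨u * NormedSpace.exp f, mul_mem huW (hexpW f hf),
          NormedSpace.exp (-f) * (1 + f) - 1, ?_, ?_, ?_, ?_⟩
        · have : NormedSpace.exp (-f) * (1 + f) - 1 =
            (NormedSpace.exp (-f) - 1) + NormedSpace.exp (-f) * f := by noncomm_ring
          rw [this]
          exact hEadd _ (hexpE _ (hEneg _ hf)) _ (hEl _ _ hf)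
        · have := hlog f hfδ
          have h0 := norm_nonneg f
          linarith
        · have := hlog f hfδ
          rw [pow_succ]
          linarith
        · rw [heq]
          have h1 : NormedSpace.exp f * NormedSpace.exp (-f) = 1 := by
            rw [← NormedSpace.exp_add_of_commute (Commute.neg_right (Commute.refl f))]
            simp
          rw [mul_assoc u, add_sub_cancel, ← mul_assoc (NormedSpace.exp f), h1, one_mul]
    choose u huW f hf hfδ hfm heq using key
    have hf0 : Tendsto f atTop (𝓝 0) := by
      rw [tendsto_zero_iff_norm_tendsto_zero]
      refine squeeze_zero (fun _ => norm_nonneg _) hfm ?_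
      have := (tendsto_pow_atTop_nhds_zero_of_lt_one (r := (1 / 2 : ℝ)) (by norm_num)
        (by norm_num)).mul_const ‖e‖
      simpa using this
    have h1 : Tendsto (fun m => (1 + e) * Ring.inverse (1 + f m)) atTop (𝓝 (1 + e)) := by
      have hc : ContinuousAt (Ring.inverse : 𝔹 → 𝔹) (1 + 0) := by
        have := NormedRing.inverse_continuousAt (1 : 𝔹ˣ)
        simpa using this
      have h2 : Tendsto (fun m => 1 + f m) atTop (𝓝 (1 + 0)) := hf0.const_add 1
      have h3 := (hc.tendsto.comp h2).const_mul (1 + e)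
      simpa using h3
    refine hWc.mem_of_tendsto h1 ?_
    have hev : ∀ᶠ m in atTop, ‖f m‖ < 1 := by
      have := (tendsto_zero_iff_norm_tendsto_zero.1 hf0)
      exact this.eventually (gt_mem_nhds one_pos)
    filter_upwards [hev] with m hm
    have hunit : IsUnit (1 + f m) := by
      have := isUnit_one_sub_of_norm_lt_one (x := -f m) (by simpa using hm)
      simpa using this
    have : (1 + e) * Ring.inverse (1 + f m) = u m := by
      rw [heq m, mul_assoc, Ring.mul_inverse_cancel _ hunit, mul_one]
    rw [this]
    exact huW m
  -- connectedness
  have hT : ({τ | γ τ ∈ W} : Set unitInterval) = univ := by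
    have hclosed : IsClosed {τ | γ τ ∈ W} := hWc.preimage hγ
    have hopen : IsOpen {τ | γ τ ∈ W} := by
      rw [isOpen_iff_mem_nhds]
      intro τ₀ hτ₀
      obtain ⟨g, hg⟩ := hu τ₀
      have hcont : Continuous (fun τ => (↑g⁻¹ : 𝔹) * γ τ - 1) :=
        (continuous_const.mul hγ).sub continuous_const
      have hz : (↑g⁻¹ : 𝔹) * γ τ₀ - 1 = 0 := by rw [← hg]; simp
      have hev : ∀ᶠ τ in 𝓝 τ₀, ‖(↑g⁻¹ : 𝔹) * γ τ - 1‖ < δ := by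
        have := hcont.norm.tendsto τ₀
        rw [hz, norm_zero] at this
        exact this.eventually (gt_mem_nhds hδ)
      filter_upwards [hev] with τ hτ
      have hmem : (↑g⁻¹ : 𝔹) * γ τ - 1 ∈ E := by
        have : (↑g⁻¹ : 𝔹) * γ τ - 1 = ↑g⁻¹ * ((γ τ - 1) - (γ τ₀ - 1)) := by
          rw [← hg]
          simp [mul_sub]
        rw [this]
        exact hEl _ _ (hEsub _ (hE τ) _ (hE τ₀))
      have := hmain _ hmem hτ
      have h2 := mul_mem hτ₀ this
      have h3 : γ τ₀ * (1 + ((↑g⁻¹ : 𝔹) * γ τ - 1)) = γ τ := by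
        rw [← hg]; simp
      rw [h3] at h2
      exact h2
    refine IsClopen.eq_univ ⟨hclosed, hopen⟩ ⟨0, ?_⟩
    show γ 0 ∈ W
    rw [h0]; exact one_mem _
  have h1 : γ 1 ∈ W := by
    have : (1 : unitInterval) ∈ ({τ | γ τ ∈ W} : Set unitInterval) := by rw [hT]; trivial
    exact this
  have h2 : γ 1 ∈ closure (((Submonoid.closure (NormedSpace.exp '' (J : Set 𝔸))).map ι :
    Submonoid 𝔹) : Set 𝔹) := h1
  rw [Metric.mem_closure_iff] at h2
  obtain ⟨_, ⟨v, hv, rfl⟩, hlt⟩ := h2 ε hε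
  refine ⟨v, hv, ?_⟩
  rw [dist_comm, dist_eq_norm] at hlt
  exact hlt

end ApproxExp

end PartP1

section PartP2

/-! ### The localisation of a Banach algebra on an annulus -/

section Loc

open Filter Topology Set

universe u

lemma arens_completion {D : Type u} [CommRing D] [Algebra ℂ D] (P : RingSeminorm D)
    (hsmul : ∀ (z : ℂ) (f : D), P (z • f) ≤ ‖z‖ * P f) :
    ∃ (Q : Type u) (_ : NormedCommRing Q) (_ : NormedAlgebra ℂ Q) (_ : CompleteSpace Q)
      (ι : D →ₐ[ℂ] Q), DenseRange ι ∧ ∀ f, ‖ι f‖ = P f := by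
  letI iC : SeminormedCommRing D :=
    { P.toSeminormedRing with mul_comm := fun a b : D => mul_comm a b }
  letI iA : NormedAlgebra ℂ D := { norm_smul_le := hsmul }
  let ι : D →ₐ[ℂ] UniformSpace.Completion D :=
    { toFun := fun f => (f : UniformSpace.Completion D)
      map_one' := UniformSpace.Completion.coe_one D
      map_mul' := fun f g => UniformSpace.Completion.coe_mul f g
      map_zero' := UniformSpace.Completion.coe_zero
      map_add' := fun f g => UniformSpace.Completion.coe_add f g
      commutes' := fun z => rfl }
  exact ⟨UniformSpace.Completion D, inferInstance, inferInstance, inferInstance, ι,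
    UniformSpace.Completion.denseRange_coe, fun f => UniformSpace.Completion.norm_coe f⟩

variable {D : Type u} [NormedCommRing D] [NormedAlgebra ℂ D]

/-- The weight of the `k`-th power of the variable on the annulus `r₁ ≤ |w| ≤ r₂`. -/
noncomputable def arensWeight (r₁ r₂ : ℝ) (k : ℤ) : ℝ := max (r₂ ^ k) (r₁ ^ k)

/-- Monomials together with an upper bound of their cost. -/
noncomputable def arensMono (hone : ‖(1 : D)‖ ≤ 1) (w : Dˣ) (r₁ r₂ : ℝ) (h₁ : 0 < r₁) (h₂ : 0 < r₂) :
    Submonoid (D × ℝ) where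
  carrier := {p | ∃ (k : ℤ) (g : D), p.1 = g * (↑(w ^ k) : D) ∧ ‖g‖ * arensWeight r₁ r₂ k ≤ p.2}
  one_mem' := ⟨0, 1, by simp, by simpa [arensWeight] using hone⟩
  mul_mem' := by
    rintro ⟨f, c⟩ ⟨f', c'⟩ ⟨k, g, hf, hc⟩ ⟨k', g', hf', hc'⟩
    refine ⟨k + k', g * g', ?_, ?_⟩
    · simp only [Prod.mk_mul_mk] at *
      rw [hf, hf', zpow_add]
      push_cast
      ring
    · simp only [Prod.mk_mul_mk] at *
      have hw : ∀ k, 0 < arensWeight r₁ r₂ k := fun k =>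
        lt_max_of_lt_left (zpow_pos h₂ k)
      have hmul : arensWeight r₁ r₂ (k + k') ≤ arensWeight r₁ r₂ k * arensWeight r₁ r₂ k' := by
        refine max_le ?_ ?_
        · rw [zpow_add₀ h₂.ne']
          exact mul_le_mul (le_max_left _ _) (le_max_left _ _) (zpow_pos h₂ _).le (hw _).le
        · rw [zpow_add₀ h₁.ne']
          exact mul_le_mul (le_max_right _ _) (le_max_right _ _) (zpow_pos h₁ _).le (hw _).le
      calc ‖g * g'‖ * arensWeight r₁ r₂ (k + k')
          ≤ (‖g‖ * ‖g'‖) * (arensWeight r₁ r₂ k * arensWeight r₁ r₂ k') :=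
            mul_le_mul (norm_mul_le _ _) hmul (hw _).le (by positivity)
        _ = (‖g‖ * arensWeight r₁ r₂ k) * (‖g'‖ * arensWeight r₁ r₂ k') := by ring
        _ ≤ c * c' := mul_le_mul hc hc' (mul_nonneg (norm_nonneg _) (hw _).le)
            (le_trans (mul_nonneg (norm_nonneg _) (hw _).le) hc)

lemma arens_loc (hone : ‖(1 : D)‖ ≤ 1) (w : Dˣ) (r₁ r₂ : ℝ) (h₁ : 0 < r₁) (h₁₂ : r₁ ≤ r₂) :
    ∃ (Q : Type u) (_ : NormedCommRing Q) (_ : NormedAlgebra ℂ Q) (_ : CompleteSpace Q)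
      (ι : D →ₐ[ℂ] Q), DenseRange ι ∧ (∀ f, ‖ι f‖ ≤ ‖f‖) ∧ ‖ι (w : D)‖ ≤ r₂ ∧
      ‖ι (↑w⁻¹ : D)‖ ≤ r₁⁻¹ ∧
      ∀ (f : D) (c : ℝ), ‖ι f‖ < c → ∃ f₁ f₂ : D, f = f₁ + f₂ ∧ ‖ι f₁‖ ≤ c ∧ ‖ι f₂‖ ≤ c ∧
        ∀ χ : D →+* ℂ, (∀ g, ‖χ g‖ ≤ ‖g‖) →
          (‖χ w‖ ≤ r₂ → ‖χ f₁‖ ≤ c) ∧ (r₁ ≤ ‖χ w‖ → ‖χ f₂‖ ≤ c) := by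
  have h₂ : 0 < r₂ := h₁.trans_le h₁₂
  set S := arensMono hone w r₁ r₂ h₁ h₂ with hS
  set U : Subsemiring (D × ℝ) := S.subsemiringClosure with hU
  have hUc : (U : Set (D × ℝ)) = AddSubmonoid.closure (S : Set (D × ℝ)) := rfl
  have hmemU : ∀ p, p ∈ U ↔ p ∈ AddSubmonoid.closure (S : Set (D × ℝ)) := fun p => Iff.rfl
  have hw : ∀ k, 0 < arensWeight r₁ r₂ k := fun k => lt_max_of_lt_left (zpow_pos h₂ k)
  have hgen : ∀ (k : ℤ) (g : D) (c : ℝ), ‖g‖ * arensWeight r₁ r₂ k ≤ c →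
      (g * (↑(w ^ k) : D), c) ∈ U := fun k g c h =>
    (hmemU _).2 (AddSubmonoid.subset_closure ⟨k, g, rfl, h⟩)
  have hbase : ∀ (f : D), (f, ‖f‖) ∈ U := by
    intro f
    have := hgen 0 f ‖f‖ (by simp [arensWeight])
    simpa using this
  have hnn : ∀ p ∈ U, 0 ≤ p.2 := by
    intro p hp
    rw [hmemU] at hp
    induction hp using AddSubmonoid.closure_induction with
    | mem x hx =>
      obtain ⟨k, g, _, h⟩ := hx
      exact le_trans (mul_nonneg (norm_nonneg _) (hw _).le) h
    | zero => simp
    | add x y _ _ hx hy => exact add_nonneg hx hy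
  set p : D → ℝ := fun f => sInf {c | (f, c) ∈ U} with hp
  have hbdd : ∀ f, BddBelow {c | (f, c) ∈ U} := fun f => ⟨0, fun c hc => hnn _ hc⟩
  have hle : ∀ {f c}, (f, c) ∈ U → p f ≤ c := fun {f c} h => csInf_le (hbdd f) h
  have hlt : ∀ {f c}, p f < c → ∃ c' < c, (f, c') ∈ U := by
    intro f c h
    obtain ⟨c', hc', h'⟩ := exists_lt_of_csInf_lt (s := {c | (f, c) ∈ U}) ⟨_, hbase f⟩ h
    exact ⟨c', h', hc'⟩
  have hp0 : ∀ f, 0 ≤ p f := fun f => le_csInf ⟨_, hbase f⟩ fun c hc => hnn _ hc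
  have hpn : ∀ f, p f ≤ ‖f‖ := fun f => hle (hbase f)
  have hpadd : ∀ f g, p (f + g) ≤ p f + p g := by
    intro f g
    refine le_of_forall_pos_le_add fun ε hε => ?_
    obtain ⟨c, hc, hcU⟩ := hlt (show p f < p f + ε / 2 by linarith)
    obtain ⟨d, hd, hdU⟩ := hlt (show p g < p g + ε / 2 by linarith)
    have : p (f + g) ≤ c + d := hle (add_mem hcU hdU)
    linarith
  have hpmul : ∀ f g, p (f * g) ≤ p f * p g := by
    intro f g
    have key : ∀ c d, p f < c → p g < d → p (f * g) ≤ c * d := by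
      intro c d hc hd
      obtain ⟨c', hc', hcU⟩ := hlt hc
      obtain ⟨d', hd', hdU⟩ := hlt hd
      have h1 : p (f * g) ≤ c' * d' := hle (mul_mem hcU hdU)
      refine h1.trans ?_
      exact mul_le_mul hc'.le hd'.le (hnn _ hdU) ((hnn _ hcU).trans hc'.le)
    have ht : Filter.Tendsto (fun ε : ℝ => (p f + ε) * (p g + ε)) (𝓝[>] 0) (𝓝 (p f * p g)) := by
      have : Continuous (fun ε : ℝ => (p f + ε) * (p g + ε)) := by fun_prop
      have h2 := (this.tendsto 0).mono_left (nhdsWithin_le_nhds (s := Ioi (0 : ℝ)))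
      simpa using h2
    refine ge_of_tendsto ht ?_
    filter_upwards [self_mem_nhdsWithin] with ε hε
    have hε' : (0 : ℝ) < ε := hε
    exact key _ _ (by linarith) (by linarith)
  have hpzero : p 0 = 0 := le_antisymm (by simpa using hpn 0) (hp0 0)
  have hpneg : ∀ f, p (-f) ≤ p f := by
    intro f
    have h := hpmul (-1) f
    have h1 : p (-1) ≤ 1 := (hpn _).trans (by simpa using hone)
    have h2 := hp0 f
    rw [neg_one_mul] at h
    nlinarith
  let P : RingSeminorm D :=
    { toFun := p
      map_zero' := hpzero
      add_le' := hpadd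
      neg' := fun f => le_antisymm (hpneg f) (by simpa using hpneg (-f))
      mul_le' := hpmul }
  have hsmul : ∀ (z : ℂ) (f : D), P (z • f) ≤ ‖z‖ * P f := by
    intro z f
    have h := hpmul (z • (1 : D)) f
    have h1 : p (z • (1 : D)) ≤ ‖z‖ := (hpn _).trans
      ((norm_smul_le z 1).trans (by nlinarith [norm_nonneg z]))
    rw [smul_mul_assoc, one_mul] at h
    show p (z • f) ≤ ‖z‖ * p f
    nlinarith [hp0 f]
  obtain ⟨Q, i1, i2, i3, ι, hdense, hιn'⟩ := arens_completion P hsmul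
  have hιn : ∀ f : D, ‖ι f‖ = p f := hιn'
  refine ⟨Q, i1, i2, i3, ι, hdense, ?_, ?_, ?_, ?_⟩
  · intro f
    rw [hιn]; exact hpn f
  · rw [hιn]
    have := hgen 1 1 r₂ (by
      have : arensWeight r₁ r₂ 1 = r₂ := by simp [arensWeight, h₁₂]
      rw [this]; nlinarith)
    exact hle (by simpa using this)
  · rw [hιn]
    have := hgen (-1) 1 r₁⁻¹ (by
      have : arensWeight r₁ r₂ (-1) = r₁⁻¹ := by
        simp only [arensWeight, zpow_neg, zpow_one]
        exact max_eq_right (inv_anti₀ h₁ h₁₂)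
      rw [this]
      have : 0 < r₁⁻¹ := inv_pos.2 h₁
      nlinarith)
    exact hle (by simpa using this)
  · intro f c hc
    rw [hιn] at hc
    obtain ⟨c', hc', hcU⟩ := hlt hc
    have key : ∀ q ∈ U, ∃ f₁ f₂ : D, q.1 = f₁ + f₂ ∧ (f₁, q.2) ∈ U ∧ (f₂, q.2) ∈ U ∧
        ∀ χ : D →+* ℂ, (∀ g, ‖χ g‖ ≤ ‖g‖) →
          (‖χ w‖ ≤ r₂ → ‖χ f₁‖ ≤ q.2) ∧ (r₁ ≤ ‖χ w‖ → ‖χ f₂‖ ≤ q.2) := by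
      intro q hq
      rw [hmemU] at hq
      induction hq using AddSubmonoid.closure_induction with
      | zero => exact ⟨0, 0, by simp, zero_mem U, zero_mem U, fun χ _ => by simp⟩
      | add x y _ _ hx hy =>
        obtain ⟨x₁, x₂, hxe, hx1, hx2, hxχ⟩ := hx
        obtain ⟨y₁, y₂, hye, hy1, hy2, hyχ⟩ := hy
        refine ⟨x₁ + y₁, x₂ + y₂, ?_, ?_, ?_, ?_⟩
        · rw [Prod.fst_add, hxe, hye]; ring
        · exact add_mem hx1 hy1
        · exact add_mem hx2 hy2
        · intro χ hχ
          refine ⟨fun h => ?_, fun h => ?_⟩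
          · rw [map_add]
            exact (norm_add_le _ _).trans (add_le_add ((hxχ χ hχ).1 h) ((hyχ χ hχ).1 h))
          · rw [map_add]
            exact (norm_add_le _ _).trans (add_le_add ((hxχ χ hχ).2 h) ((hyχ χ hχ).2 h))
      | mem x hx =>
        obtain ⟨k, g, hf, hc⟩ := hx
        have hx2 : 0 ≤ x.2 := (mul_nonneg (norm_nonneg _) (hw _).le).trans hc
        have hzero : ((0 : D), x.2) ∈ U := by
          have := hgen 0 0 x.2 (by simpa using hx2)
          simpa using this
        have hxU : (x.1, x.2) ∈ U := by
          rw [hf]; exact hgen k g x.2 hc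
        have hχw : ∀ (χ : D →+* ℂ) (k : ℤ), χ (↑(w ^ k) : D) = (χ w) ^ k := by
          intro χ k
          have h := map_zpow (Units.map (χ : D →* ℂ)) w k
          have h2 := congrArg (fun u : ℂˣ => (u : ℂ)) h
          simp only [Units.coe_map, Units.val_zpow_eq_zpow_val] at h2
          exact h2
        have hχ0 : ∀ (χ : D →+* ℂ), χ w ≠ 0 := fun χ => (w.isUnit.map χ).ne_zero
        rcases le_or_gt 0 k with hk | hk
        · refine ⟨x.1, 0, by simp, hxU, hzero, fun χ hχ => ⟨fun h => ?_, fun _ => by simpa using hx2⟩⟩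
          rw [hf, map_mul, norm_mul, hχw, norm_zpow]
          refine le_trans (mul_le_mul (hχ g) ?_ (by positivity) (norm_nonneg _)) hc
          exact le_trans (zpow_le_zpow_left₀ hk (norm_nonneg _) h) (le_max_left _ _)
        · refine ⟨0, x.1, by simp, hzero, hxU, fun χ hχ => ⟨fun _ => by simpa using hx2, fun h => ?_⟩⟩
          rw [hf, map_mul, norm_mul, hχw, norm_zpow]
          refine le_trans (mul_le_mul (hχ g) ?_ (by positivity) (norm_nonneg _)) hc
          refine le_trans ?_ (le_max_right _ _)
          obtain ⟨m, rfl⟩ : ∃ m : ℤ, k = -m := ⟨-k, by ring⟩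
          rw [zpow_neg, zpow_neg]
          exact inv_anti₀ (zpow_pos h₁ _) (zpow_le_zpow_left₀ (by linarith) h₁.le h)
    obtain ⟨f₁, f₂, he, hf1, hf2, hχ⟩ := key _ hcU
    refine ⟨f₁, f₂, he, ?_, ?_, fun χ hχ' => ⟨fun h => ?_, fun h => ?_⟩⟩
    · rw [hιn]; exact (hle hf1).trans hc'.le
    · rw [hιn]; exact (hle hf2).trans hc'.le
    · exact ((hχ χ hχ').1 h).trans hc'.le
    · exact ((hχ χ hχ').2 h).trans hc'.le

end Loc

end PartP2

section PartP3a

/-! ### Matrices over a full function algebra -/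

section MatrixBasics

universe u

open Filter Topology Set

attribute [local instance] Matrix.linftyOpNormedRing Matrix.linftyOpNormedAlgebra

lemma arens_entry_le {D : Type*} [NormedCommRing D] {n : ℕ} (M : Matrix (Fin n) (Fin n) D)
    (i j : Fin n) : ‖M i j‖ ≤ ‖M‖ := by
  rw [Matrix.linfty_opNorm_def]
  have h1 : ‖M i j‖₊ ≤ ∑ j, ‖M i j‖₊ :=
    Finset.single_le_sum (f := fun j => ‖M i j‖₊) (fun _ _ => zero_le) (Finset.mem_univ j)
  have h2 : (∑ j, ‖M i j‖₊) ≤ Finset.univ.sup fun i => ∑ j, ‖M i j‖₊ :=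
    Finset.le_sup (f := fun i => ∑ j, ‖M i j‖₊) (Finset.mem_univ i)
  exact_mod_cast h1.trans h2

lemma arens_norm_le {D : Type*} [NormedCommRing D] {n : ℕ} (M : Matrix (Fin n) (Fin n) D)
    (c : ℝ) (hc : 0 ≤ c) (h : ∀ i j, ‖M i j‖ ≤ c) : ‖M‖ ≤ (n + 1) * c := by
  lift c to NNReal using hc
  rw [Matrix.linfty_opNorm_def]
  have : (Finset.univ.sup fun i => ∑ j, ‖M i j‖₊) ≤ ((n : NNReal) + 1) * c := by
    refine Finset.sup_le fun i _ => ?_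
    calc (∑ j, ‖M i j‖₊) ≤ ∑ _j : Fin n, c := Finset.sum_le_sum fun j _ => by exact_mod_cast h i j
      _ = n * c := by simp
      _ ≤ ((n : NNReal) + 1) * c := by gcongr; exact le_self_add
  exact_mod_cast this

variable {D E : Type*} [NormedCommRing D] [NormedAlgebra ℂ D] [NormedCommRing E]
  [NormedAlgebra ℂ E] {n : ℕ}

lemma arens_map_norm_le (φ : D →ₐ[ℂ] E) (hφ : ∀ f, ‖φ f‖ ≤ ‖f‖) (M : Matrix (Fin n) (Fin n) D) :
    ‖φ.mapMatrix M‖ ≤ ‖M‖ := by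
  rw [Matrix.linfty_opNorm_def, Matrix.linfty_opNorm_def]
  have : (Finset.univ.sup fun i => ∑ j, ‖φ.mapMatrix M i j‖₊) ≤
      Finset.univ.sup fun i => ∑ j, ‖M i j‖₊ := by
    refine Finset.sup_mono_fun fun i _ => Finset.sum_le_sum fun j _ => ?_
    exact hφ (M i j)
  exact_mod_cast this

lemma arens_map_continuous (φ : D →ₐ[ℂ] E) (hφ : ∀ f, ‖φ f‖ ≤ ‖f‖) :
    Continuous (φ.mapMatrix : Matrix (Fin n) (Fin n) D →ₐ[ℂ] Matrix (Fin n) (Fin n) E) :=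
  AddMonoidHomClass.continuous_of_bound
    (φ.mapMatrix : Matrix (Fin n) (Fin n) D →ₐ[ℂ] Matrix (Fin n) (Fin n) E) 1
    (fun M => by rw [one_mul]; exact arens_map_norm_le φ hφ M)

lemma arens_map_denseRange (φ : D →ₐ[ℂ] E) (hφ : DenseRange φ) :
    DenseRange (φ.mapMatrix : Matrix (Fin n) (Fin n) D →ₐ[ℂ] Matrix (Fin n) (Fin n) E) := by
  refine Metric.denseRange_iff.2 ?_
  intro M r hr
  have hr' : 0 < r / (2 * (n + 1)) := by positivity
  choose N hN using fun i j => Metric.denseRange_iff.1 hφ (M i j) _ hr'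
  refine ⟨Matrix.of N, ?_⟩
  rw [dist_eq_norm]
  refine lt_of_le_of_lt (arens_norm_le _ _ hr'.le fun i j => ?_) (b := (n + 1) * (r / (2 * (n + 1)))) ?_
  · have := hN i j
    rw [dist_eq_norm] at this
    exact this.le
  · have : ((n : ℝ) + 1) * (r / (2 * (n + 1))) = r / 2 := by field_simp
    rw [this]; linarith

/-- `D` is (isometrically) an algebra of functions on `Y` all of whose characters are
evaluations. -/
structure ArensFull (D : Type*) [NormedCommRing D] [NormedAlgebra ℂ D] {Y : Type*}
    (ev : Y → D →ₐ[ℂ] ℂ) : Prop where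
  le : ∀ y f, ‖ev y f‖ ≤ ‖f‖
  of_le : ∀ f c, 0 ≤ c → (∀ y, ‖ev y f‖ ≤ c) → ‖f‖ ≤ c
  full : ∀ χ : D →ₐ[ℂ] ℂ, ∃ y, ∀ f, χ f = ev y f

lemma ArensFull.one_le {Y : Type*} {ev : Y → D →ₐ[ℂ] ℂ} (h : ArensFull D ev) : ‖(1 : D)‖ ≤ 1 :=
  h.of_le 1 1 zero_le_one (fun y => by simp)

/-- The localisation lemma in matrix form. -/
lemma arens_loc_matrix {D : Type u} [NormedCommRing D] [NormedAlgebra ℂ D]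
    {Y : Type*} {ev : Y → D →ₐ[ℂ] ℂ} (hfull : ArensFull D ev) (n : ℕ)
    (w : Dˣ) (r₁ r₂ : ℝ) (h₁ : 0 < r₁) (h₁₂ : r₁ ≤ r₂) :
    ∃ (Q : Type u) (_ : NormedCommRing Q) (_ : NormedAlgebra ℂ Q) (_ : CompleteSpace Q)
      (ι : D →ₐ[ℂ] Q), (∀ f, ‖ι f‖ ≤ ‖f‖) ∧ DenseRange ι ∧
      (∀ g : Matrix (Fin n) (Fin n) D, (∀ y, r₁ ≤ ‖ev y w‖ → ‖ev y w‖ ≤ r₂ →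
        ((ev y).mapMatrix g).det ≠ 0) → IsUnit (ι.mapMatrix g)) ∧
      ∀ (f : Matrix (Fin n) (Fin n) D) (c : ℝ), ‖ι.mapMatrix f‖ < c →
        ∃ f₁ f₂ : Matrix (Fin n) (Fin n) D, f = f₁ + f₂ ∧
          ‖ι.mapMatrix f₁‖ ≤ (n + 1) * c ∧ ‖ι.mapMatrix f₂‖ ≤ (n + 1) * c ∧
          (∀ y, ‖ev y w‖ ≤ r₂ → ‖(ev y).mapMatrix f₁‖ ≤ (n + 1) * c) ∧
          (∀ y, r₁ ≤ ‖ev y w‖ → ‖(ev y).mapMatrix f₂‖ ≤ (n + 1) * c) := by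
  obtain ⟨Q, i1, i2, i3, ι, hd, hle, hw2, hw1, hsp⟩ := arens_loc hfull.one_le w r₁ r₂ h₁ h₁₂
  refine ⟨Q, i1, i2, i3, ι, hle, hd, ?_, ?_⟩
  · intro g hg
    rw [Matrix.isUnit_iff_isUnit_det]
    by_contra hnu
    obtain ⟨χ, hχ⟩ := WeakDual.CharacterSpace.exists_apply_eq_zero hnu
    set χ' : Q →ₐ[ℂ] ℂ := WeakDual.CharacterSpace.toAlgHom χ with hχ'
    have hχ0 : χ' ((ι.mapMatrix g).det) = 0 := hχ
    obtain ⟨y, hy⟩ := hfull.full (χ'.comp ι)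
    have hone : ‖(1 : Q)‖ ≤ 1 := by
      have := (hle 1).trans hfull.one_le
      rwa [map_one] at this
    have hχle : ∀ q, ‖χ' q‖ ≤ ‖q‖ := fun q =>
      (AlgHom.norm_apply_le_self_mul_norm_one χ' q).trans
        (by nlinarith [norm_nonneg q])
    have hb : ‖ev y (w : D)‖ ≤ r₂ := by
      rw [← hy]; exact (hχle _).trans hw2
    have ha : r₁ ≤ ‖ev y (w : D)‖ := by
      have h := (hχle _).trans hw1
      have h' : ‖ev y (↑w⁻¹ : D)‖ ≤ r₁⁻¹ := by rw [← hy]; exact h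
      have hm : ev y (w : D) * ev y (↑w⁻¹ : D) = 1 := by
        rw [← map_mul, Units.mul_inv, map_one]
      have hm' : ‖ev y (w : D)‖ * ‖ev y (↑w⁻¹ : D)‖ = 1 := by
        rw [← norm_mul, hm, norm_one]
      have h3 : 1 ≤ ‖ev y (w : D)‖ * r₁⁻¹ := by
        rw [← hm']; gcongr
      rw [← div_eq_mul_inv, le_div_iff₀ h₁] at h3
      linarith
    refine hg y ha hb ?_
    have e1 : ((ev y).mapMatrix g).det = ev y g.det := (AlgHom.map_det (ev y) g).symm
    rw [e1, ← hy]
    have e2 : (ι.mapMatrix g).det = ι g.det := (AlgHom.map_det ι g).symm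
    rw [e2] at hχ0
    exact hχ0
  · intro f c hc
    have hc0 : 0 ≤ c := (norm_nonneg _).trans hc.le
    choose F₁ F₂ he h1 h2 h3 using fun i j => hsp (f i j) c
      (lt_of_le_of_lt (arens_entry_le (ι.mapMatrix f) i j) hc)
    refine ⟨Matrix.of F₁, Matrix.of F₂, ?_, ?_, ?_, ?_, ?_⟩
    · ext i j; exact he i j
    · exact arens_norm_le _ _ hc0 fun i j => h1 i j
    · exact arens_norm_le _ _ hc0 fun i j => h2 i j
    · exact fun y hy => arens_norm_le _ _ hc0 fun i j =>
        (h3 i j (ev y : D →+* ℂ) (hfull.le y)).1 hy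
    · exact fun y hy => arens_norm_le _ _ hc0 fun i j =>
        (h3 i j (ev y : D →+* ℂ) (hfull.le y)).2 hy

end MatrixBasics

end PartP3a

section PartP3b

section CoreV

open Filter Topology Set

lemma arens_core_v {𝔸 𝔹 𝕄 : Type*} [NormedRing 𝔸] [NormedAlgebra ℂ 𝔸] [CompleteSpace 𝔸]
    [NormedRing 𝔹] [NormedAlgebra ℂ 𝔹] [CompleteSpace 𝔹]
    [NormedRing 𝕄] [NormedAlgebra ℂ 𝕄] [CompleteSpace 𝕄]
    {Y : Type*} (ev : Y → 𝔸 →ₐ[ℂ] 𝕄) (hev : ∀ y, Continuous (ev y))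
    (I : 𝔸 →ₐ[ℂ] 𝔹) (hIc : Continuous I) (hId : DenseRange I) (Z : Set Y)
    (γ : unitInterval → 𝔸) (hγ : Continuous γ)
    (hγu : ∀ τ, IsUnit (I (γ τ)))
    (hZ : ∀ τ, ∀ y ∈ Z, ev y (γ τ) = ev y (γ 0))
    (c₀ : ℝ) (hc₀ : 0 < c₀) :
    ∃ (v : 𝔸ˣ) (u : 𝔹), ‖u‖ < c₀ ∧ (∀ y ∈ Z, ev y (v : 𝔸) = 1) ∧
      I (γ 1 * (v : 𝔸)) = I (γ 0) * (1 + u) := by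
  let _ : NormedAlgebra ℚ 𝔸 := NormedAlgebra.restrictScalars ℚ ℂ 𝔸
  let _ : NormedAlgebra ℚ 𝕄 := NormedAlgebra.restrictScalars ℚ ℂ 𝕄
  let J : AddSubgroup 𝔸 :=
    { carrier := {b | ∀ y ∈ Z, ev y b = 0}
      add_mem' := fun {a b} ha hb y hy => by rw [map_add, ha y hy, hb y hy, add_zero]
      zero_mem' := fun y _ => map_zero _
      neg_mem' := fun {a} ha y hy => by rw [map_neg, ha y hy, neg_zero] }
  obtain ⟨g, hg⟩ := hγu 0
  have hJ : ∀ x : 𝔸, ∀ b ∈ J, x * b ∈ J := by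
    intro x b hb y hy
    rw [map_mul, hb y hy, mul_zero]
  have hexp1 : ∀ b ∈ J, ∀ y ∈ Z, ev y (NormedSpace.exp b) = 1 := by
    intro b hb y hy
    rw [NormedSpace.map_exp (ev y) (hev y) b, hb y hy, NormedSpace.exp_zero]
  have hJexp : ∀ b ∈ J, NormedSpace.exp b - 1 ∈ J := by
    intro b hb y hy
    rw [map_sub, hexp1 b hb y hy, map_one, sub_self]
  set γ' : unitInterval → 𝔹 := fun τ => (↑g⁻¹ : 𝔹) * I (γ τ) with hγ'
  have hcont : Continuous γ' := continuous_const.mul (hIc.comp hγ)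
  have h0 : γ' 0 = 1 := by
    show (↑g⁻¹ : 𝔹) * I (γ 0) = 1
    rw [← hg, Units.inv_mul]
  have hu : ∀ τ, IsUnit (γ' τ) := fun τ => (g⁻¹).isUnit.mul (hγu τ)
  have hE : ∀ τ, γ' τ - 1 ∈ closure ((I : 𝔸 →+* 𝔹) '' (J : Set 𝔸)) := by
    intro τ
    have hb : γ τ - γ 0 ∈ J := by
      intro y hy
      rw [map_sub, hZ τ y hy, sub_self]
    have e : γ' τ - 1 = (↑g⁻¹ : 𝔹) * I (γ τ - γ 0) := by
      rw [← h0, map_sub, mul_sub]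
    rw [e]
    exact arens_E_left (I : 𝔸 →+* 𝔹) J hId hJ rfl _ _ (subset_closure ⟨_, hb, rfl⟩)
  have hinv : ∀ᶠ X in 𝓝 (γ' 1), ‖γ' 1 * Ring.inverse X - 1‖ < c₀ := by
    obtain ⟨x, hx⟩ := hu 1
    have h1 : ContinuousAt (Ring.inverse : 𝔹 → 𝔹) (γ' 1) := by
      rw [← hx]; exact NormedRing.inverse_continuousAt x
    have h2 : ContinuousAt (fun X => γ' 1 * Ring.inverse X - 1) (γ' 1) :=
      (continuousAt_const.mul h1).sub continuousAt_const
    have h3 := h2.norm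
    have h4 : ‖γ' 1 * Ring.inverse (γ' 1) - 1‖ < c₀ := by
      rw [Ring.mul_inverse_cancel _ (hu 1)]; simpa using hc₀
    exact h3.eventually_lt continuousAt_const h4
  obtain ⟨ε, hε, hball⟩ := Metric.eventually_nhds_iff.1 hinv
  obtain ⟨v, hv, hvε⟩ := arens_approx_exp (I : 𝔸 →+* 𝔹) J hIc hId hJ hJexp γ' hcont h0 hu hE ε hε
  have hv' : IsUnit v ∧ ∀ y ∈ Z, ev y v = 1 := by
    clear hvε
    induction hv using Submonoid.closure_induction with
    | mem x hx =>
      obtain ⟨b, hb, rfl⟩ := hx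
      exact ⟨NormedSpace.isUnit_exp b, hexp1 b hb⟩
    | one => exact ⟨isUnit_one, fun y _ => map_one _⟩
    | mul x y _ _ hx hy =>
      exact ⟨hx.1.mul hy.1, fun z hz => by rw [map_mul, hx.2 z hz, hy.2 z hz, one_mul]⟩
  obtain ⟨⟨V, rfl⟩, hVZ⟩ := hv'
  have hclose : ‖γ' 1 * Ring.inverse (I V) - 1‖ < c₀ := hball (by rw [dist_eq_norm]; exact hvε)
  have hinvV : Ring.inverse (I V) = I (↑V⁻¹ : 𝔸) := by
    have : I V = ((Units.map (I : 𝔸 →* 𝔹) V : 𝔹ˣ) : 𝔹) := rfl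
    rw [this, Ring.inverse_unit]; rfl
  refine ⟨V⁻¹, γ' 1 * I (↑V⁻¹ : 𝔸) - 1, ?_, ?_, ?_⟩
  · rw [← hinvV]; exact hclose
  · intro y hy
    have h := hVZ y hy
    have h2 : ev y (V : 𝔸) * ev y (↑V⁻¹ : 𝔸) = 1 := by
      rw [← map_mul, Units.mul_inv, map_one]
    rwa [h, one_mul] at h2
  · rw [add_sub_cancel, map_mul]
    show I (γ 1) * _ = _ * ((↑g⁻¹ : 𝔹) * I (γ 1) * _)
    rw [← hg, ← mul_assoc, ← mul_assoc, Units.mul_inv, one_mul]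

/-- Solving the additive Cousin type problem by iteration. -/
lemma arens_core_iter {𝔸 𝔹 𝕄 : Type*} [NormedRing 𝔸] [NormedAlgebra ℂ 𝔸] [CompleteSpace 𝔸]
    [NormedRing 𝔹] [NormedAlgebra ℂ 𝔹]
    [NormedRing 𝕄] [NormedAlgebra ℂ 𝕄] [CompleteSpace 𝕄]
    {Y : Type*} (ev : Y → 𝔸 →ₐ[ℂ] 𝕄) (hev : ∀ y f, ‖ev y f‖ ≤ ‖f‖)
    (I : 𝔸 →ₐ[ℂ] 𝔹) (hId : DenseRange I) (K : ℝ) (hK : 1 ≤ K)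
    (hrec : ∀ f c, 0 ≤ c → (∀ y, ‖ev y f‖ ≤ c) → ‖f‖ ≤ K * c)
    (S₁ S₂ : Set Y) (hS : ∀ y, y ∈ S₁ ∨ y ∈ S₂)
    (hsplit : ∀ (f : 𝔸) (c : ℝ), ‖I f‖ < c → ∃ f₁ f₂ : 𝔸, f = f₁ + f₂ ∧
      ‖I f₁‖ ≤ K * c ∧ ‖I f₂‖ ≤ K * c ∧
      (∀ y ∈ S₁, ‖ev y f₁‖ ≤ K * c) ∧ (∀ y ∈ S₂, ‖ev y f₂‖ ≤ K * c))
    (η : ℝ) (c₀ : ℝ) (hc₀ : 0 < c₀) (hcη : 2 * K * c₀ ≤ η) (hc4 : 4 * K * c₀ ≤ 1)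
    (g₁ g₂ : 𝔸) (u : 𝔹) (hu : ‖u‖ < c₀) (hg : I g₂ = I g₁ * (1 + u)) :
    ∃ (M : 𝔸) (β : Y → 𝕄),
      (∀ y ∈ S₁, ∃ k, ev y M = ev y g₁ * k ∧ ‖k - 1‖ ≤ η) ∧
      (∀ y ∈ S₂, ev y M = ev y g₂ * β y ∧ ‖β y - 1‖ ≤ η) ∧
      (∀ δ > 0, ∃ c : 𝔸, ∀ y ∈ S₂, ‖ev y c - β y‖ ≤ δ) := by
  have hK0 : 0 < K := by linarith
  -- one step of the iteration
  have step : ∀ (a b : 𝔸) (c : ℝ), ‖u * (1 + I b) + I b - I a‖ < c → ∃ a' b' : 𝔸,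
      ‖u * (1 + I b') + I b' - I a'‖ < c / 2 ∧ (∀ y ∈ S₁, ‖ev y (a' - a)‖ ≤ K * c) ∧
      (∀ y ∈ S₂, ‖ev y (b' - b)‖ ≤ K * c) := by
    intro a b c hc
    have hc0 : 0 < c := (norm_nonneg _).trans_lt hc
    set r := u * (1 + I b) + I b - I a with hr
    obtain ⟨r', hr'⟩ := Metric.denseRange_iff.1 hId r (min (c / 4) (c - ‖r‖))
      (lt_min (by linarith) (by linarith))
    rw [dist_eq_norm, lt_min_iff] at hr'
    have hIr' : ‖I r'‖ < c := by
      have : ‖I r'‖ ≤ ‖r‖ + ‖r - I r'‖ := by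
        have := norm_sub_le r (r - I r')
        rwa [sub_sub_cancel] at this
      linarith [hr'.2]
    obtain ⟨r₁, r₂, he, _, hI2, hs1, hs2⟩ := hsplit r' c hIr'
    refine ⟨a + r₁, b - r₂, ?_, ?_, ?_⟩
    · have e : u * (1 + I (b - r₂)) + I (b - r₂) - I (a + r₁) = (r - I r') - u * I r₂ := by
        rw [hr, he, map_sub, map_add, map_add]; noncomm_ring
      rw [e]
      have h1 : ‖u * I r₂‖ ≤ c₀ * (K * c) :=
        (norm_mul_le _ _).trans (mul_le_mul hu.le hI2 (norm_nonneg _) hc₀.le)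
      have h2 : c₀ * (K * c) ≤ c / 4 := by nlinarith
      have h3 := norm_sub_le (r - I r') (u * I r₂)
      linarith [hr'.1]
    · intro y hy; rw [add_sub_cancel_left]; exact hs1 y hy
    · intro y hy
      rw [sub_sub_cancel_left, map_neg, norm_neg]; exact hs2 y hy
  choose! fa fb hf1 hf2 hf3 using step
  let s : ℕ → 𝔸 × 𝔸 := fun m => Nat.rec (0, 0)
    (fun m p => (fa p.1 p.2 (c₀ / 2 ^ m), fb p.1 p.2 (c₀ / 2 ^ m))) m
  set a : ℕ → 𝔸 := fun m => (s m).1 with ha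
  set b : ℕ → 𝔸 := fun m => (s m).2 with hb
  have hres : ∀ m, ‖u * (1 + I (b m)) + I (b m) - I (a m)‖ < c₀ / 2 ^ m := by
    intro m
    induction m with
    | zero =>
      show ‖u * (1 + I 0) + I 0 - I 0‖ < c₀ / 2 ^ 0
      simpa using hu
    | succ m ih =>
      have := hf1 _ _ _ ih
      rw [pow_succ, ← div_div]
      exact this
  have hda : ∀ m, ∀ y ∈ S₁, ‖ev y (a (m + 1) - a m)‖ ≤ K * (c₀ / 2 ^ m) :=
    fun m => hf2 _ _ _ (hres m)
  have hdb : ∀ m, ∀ y ∈ S₂, ‖ev y (b (m + 1) - b m)‖ ≤ K * (c₀ / 2 ^ m) :=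
    fun m => hf3 _ _ _ (hres m)
  have ha0 : a 0 = 0 := rfl
  have hb0 : b 0 = 0 := rfl
  -- limits of the two sequences
  have hlim : ∀ (S : Set Y) (a : ℕ → 𝔸), a 0 = 0 →
      (∀ m, ∀ y ∈ S, ‖ev y (a (m + 1) - a m)‖ ≤ K * (c₀ / 2 ^ m)) →
      ∃ l : Y → 𝕄, ∀ y ∈ S, Tendsto (fun m => ev y (a m)) atTop (𝓝 (l y)) ∧
        ‖l y‖ ≤ 2 * K * c₀ ∧ ∀ m, ‖ev y (a m) - l y‖ ≤ 2 * K * c₀ / 2 ^ m := by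
    intro S a ha0 hda
    have hC : ∀ y ∈ S, ∀ m, dist (ev y (a m)) (ev y (a (m + 1))) ≤ (2 * K * c₀) / 2 / 2 ^ m := by
      intro y hy m
      rw [dist_comm, dist_eq_norm, ← map_sub]
      refine (hda m y hy).trans (le_of_eq ?_)
      ring
    have hex : ∀ y, ∃ l, y ∈ S → Tendsto (fun m => ev y (a m)) atTop (𝓝 l) := by
      intro y
      by_cases hy : y ∈ S
      · obtain ⟨l, hl⟩ := cauchySeq_tendsto_of_complete (cauchySeq_of_le_geometric_two (hC y hy))
        exact ⟨l, fun _ => hl⟩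
      · exact ⟨0, fun h => absurd h hy⟩
    choose l hl using hex
    refine ⟨l, fun y hy => ⟨hl y hy, ?_, fun m => ?_⟩⟩
    · have := dist_le_of_le_geometric_two_of_tendsto₀ (hC y hy) (hl y hy)
      rwa [ha0, map_zero, dist_comm, dist_zero_right] at this
    · rw [← dist_eq_norm]
      exact dist_le_of_le_geometric_two_of_tendsto (hC y hy) (hl y hy) m
  obtain ⟨la, hla⟩ := hlim S₁ a ha0 hda
  obtain ⟨lb, hlb⟩ := hlim S₂ b hb0 hdb
  -- the approximate gluing
  set L := ‖I g₁‖ + 1 with hL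
  have hL0 : 0 < L := by positivity
  have hglue : ∀ m, ∃ p q : 𝔸, g₂ * (1 + b m) - g₁ * (1 + a m) = p + q ∧
      (∀ y ∈ S₁, ‖ev y p‖ ≤ K * (L * (c₀ / 2 ^ m))) ∧
      (∀ y ∈ S₂, ‖ev y q‖ ≤ K * (L * (c₀ / 2 ^ m))) := by
    intro m
    have e : I (g₂ * (1 + b m) - g₁ * (1 + a m)) =
        I g₁ * (u * (1 + I (b m)) + I (b m) - I (a m)) := by
      rw [map_sub, map_mul, map_mul, hg, map_add, map_add, map_one]; noncomm_ring
    have hn : ‖I (g₂ * (1 + b m) - g₁ * (1 + a m))‖ < L * (c₀ / 2 ^ m) := by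
      rw [e]
      have hpos : 0 < c₀ / 2 ^ m := by positivity
      calc _ ≤ ‖I g₁‖ * ‖u * (1 + I (b m)) + I (b m) - I (a m)‖ := norm_mul_le _ _
        _ ≤ ‖I g₁‖ * (c₀ / 2 ^ m) := by gcongr; exact (hres m).le
        _ < L * (c₀ / 2 ^ m) := by rw [hL]; nlinarith
    obtain ⟨p, q, h1, _, _, h4, h5⟩ := hsplit _ _ hn
    exact ⟨p, q, h1, h4, h5⟩
  choose p q hpq hp hq using hglue
  set z : ℕ → 𝔸 := fun m => g₁ * (1 + a m) + p m with hz
  have hz' : ∀ m, z m = g₂ * (1 + b m) - q m := by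
    intro m
    have := hpq m
    rw [hz]
    rw [sub_eq_iff_eq_add] at this
    simp only [this]; abel
  set G := ‖g₁‖ + ‖g₂‖ with hG
  have hdz : ∀ m y, ‖ev y (z m - z (m + 1))‖ ≤ (G * K * c₀ + 2 * K * L * c₀) / 2 ^ m := by
    intro m y
    have hm : (2 : ℝ)^m ≤ 2^(m+1) := by rw [pow_succ]; nlinarith [pow_pos (two_pos : (0:ℝ) < 2) m]
    have hmono : K * (L * (c₀ / 2 ^ (m + 1))) ≤ K * (L * (c₀ / 2 ^ m)) := by
      gcongr
    have hval : (G * K * c₀ + 2 * K * L * c₀) / 2 ^ m =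
        G * (K * (c₀ / 2 ^ m)) + K * (L * (c₀ / 2 ^ m)) + K * (L * (c₀ / 2 ^ m)) := by ring
    rw [hval]
    have hpos : 0 ≤ K * (c₀ / 2 ^ m) := by positivity
    rcases hS y with hy | hy
    · have e : ev y (z m - z (m + 1)) = ev y g₁ * (- ev y (a (m + 1) - a m)) + ev y (p m)
          - ev y (p (m + 1)) := by
        simp only [hz, map_sub, map_add, map_mul, map_one]; noncomm_ring
      rw [e]
      refine (norm_sub_le _ _).trans (add_le_add ((norm_add_le _ _).trans (add_le_add ?_ ?_)) ?_)
      · refine (norm_mul_le _ _).trans ?_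
        rw [norm_neg]
        refine mul_le_mul ((hev y g₁).trans ?_) (hda m y hy) (norm_nonneg _) (by positivity)
        rw [hG]; linarith [norm_nonneg g₂]
      · exact hp m y hy
      · exact (hp (m + 1) y hy).trans hmono
    · have e : ev y (z m - z (m + 1)) = ev y g₂ * (- ev y (b (m + 1) - b m)) - ev y (q m)
          + ev y (q (m + 1)) := by
        simp only [hz', map_sub, map_add, map_mul, map_one]; noncomm_ring
      rw [e]
      refine (norm_add_le _ _).trans (add_le_add ((norm_sub_le _ _).trans (add_le_add ?_ ?_)) ?_)
      · refine (norm_mul_le _ _).trans ?_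
        rw [norm_neg]
        refine mul_le_mul ((hev y g₂).trans ?_) (hdb m y hy) (norm_nonneg _) (by positivity)
        rw [hG]; linarith [norm_nonneg g₁]
      · exact hq m y hy
      · exact (hq (m + 1) y hy).trans hmono
  have hcz : CauchySeq z := by
    refine cauchySeq_of_le_geometric_two (C := 2 * (K * (G * K * c₀ + 2 * K * L * c₀))) fun m => ?_
    rw [dist_eq_norm]
    refine (hrec _ _ (by positivity) (hdz m)).trans (le_of_eq ?_)
    ring
  obtain ⟨M, hM⟩ := cauchySeq_tendsto_of_complete hcz
  have hevc : ∀ y, Continuous (ev y) := fun y =>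
    AddMonoidHomClass.continuous_of_bound (ev y) 1 (fun f => by rw [one_mul]; exact hev y f)
  have hevM : ∀ y, Tendsto (fun m => ev y (z m)) atTop (𝓝 (ev y M)) := fun y =>
    ((hevc y).tendsto M).comp hM
  have hzero : Tendsto (fun m : ℕ => K * (L * (c₀ / 2 ^ m))) atTop (𝓝 0) := by
    have h1 : Tendsto (fun m : ℕ => (K * L * c₀) * (1 / 2 : ℝ) ^ m) atTop (𝓝 ((K * L * c₀) * 0)) :=
      (tendsto_pow_atTop_nhds_zero_of_lt_one (by norm_num) (by norm_num)).const_mul _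
    rw [mul_zero] at h1
    refine h1.congr fun m => ?_
    rw [one_div, inv_pow]; ring
  refine ⟨M, fun y => 1 + lb y, ?_, ?_, ?_⟩
  · intro y hy
    obtain ⟨h1, h2, _⟩ := hla y hy
    refine ⟨1 + la y, ?_, by rw [add_sub_cancel_left]; exact h2.trans hcη⟩
    have hp0 : Tendsto (fun m => ev y (p m)) atTop (𝓝 0) :=
      squeeze_zero_norm (fun m => hp m y hy) hzero
    have h3 : Tendsto (fun m => ev y g₁ * (1 + ev y (a m)) + ev y (p m)) atTop
        (𝓝 (ev y g₁ * (1 + la y) + 0)) := ((h1.const_add 1).const_mul _).add hp0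
    rw [add_zero] at h3
    refine tendsto_nhds_unique (hevM y) (h3.congr fun m => ?_)
    simp only [hz, map_add, map_mul, map_one]
  · intro y hy
    obtain ⟨h1, h2, _⟩ := hlb y hy
    refine ⟨?_, by rw [add_sub_cancel_left]; exact h2.trans hcη⟩
    have hq0 : Tendsto (fun m => ev y (q m)) atTop (𝓝 0) :=
      squeeze_zero_norm (fun m => hq m y hy) hzero
    have h3 : Tendsto (fun m => ev y g₂ * (1 + ev y (b m)) - ev y (q m)) atTop
        (𝓝 (ev y g₂ * (1 + lb y) - 0)) := ((h1.const_add 1).const_mul _).sub hq0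
    rw [sub_zero] at h3
    refine tendsto_nhds_unique (hevM y) (h3.congr fun m => ?_)
    simp only [hz', map_sub, map_add, map_mul, map_one]
  · intro δ hδ
    obtain ⟨m, hm⟩ := exists_pow_lt_of_lt_one (show 0 < δ / (2 * K * c₀) by positivity)
      (show (1 / 2 : ℝ) < 1 by norm_num)
    refine ⟨1 + b m, fun y hy => ?_⟩
    rw [map_add, map_one, add_sub_add_left_eq_sub]
    refine ((hlb y hy).2.2 m).trans ?_
    rw [lt_div_iff₀ (by positivity), one_div, inv_pow] at hm
    rw [div_eq_inv_mul]
    exact hm.le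

end CoreV

end PartP3b

section PartP3c

section Core

open Filter Topology Set

attribute [local instance] Matrix.linftyOpNormedRing Matrix.linftyOpNormedAlgebra

lemma arens_matrix_complete (D : Type*) [NormedCommRing D] [CompleteSpace D] (n : ℕ) :
    @CompleteSpace (Matrix (Fin n) (Fin n) D) PseudoMetricSpace.toUniformSpace :=
  Matrix.instCompleteSpace (Fin n) (Fin n) D

lemma arens_core {D : Type*} [NormedCommRing D] [NormedAlgebra ℂ D] [CompleteSpace D]
    {Y : Type*} {ev : Y → D →ₐ[ℂ] ℂ} (hfull : ArensFull D ev) {n : ℕ}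
    (w : Dˣ) (r₁ r₂ : ℝ) (h₁ : 0 < r₁) (h₁₂ : r₁ ≤ r₂) (Z : Set Y)
    (γ : unitInterval → Matrix (Fin n) (Fin n) D) (hγ : Continuous γ)
    (hdet : ∀ τ y, r₁ ≤ ‖ev y w‖ → ‖ev y w‖ ≤ r₂ → ((ev y).mapMatrix (γ τ)).det ≠ 0)
    (hZ : ∀ τ, ∀ y ∈ Z, (ev y).mapMatrix (γ τ) = (ev y).mapMatrix (γ 0))
    (η : ℝ) (hη : 0 < η) :
    ∃ (M : Matrix (Fin n) (Fin n) D) (v : (Matrix (Fin n) (Fin n) D)ˣ)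
      (β : Y → Matrix (Fin n) (Fin n) ℂ),
      (∀ y ∈ Z, (ev y).mapMatrix (v : Matrix (Fin n) (Fin n) D) = 1) ∧
      (∀ y, ‖ev y w‖ ≤ r₂ → ∃ k, (ev y).mapMatrix M = (ev y).mapMatrix (γ 0) * k ∧ ‖k - 1‖ ≤ η) ∧
      (∀ y, r₁ ≤ ‖ev y w‖ → (ev y).mapMatrix M = (ev y).mapMatrix (γ 1) *
        (ev y).mapMatrix (v : Matrix (Fin n) (Fin n) D) * β y ∧ ‖β y - 1‖ ≤ η) ∧
      (∀ δ > 0, ∃ c : Matrix (Fin n) (Fin n) D, ∀ y, r₁ ≤ ‖ev y w‖ →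
        ‖(ev y).mapMatrix c - β y‖ ≤ δ) := by
  obtain ⟨Q, i1, i2, i3, ι, hle, hd, hunit, hsp⟩ := arens_loc_matrix hfull n w r₁ r₂ h₁ h₁₂
  set K : ℝ := n + 1 with hK
  have hK1 : 1 ≤ K := by rw [hK]; simp
  have hK0 : 0 < K := by linarith
  set c₀ : ℝ := min (η / (2 * K)) (1 / (4 * K)) with hc₀
  have hc0 : 0 < c₀ := lt_min (by positivity) (by positivity)
  have hcη : 2 * K * c₀ ≤ η := by
    have : c₀ ≤ η / (2 * K) := min_le_left _ _
    rw [le_div_iff₀ (by positivity)] at this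
    linarith
  have hc4 : 4 * K * c₀ ≤ 1 := by
    have : c₀ ≤ 1 / (4 * K) := min_le_right _ _
    rw [le_div_iff₀ (by positivity)] at this
    linarith
  have _ := arens_matrix_complete D n
  have _ := arens_matrix_complete Q n
  have _ := arens_matrix_complete ℂ n
  obtain ⟨v, u, hu, hvZ, hgu⟩ := arens_core_v
    (𝔸 := Matrix (Fin n) (Fin n) D) (𝔹 := Matrix (Fin n) (Fin n) Q)
    (𝕄 := Matrix (Fin n) (Fin n) ℂ) (fun y => (ev y).mapMatrix)
    (fun y => arens_map_continuous (ev y) (hfull.le y)) ι.mapMatrix (arens_map_continuous ι hle)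
    (arens_map_denseRange ι hd) Z γ hγ (fun τ => hunit _ (hdet τ)) hZ c₀ hc0
  obtain ⟨M, β, h1, h2, h3⟩ := arens_core_iter
    (𝔸 := Matrix (Fin n) (Fin n) D) (𝔹 := Matrix (Fin n) (Fin n) Q)
    (𝕄 := Matrix (Fin n) (Fin n) ℂ) (fun y => (ev y).mapMatrix)
    (fun y => arens_map_norm_le (ev y) (hfull.le y)) ι.mapMatrix
    (arens_map_denseRange ι hd) K hK1
    (fun f c hc hf => arens_norm_le _ _ hc fun i j => hfull.of_le _ _ hc fun y =>
      (arens_entry_le ((ev y).mapMatrix f) i j).trans (hf y))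
    {y | ‖ev y w‖ ≤ r₂} {y | r₁ ≤ ‖ev y w‖}
    (fun y => (le_total ‖ev y (w : D)‖ r₂).imp id fun h => h₁₂.trans h)
    (fun f c hc => hsp f c hc) η c₀ hc0 hcη hc4 (γ 0) (γ 1 * v) u hu hgu
  refine ⟨M, v, β, hvZ, h1, ?_, h3⟩
  intro y hy
  obtain ⟨h4, h5⟩ := h2 y hy
  rw [map_mul] at h4
  exact ⟨h4, h5⟩

end Core

end PartP3c

section PartP4

section RE

open Filter Topology Set

lemma arens_ev_continuous {𝔸 𝕄 : Type*} [NormedRing 𝔸] [NormedAlgebra ℂ 𝔸]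
    [NormedRing 𝕄] [NormedAlgebra ℂ 𝕄]
    {Y : Type*} [TopologicalSpace Y] (ev : Y → 𝔸 →ₐ[ℂ] 𝕄)
    (hev : ∀ y f, ‖ev y f‖ ≤ ‖f‖) (hevc : ∀ f, Continuous fun y => ev y f)
    {T : Type*} [TopologicalSpace T] (G : T → 𝔸) (hG : Continuous G) :
    Continuous fun p : T × Y => ev p.2 (G p.1) := by
  rw [continuous_iff_continuousAt]
  rintro ⟨t₀, y₀⟩
  have h1 : Tendsto (fun p : T × Y => ev p.2 (G p.1 - G t₀)) (𝓝 (t₀, y₀)) (𝓝 0) := by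
    have hc : Continuous fun p : T × Y => ‖G p.1 - G t₀‖ := by fun_prop
    refine squeeze_zero_norm (fun p => hev p.2 _) ?_
    have := hc.tendsto (t₀, y₀)
    simpa using this
  have h2 : Tendsto (fun p : T × Y => ev p.2 (G t₀)) (𝓝 (t₀, y₀)) (𝓝 (ev y₀ (G t₀))) :=
    ((hevc (G t₀)).comp continuous_snd).tendsto (t₀, y₀)
  have h3 := h1.add h2
  rw [zero_add] at h3
  refine h3.congr fun p => ?_
  rw [← map_add, sub_add_cancel]

lemma arens_inverse_bdd {𝕄 P : Type*} [NormedRing 𝕄] [CompleteSpace 𝕄] [TopologicalSpace P]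
    (F : P → 𝕄) (hF : Continuous F) (K : Set P) (hK : IsCompact K) (hu : ∀ p ∈ K, IsUnit (F p)) :
    ∃ C, 0 ≤ C ∧ ∀ p ∈ K, ‖Ring.inverse (F p)‖ ≤ C := by
  have : ContinuousOn (fun p => Ring.inverse (F p)) K := by
    intro p hp
    obtain ⟨x, hx⟩ := hu p hp
    have h1 : ContinuousAt Ring.inverse (F p) := by
      rw [← hx]; exact NormedRing.inverse_continuousAt x
    exact (h1.comp (f := F) hF.continuousAt).continuousWithinAt
  obtain ⟨C, hC⟩ := hK.exists_bound_of_continuousOn this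
  exact ⟨max C 0, le_max_right _ _, fun p hp => (hC p hp).trans (le_max_left _ _)⟩

lemma arens_isUnit_of_near_one {𝕄 : Type*} [NormedRing 𝕄] [CompleteSpace 𝕄] (k : 𝕄)
    (hk : ‖k - 1‖ < 1) : IsUnit k := by
  have := isUnit_one_sub_of_norm_lt_one (x := 1 - k) (by rwa [norm_sub_rev])
  rwa [sub_sub_cancel] at this

lemma arens_RE_abs {𝔸 𝕄 : Type*} [NormedRing 𝔸] [NormedAlgebra ℂ 𝔸]
    [NormedRing 𝕄] [NormedAlgebra ℂ 𝕄] [CompleteSpace 𝕄]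
    {Y : Type*} [TopologicalSpace Y] [CompactSpace Y] (ev : Y → 𝔸 →ₐ[ℂ] 𝕄)
    (hev : ∀ y f, ‖ev y f‖ ≤ ‖f‖) (hevc : ∀ f, Continuous fun y => ev y f)
    (h : Y → ℝ) (hh : Continuous h) (Z : Set Y)
    (hcore : ∀ s₁ s₂ : ℝ, s₁ ≤ s₂ → ∀ γ : unitInterval → 𝔸, Continuous γ →
      (∀ τ y, s₁ ≤ h y → h y ≤ s₂ → IsUnit (ev y (γ τ))) →
      (∀ τ, ∀ y ∈ Z, ev y (γ τ) = ev y (γ 0)) → ∀ η > 0,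
      ∃ (M : 𝔸) (v : 𝔸ˣ) (β : Y → 𝕄), (∀ y ∈ Z, ev y (v : 𝔸) = 1) ∧
        (∀ y, h y ≤ s₂ → ∃ k, ev y M = ev y (γ 0) * k ∧ ‖k - 1‖ ≤ η) ∧
        (∀ y, s₁ ≤ h y → ev y M = ev y (γ 1) * ev y (v : 𝔸) * β y ∧ ‖β y - 1‖ ≤ η) ∧
        (∀ δ > 0, ∃ c : 𝔸, ∀ y, s₁ ≤ h y → ‖ev y c - β y‖ ≤ δ))
    (G : ℝ → 𝔸) (hG : Continuous G) (hGZ : ∀ t, ∀ y ∈ Z, ev y (G t) = ev y (G 0))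
    (hGu : ∀ y, IsUnit (ev y (G (h y)))) (η : ℝ) (hη : 0 < η) :
    ∃ M : 𝔸, (∀ y, IsUnit (ev y M)) ∧ ∀ y ∈ Z, ‖ev y M - ev y (G 0)‖ ≤ η := by
  -- the step size
  obtain ⟨δ, hδ, hδu⟩ : ∃ δ > 0, ∀ t y, |t - h y| ≤ δ → IsUnit (ev y (G t)) := by
    have hc : Continuous fun p : ℝ × Y => ev p.2 (G (h p.2 + p.1)) := by
      have h1 := arens_ev_continuous ev hev hevc G hG
      have h2 : Continuous fun p : ℝ × Y => ((h p.2 + p.1, p.2) : ℝ × Y) := by fun_prop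
      exact h1.comp h2
    have hopen : IsOpen {p : ℝ × Y | IsUnit (ev p.2 (G (h p.2 + p.1)))} :=
      Units.isOpen.preimage hc
    have := (isCompact_univ (X := Y)).eventually_forall_of_forall_eventually (x₀ := (0 : ℝ))
      (P := fun ε y => IsUnit (ev y (G (h y + ε))))
      (fun y _ => hopen.mem_nhds (show IsUnit (ev y (G (h y + 0))) by rw [add_zero]; exact hGu y))
    obtain ⟨δ, hδ, hball⟩ := Metric.eventually_nhds_iff.1 this
    refine ⟨δ / 2, by linarith, fun t y ht => ?_⟩
    have := hball (y := t - h y) (by rw [Real.dist_eq, sub_zero]; linarith) y (mem_univ y)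
    rwa [add_sub_cancel] at this
  obtain ⟨L, hL⟩ : ∃ L, ∀ y, |h y| ≤ L := by
    obtain ⟨C, hC⟩ := (isCompact_univ (X := Y)).exists_bound_of_continuousOn hh.continuousOn
    exact ⟨C, fun y => hC y (mem_univ y)⟩
  have hLl : ∀ y, -L ≤ h y := fun y => (abs_le.1 (hL y)).1
  have hLr : ∀ y, h y ≤ L := fun y => (abs_le.1 (hL y)).2
  have main : ∀ j : ℕ, ∀ η > 0, ∃ F : ℝ → 𝔸, Continuous F ∧
      (∀ y, h y ≤ -L - 1 + j * δ → IsUnit (ev y (F (-L - 1 + j * δ)))) ∧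
      (∀ t y, -L - 1 + j * δ ≤ t → -L - 1 + j * δ ≤ h y → |t - h y| ≤ δ → IsUnit (ev y (F t))) ∧
      (∀ t t', ∀ y ∈ Z, ev y (F t) = ev y (F t')) ∧
      (∀ y ∈ Z, ‖ev y (F (-L - 1 + j * δ)) - ev y (G 0)‖ ≤ η) := by
    intro j
    induction j with
    | zero =>
      intro η hη
      refine ⟨G, hG, ?_, ?_, ?_, ?_⟩
      · intro y hy
        have := hLl y
        simp at hy; linarith
      · intro t y _ _ ht; exact hδu t y ht
      · intro t t' y hy; rw [hGZ t y hy, hGZ t' y hy]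
      · intro y hy; rw [hGZ _ y hy, sub_self, norm_zero]; exact hη.le
    | succ j ih =>
      intro η hη
      obtain ⟨F, hF, hb, hc, hd, he⟩ := ih (η / 2) (by linarith)
      set t₀ : ℝ := -L - 1 + j * δ with ht₀
      have ht₁ : -L - 1 + ((j + 1 : ℕ) : ℝ) * δ = t₀ + δ := by rw [ht₀]; push_cast; ring
      rw [ht₁]
      set t₁ : ℝ := t₀ + δ with ht₁'
      set η' : ℝ := min (1 / 4) (η / (2 * (‖F t₀‖ + 1))) with hη'
      have hη'0 : 0 < η' := lt_min (by norm_num) (by positivity)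
      have hη'1 : η' ≤ 1 / 4 := min_le_left _ _
      have hη'2 : ‖F t₀‖ * η' ≤ η / 2 := by
        have h1 : η' ≤ η / (2 * (‖F t₀‖ + 1)) := min_le_right _ _
        rw [le_div_iff₀ (by positivity)] at h1
        nlinarith [norm_nonneg (F t₀)]
      obtain ⟨M, v, β, hvZ, hM1, hM2, hM3⟩ := hcore t₀ t₁ (by linarith)
        (fun τ => F (t₀ + τ * δ)) (by fun_prop)
        (by
          intro τ y hy1 hy2
          have hτ0 : 0 ≤ (τ : ℝ) * δ := mul_nonneg τ.2.1 hδ.le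
          have hτ1 : (τ : ℝ) * δ ≤ δ := by nlinarith [τ.2.2]
          refine hc _ y (by linarith) hy1 ?_
          rw [abs_le]; constructor <;> linarith)
        (fun τ y hy => hd _ _ y hy) η' hη'0
      simp only [Set.Icc.coe_zero, zero_mul, add_zero, Set.Icc.coe_one, one_mul] at hM1 hM2
      have hF0 : ∀ y, h y ≤ t₁ → IsUnit (ev y (F t₀)) := by
        intro y hy
        rcases le_total (h y) t₀ with hy' | hy'
        · exact hb y hy'
        · exact hc t₀ y le_rfl hy' (by rw [abs_le]; constructor <;> linarith)
      -- the compact set of relevant parameters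
      set K : Set (ℝ × Y) := {p | t₁ ≤ p.1 ∧ t₁ ≤ h p.2 ∧ |p.1 - h p.2| ≤ δ} with hK
      have hKc : IsCompact K := by
        have hsub : K ⊆ Icc t₁ (L + δ) ×ˢ (univ : Set Y) := by
          rintro ⟨t, y⟩ ⟨h1, h2, h3⟩
          refine ⟨⟨h1, ?_⟩, mem_univ _⟩
          have := (abs_le.1 h3).2
          have := hLr y
          simp only at *; linarith
        refine (isCompact_Icc.prod isCompact_univ).of_isClosed_subset ?_ hsub
        have c1 : IsClosed {p : ℝ × Y | t₁ ≤ p.1} := isClosed_le continuous_const continuous_fst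
        have c2 : IsClosed {p : ℝ × Y | t₁ ≤ h p.2} :=
          isClosed_le continuous_const (hh.comp continuous_snd)
        have c3 : IsClosed {p : ℝ × Y | |p.1 - h p.2| ≤ δ} :=
          isClosed_le (by fun_prop) continuous_const
        exact c1.inter (c2.inter c3)
      obtain ⟨C, hC0, hC⟩ := arens_inverse_bdd (fun p : ℝ × Y => ev p.2 (F p.1))
        (arens_ev_continuous ev hev hevc F hF) K hKc
        (fun p hp => hc p.1 p.2 (by linarith [hp.1]) (by linarith [hp.2.1]) hp.2.2)
      set B : ℝ := ‖(↑v⁻¹ : 𝔸)‖ * (‖(1 : 𝕄)‖ + C * ‖F t₁‖) * ‖(v : 𝔸)‖ with hB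
      have hB0 : 0 ≤ B := by positivity
      obtain ⟨c, hcβ⟩ := hM3 (1 / (4 * (B + 1))) (by positivity)
      refine ⟨fun t => M + (F t - F t₁) * v * c, by fun_prop, ?_, ?_, ?_, ?_⟩
      · intro y hy
        simp only [sub_self, zero_mul, add_zero]
        obtain ⟨k, hk, hk1⟩ := hM1 y hy
        rw [hk]
        exact (hF0 y hy).mul (arens_isUnit_of_near_one k (by linarith))
      · intro t y hty hy hyt
        have hmem : ((t, y) : ℝ × Y) ∈ K := ⟨hty, hy, hyt⟩
        have hFu : IsUnit (ev y (F t)) := hc t y (by linarith) (by linarith) hyt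
        have hCy : ‖Ring.inverse (ev y (F t))‖ ≤ C := hC _ hmem
        obtain ⟨hMy, hβ⟩ := hM2 y (by linarith)
        set W : 𝕄 := ev y (↑v⁻¹ : 𝔸) * (1 - Ring.inverse (ev y (F t)) * ev y (F t₁)) * ev y (v : 𝔸)
          with hW
        have hWn : ‖W‖ ≤ B := by
          refine (norm_mul_le _ _).trans ?_
          refine mul_le_mul ((norm_mul_le _ _).trans ?_) (hev _ _) (norm_nonneg _) (by positivity)
          refine mul_le_mul (hev _ _) ?_ (norm_nonneg _) (norm_nonneg _)
          refine (norm_sub_le _ _).trans ?_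
          gcongr
          refine (norm_mul_le _ _).trans ?_
          exact mul_le_mul hCy (hev _ _) (norm_nonneg _) hC0
        have hvv : ev y (v : 𝔸) * ev y (↑v⁻¹ : 𝔸) = 1 := by
          rw [← map_mul, Units.mul_inv, map_one]
        have hFF : ev y (F t) * Ring.inverse (ev y (F t)) = 1 := Ring.mul_inverse_cancel _ hFu
        have e : ev y (M + (F t - F t₁) * v * c) =
            ev y (F t) * ev y (v : 𝔸) * (β y + W * (ev y c - β y)) := by
          have e1 : ev y (F t) * ev y (v : 𝔸) * W = (ev y (F t) - ev y (F t₁)) * ev y (v : 𝔸) := by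
            rw [hW]
            calc _ = ev y (F t) * (ev y (v : 𝔸) * ev y (↑v⁻¹ : 𝔸)) *
                  (1 - Ring.inverse (ev y (F t)) * ev y (F t₁)) * ev y (v : 𝔸) := by
                  noncomm_ring
              _ = (ev y (F t) - (ev y (F t) * Ring.inverse (ev y (F t))) * ev y (F t₁)) *
                  ev y (v : 𝔸) := by rw [hvv]; noncomm_ring
              _ = _ := by rw [hFF, one_mul]
          rw [mul_add, ← mul_assoc, e1, map_add, map_mul, map_mul, map_sub, hMy]
          noncomm_ring
        rw [e]
        refine (hFu.mul (v.isUnit.map (ev y))).mul (arens_isUnit_of_near_one _ ?_)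
        have h1 : ‖W * (ev y c - β y)‖ ≤ 1 / 4 := by
          refine (norm_mul_le _ _).trans ?_
          refine (mul_le_mul hWn (hcβ y (by linarith)) (norm_nonneg _) hB0).trans ?_
          rw [mul_one_div, div_le_div_iff₀ (by positivity) (by norm_num)]
          linarith
        have h2 : β y + W * (ev y c - β y) - 1 = (β y - 1) + W * (ev y c - β y) := by abel
        rw [h2]
        refine (norm_add_le _ _).trans_lt ?_
        linarith
      · intro t t' y hy
        simp only [map_add, map_mul, map_sub, hd t t₁ y hy, hd t' t₁ y hy]
      · intro y hy
        simp only [sub_self, zero_mul, add_zero]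
        have hk : ∃ k, ev y M = ev y (F t₀) * k ∧ ‖k - 1‖ ≤ η' := by
          rcases le_total (h y) t₁ with hy' | hy'
          · exact hM1 y hy'
          · obtain ⟨h1, h2⟩ := hM2 y (by linarith)
            refine ⟨β y, ?_, h2⟩
            rw [h1, hvZ y hy, mul_one, hd t₁ t₀ y hy]
        obtain ⟨k, hk, hk1⟩ := hk
        have e : ev y M - ev y (G 0) = ev y (F t₀) * (k - 1) + (ev y (F t₀) - ev y (G 0)) := by
          rw [hk]; noncomm_ring
        rw [e]
        refine (norm_add_le _ _).trans ?_
        have h1 : ‖ev y (F t₀) * (k - 1)‖ ≤ ‖F t₀‖ * η' :=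
          (norm_mul_le _ _).trans (mul_le_mul (hev _ _) hk1 (norm_nonneg _) (norm_nonneg _))
        linarith [he y hy]
  obtain ⟨j, hj⟩ := exists_nat_ge ((2 * L + 1) / δ)
  rw [div_le_iff₀ hδ] at hj
  obtain ⟨F, _, hb, _, _, he⟩ := main j η hη
  exact ⟨F (-L - 1 + j * δ), fun y => hb y (by linarith [hLr y]), he⟩

end RE

end PartP4

section PartP4b

section REc

open Filter Topology Set

attribute [local instance] Matrix.linftyOpNormedRing Matrix.linftyOpNormedAlgebra

lemma arens_RE {D : Type*} [NormedCommRing D] [NormedAlgebra ℂ D] [CompleteSpace D]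
    {Y : Type*} [TopologicalSpace Y] [CompactSpace Y] {ev : Y → D →ₐ[ℂ] ℂ}
    (hfull : ArensFull D ev) (hevc : ∀ f, Continuous fun y => ev y f) {n : ℕ}
    (a : D) (Z : Set Y) (G : ℝ → Matrix (Fin n) (Fin n) D) (hG : Continuous G)
    (hGZ : ∀ t, ∀ y ∈ Z, (ev y).mapMatrix (G t) = (ev y).mapMatrix (G 0))
    (hGu : ∀ y, IsUnit ((ev y).mapMatrix (G (ev y a).re))) (η : ℝ) (hη : 0 < η) :
    ∃ M : Matrix (Fin n) (Fin n) D, (∀ y, IsUnit ((ev y).mapMatrix M)) ∧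
      ∀ y ∈ Z, ∀ i j, ‖ev y (M i j) - ev y (G 0 i j)‖ ≤ η := by
  let _ : NormedAlgebra ℚ D := NormedAlgebra.restrictScalars ℚ ℂ D
  have _ := arens_matrix_complete ℂ n
  obtain ⟨w, hw⟩ := NormedSpace.isUnit_exp a
  have hwn : ∀ y, ‖ev y (w : D)‖ = Real.exp (ev y a).re := by
    intro y
    have hc : Continuous (ev y) :=
      AddMonoidHomClass.continuous_of_bound (ev y) 1 (fun f => by rw [one_mul]; exact hfull.le y f)
    rw [hw, NormedSpace.map_exp (ev y) hc a, ← Complex.exp_eq_exp_ℂ, Complex.norm_exp]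
  obtain ⟨M, hM1, hM2⟩ := arens_RE_abs
    (𝔸 := Matrix (Fin n) (Fin n) D) (𝕄 := Matrix (Fin n) (Fin n) ℂ) (fun y => (ev y).mapMatrix)
    (fun y => arens_map_norm_le (ev y) (hfull.le y))
    (fun f => continuous_matrix fun i j => hevc (f i j))
    (fun y => (ev y a).re) (Complex.continuous_re.comp (hevc a)) Z
    (by
      intro s₁ s₂ hs γ hγ hu hZ η hη
      obtain ⟨M, v, β, h1, h2, h3, h4⟩ := arens_core hfull w (Real.exp s₁) (Real.exp s₂)
        (Real.exp_pos _) (Real.exp_le_exp.2 hs) Z γ hγ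
        (fun τ y h1 h2 => by
          rw [hwn, Real.exp_le_exp] at h1 h2
          have := (Matrix.isUnit_iff_isUnit_det _).1 (hu τ y h1 h2)
          exact this.ne_zero) hZ η hη
      simp only [hwn, Real.exp_le_exp] at h2 h3 h4
      exact ⟨M, v, β, h1, h2, h3, h4⟩)
    G hG hGZ hGu η hη
  refine ⟨M, hM1, fun y hy i j => ?_⟩
  have := (arens_entry_le ((ev y).mapMatrix M - (ev y).mapMatrix (G 0)) i j).trans (hM2 y hy)
  exact this

end REc

end PartP4b

section PartP5

/-! ### Function algebras all of whose characters are evaluations -/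

section FullAlg

open Filter Topology Set

lemma arens_ch_add {R : Type*} [CommRing R] [Algebra ℂ R] (χ : R →ₐ[ℂ] ℂ) (x y : R) :
    χ (x + y) = χ x + χ y := map_add χ x y

lemma arens_ch_sub {R : Type*} [CommRing R] [Algebra ℂ R] (χ : R →ₐ[ℂ] ℂ) (x y : R) :
    χ (x - y) = χ x - χ y := map_sub χ x y

lemma arens_ch_mul {R : Type*} [CommRing R] [Algebra ℂ R] (χ : R →ₐ[ℂ] ℂ) (x y : R) :
    χ (x * y) = χ x * χ y := map_mul χ x y

lemma arens_ch_smul {R : Type*} [CommRing R] [Algebra ℂ R] (χ : R →ₐ[ℂ] ℂ) (z : ℂ) (x : R) :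
    χ (z • x) = z * χ x := map_smul χ z x

lemma arens_ch_map {R : Type*} [CommRing R] [Algebra ℂ R] (χ : R →ₐ[ℂ] ℂ) (z : ℂ) :
    χ (algebraMap ℂ R z) = z := χ.commutes z

variable {X : Type*} [TopologicalSpace X] [CompactSpace X]

/-- Evaluation at a point, on a subalgebra of `C(X)`. -/
noncomputable def arensEv (B : Subalgebra ℂ C(X, ℂ)) (x : X) : B →ₐ[ℂ] ℂ :=
  (ContinuousMap.evalAlgHom ℂ ℂ x).comp B.val

/-- Closed subalgebras of `C(X)` all of whose characters are evaluations. -/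
def ArensAlg (B : Subalgebra ℂ C(X, ℂ)) : Prop :=
  IsClosed (B : Set C(X, ℂ)) ∧ ∀ χ : B →ₐ[ℂ] ℂ, ∃ x, ∀ f : B, χ f = (f : C(X, ℂ)) x

lemma ArensAlg.full {B : Subalgebra ℂ C(X, ℂ)} (hB : ArensAlg B) : ArensFull B (arensEv B) where
  le := fun x f => ContinuousMap.norm_coe_le_norm (f : C(X, ℂ)) x
  of_le := fun f c hc h => (ContinuousMap.norm_le (f : C(X, ℂ)) hc).2 h
  full := hB.2

lemma ArensAlg.complete {B : Subalgebra ℂ C(X, ℂ)} (hB : ArensAlg B) : CompleteSpace B :=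
  hB.1.isComplete.completeSpace_coe

lemma arens_char_le {B : Subalgebra ℂ C(X, ℂ)} (hB : IsClosed (B : Set C(X, ℂ)))
    (χ : B →ₐ[ℂ] ℂ) (f : B) : ‖χ f‖ ≤ ‖(f : C(X, ℂ))‖ := by
  have _ : CompleteSpace B := hB.isComplete.completeSpace_coe
  have h1 := AlgHom.norm_apply_le_self_mul_norm_one χ f
  have h2 : ‖(1 : B)‖ ≤ 1 :=
    (ContinuousMap.norm_le (1 : C(X, ℂ)) zero_le_one).2 (fun x => by simp)
  have h3 : ‖f‖ = ‖(f : C(X, ℂ))‖ := rfl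
  rw [← h3]
  nlinarith [norm_nonneg f]

lemma arens_char_real {B : Subalgebra ℂ C(X, ℂ)} (hB : IsClosed (B : Set C(X, ℂ)))
    (χ : B →ₐ[ℂ] ℂ) (k : B) (hk : ∀ x, ((k : C(X, ℂ)) x).im = 0) : (χ k).im = 0 := by
  have key : ∀ l : ℝ, (χ k).im ^ 2 + 2 * (χ k).im * l ≤ ‖(k : C(X, ℂ))‖ ^ 2 := by
    intro l
    set z : ℂ := Complex.I * l with hz
    have h1 := arens_char_le hB χ (k + algebraMap ℂ B z)
    have h2 : ‖((k + algebraMap ℂ B z : B) : C(X, ℂ))‖ ≤ Real.sqrt (‖(k : C(X, ℂ))‖ ^ 2 + l ^ 2) := by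
      refine (ContinuousMap.norm_le _ (Real.sqrt_nonneg _)).2 fun x => ?_
      refine Real.le_sqrt_of_sq_le ?_
      have e : ((k + algebraMap ℂ B z : B) : C(X, ℂ)) x = (k : C(X, ℂ)) x + z := rfl
      rw [e, ← Complex.normSq_eq_norm_sq, Complex.normSq_apply]
      have h3 := ContinuousMap.norm_coe_le_norm (k : C(X, ℂ)) x
      have h4 : ‖(k : C(X, ℂ)) x‖ ^ 2 = ((k : C(X, ℂ)) x).re * ((k : C(X, ℂ)) x).re := by
        rw [← Complex.normSq_eq_norm_sq, Complex.normSq_apply, hk x]; ring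
      have h5 : ‖(k : C(X, ℂ)) x‖ ^ 2 ≤ ‖(k : C(X, ℂ))‖ ^ 2 := by gcongr
      simp only [hz, Complex.add_re, Complex.add_im, hk x, Complex.mul_re, Complex.mul_im,
        Complex.I_re, Complex.I_im, Complex.ofReal_re, Complex.ofReal_im]
      nlinarith
    have h3 : ‖χ k + z‖ ^ 2 ≤ ‖(k : C(X, ℂ))‖ ^ 2 + l ^ 2 := by
      have h4 := h1.trans h2
      rw [arens_ch_add, arens_ch_map] at h4
      have h6 := pow_le_pow_left₀ (norm_nonneg _) h4 2
      rwa [Real.sq_sqrt (by positivity)] at h6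
    rw [← Complex.normSq_eq_norm_sq, Complex.normSq_apply] at h3
    simp only [hz, Complex.add_re, Complex.add_im, Complex.mul_re, Complex.mul_im,
        Complex.I_re, Complex.I_im, Complex.ofReal_re, Complex.ofReal_im] at h3
    nlinarith [sq_nonneg (χ k).re]
  by_contra hne
  have h1 := key (‖(k : C(X, ℂ))‖ ^ 2 / (χ k).im)
  have h2 : 2 * (χ k).im * (‖(k : C(X, ℂ))‖ ^ 2 / (χ k).im) = 2 * ‖(k : C(X, ℂ))‖ ^ 2 := by
    field_simp
  rw [h2] at h1
  have h3 : 0 < (χ k).im ^ 2 := by positivity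
  nlinarith [sq_nonneg ‖(k : C(X, ℂ))‖]

/-- The real part of a complex function. -/
noncomputable def arensRe (a : C(X, ℂ)) : C(X, ℂ) :=
  ⟨fun x => ((a x).re : ℂ), by fun_prop⟩

/-- Adjoining the real part of a function to a closed subalgebra. -/
noncomputable def arensAdj (B : Subalgebra ℂ C(X, ℂ)) (a : C(X, ℂ)) : Subalgebra ℂ C(X, ℂ) :=
  (Algebra.adjoin ℂ ((B : Set C(X, ℂ)) ∪ {arensRe a})).topologicalClosure

lemma arensAdj_le (B : Subalgebra ℂ C(X, ℂ)) (a : C(X, ℂ)) : B ≤ arensAdj B a := fun _ hf =>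
  Subalgebra.le_topologicalClosure _ (Algebra.subset_adjoin (Or.inl hf))

lemma arensAdj_re (B : Subalgebra ℂ C(X, ℂ)) (a : C(X, ℂ)) : arensRe a ∈ arensAdj B a :=
  Subalgebra.le_topologicalClosure _ (Algebra.subset_adjoin (Or.inr rfl))

lemma arensAdj_alg {B : Subalgebra ℂ C(X, ℂ)} (hB : ArensAlg B) {a : C(X, ℂ)} (ha : a ∈ B) :
    ArensAlg (arensAdj B a) := by
  have hcl : IsClosed (arensAdj B a : Set C(X, ℂ)) := Subalgebra.isClosed_topologicalClosure _
  refine ⟨hcl, fun χ => ?_⟩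
  obtain ⟨x, hx⟩ := hB.2 (χ.comp (Subalgebra.inclusion (arensAdj_le B a)))
  refine ⟨x, ?_⟩
  have hxB : ∀ (f : C(X, ℂ)) (hf : f ∈ B), χ ⟨f, arensAdj_le B a hf⟩ = f x := fun f hf => hx ⟨f, hf⟩
  set r : arensAdj B a := ⟨arensRe a, arensAdj_re B a⟩ with hr
  set A : arensAdj B a := ⟨a, arensAdj_le B a ha⟩ with hA
  have h1 : (χ r).im = 0 := arens_char_real hcl χ r (fun y => by simp [hr, arensRe])
  have h2 : (χ ((-Complex.I) • (A - r))).im = 0 := by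
    refine arens_char_real hcl χ _ (fun y => ?_)
    have : (((-Complex.I) • (A - r) : arensAdj B a) : C(X, ℂ)) y
        = -Complex.I * (a y - ((a y).re : ℂ)) := rfl
    rw [this]; simp
  have h3 : χ A = a x := hxB a ha
  rw [arens_ch_smul, arens_ch_sub, h3] at h2
  have hrx : χ r = arensRe a x := by
    simp only [Complex.mul_im, Complex.neg_re, Complex.neg_im, Complex.I_re,
      Complex.I_im, Complex.sub_re, Complex.sub_im, h1] at h2
    apply Complex.ext
    · simp [arensRe]; linarith
    · simp [arensRe, h1]
  -- agreement on the generated algebra, and then on the closure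
  have hadj : ∀ (f : C(X, ℂ)) (hf : f ∈ Algebra.adjoin ℂ ((B : Set C(X, ℂ)) ∪ {arensRe a})),
      χ ⟨f, Subalgebra.le_topologicalClosure _ hf⟩ = f x := by
    intro f hf
    induction hf using Algebra.adjoin_induction with
    | mem g hg =>
      rcases hg with hg | hg
      · exact hxB g hg
      · have : g = arensRe a := hg
        subst this
        exact hrx
    | algebraMap z => exact χ.commutes z
    | add g g' hg hg' h h' =>
      have := arens_ch_add χ ⟨g, Subalgebra.le_topologicalClosure _ hg⟩
        ⟨g', Subalgebra.le_topologicalClosure _ hg'⟩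
      rw [h, h'] at this
      exact this
    | mul g g' hg hg' h h' =>
      have := arens_ch_mul χ ⟨g, Subalgebra.le_topologicalClosure _ hg⟩
        ⟨g', Subalgebra.le_topologicalClosure _ hg'⟩
      rw [h, h'] at this
      exact this
  rintro ⟨f, hf⟩
  have hf' : f ∈ closure ((Algebra.adjoin ℂ ((B : Set C(X, ℂ)) ∪ {arensRe a}) :
      Subalgebra ℂ C(X, ℂ)) : Set C(X, ℂ)) := hf
  rw [← sub_eq_zero, ← norm_le_zero_iff]
  refine le_of_forall_pos_le_add fun ε hε => ?_
  obtain ⟨g, hg, hfg⟩ := Metric.mem_closure_iff.1 hf' (ε / 2) (by linarith)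
  rw [dist_eq_norm] at hfg
  have e1 := arens_char_le hcl χ (⟨f, hf⟩ - ⟨g, Subalgebra.le_topologicalClosure _ hg⟩)
  have e1' : ‖χ (⟨f, hf⟩ - ⟨g, Subalgebra.le_topologicalClosure _ hg⟩)‖ ≤ ‖f - g‖ := e1
  rw [arens_ch_sub, hadj g hg] at e1'
  have e2 := ContinuousMap.norm_coe_le_norm (f - g) x
  have e3 : χ ⟨f, hf⟩ - f x = (χ ⟨f, hf⟩ - g x) - (f - g) x := by
    rw [ContinuousMap.sub_apply]; ring
  show ‖χ ⟨f, hf⟩ - f x‖ ≤ _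
  rw [e3]
  refine (norm_sub_le _ _).trans ?_
  linarith

/-- Restriction of a function on `X × [0,1]` to a slice. -/
noncomputable def arensSlice (s : unitInterval) : C(X × unitInterval, ℂ) →ₐ[ℂ] C(X, ℂ) :=
  ContinuousMap.compRightAlgHom ℂ ℂ ⟨fun x => (x, s), by fun_prop⟩

lemma arensSlice_apply (s : unitInterval) (f : C(X × unitInterval, ℂ)) (x : X) :
    arensSlice s f x = f (x, s) := rfl

/-- Paths in the second algebra ending in the first. -/
noncomputable def arensPath (B B' : Subalgebra ℂ C(X, ℂ)) : Subalgebra ℂ C(X × unitInterval, ℂ) :=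
  (⨅ s, B'.comap (arensSlice s)) ⊓ B.comap (arensSlice 1)

lemma mem_arensPath {B B' : Subalgebra ℂ C(X, ℂ)} {f : C(X × unitInterval, ℂ)} :
    f ∈ arensPath B B' ↔ (∀ s, arensSlice s f ∈ B') ∧ arensSlice 1 f ∈ B := by
  simp [arensPath, Algebra.mem_inf, Algebra.mem_iInf]

lemma arensSlice_continuous (s : unitInterval) :
    Continuous (arensSlice (X := X) s) := by
  refine AddMonoidHomClass.continuous_of_bound (arensSlice (X := X) s) 1 fun f => ?_
  rw [one_mul]
  exact (ContinuousMap.norm_le _ (norm_nonneg _)).2 fun x => ContinuousMap.norm_coe_le_norm f (x, s)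

/-- The product of a function on `X` and a function on the interval. -/
noncomputable def arensTensor (b : C(X, ℂ)) (ψ : C(unitInterval, ℂ)) : C(X × unitInterval, ℂ) :=
  ⟨fun p => b p.1 * ψ p.2, by fun_prop⟩

lemma arensSlice_tensor (s : unitInterval) (b : C(X, ℂ)) (ψ : C(unitInterval, ℂ)) :
    arensSlice s (arensTensor b ψ) = ψ s • b := by
  ext x
  show b x * ψ s = ψ s * b x
  ring

lemma arensPath_alg {B B' : Subalgebra ℂ C(X, ℂ)} (hB : ArensAlg B) (hB' : ArensAlg B')
    (hBB : B ≤ B') : ArensAlg (arensPath B B') := by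
  have hcl : IsClosed (arensPath B B' : Set C(X × unitInterval, ℂ)) := by
    have : (arensPath B B' : Set C(X × unitInterval, ℂ)) =
        (⋂ s, arensSlice s ⁻¹' (B' : Set C(X, ℂ))) ∩ arensSlice 1 ⁻¹' (B : Set C(X, ℂ)) := by
      ext f
      simp only [SetLike.mem_coe, mem_arensPath, mem_inter_iff, mem_iInter, mem_preimage]
    rw [this]
    exact (isClosed_iInter fun s => hB'.1.preimage (arensSlice_continuous s)).inter
      (hB.1.preimage (arensSlice_continuous 1))
  refine ⟨hcl, ?_⟩
  set D := arensPath B B' with hD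
  intro χ
  have hconst : ∀ ψ : C(unitInterval, ℂ), arensTensor (1 : C(X, ℂ)) ψ ∈ D := by
    intro ψ
    refine mem_arensPath.2 ⟨fun s => ?_, ?_⟩ <;> rw [arensSlice_tensor]
    · exact B'.smul_mem B'.one_mem _
    · exact B.smul_mem B.one_mem _
  -- the character of `C([0,1])`
  let c : C(unitInterval, ℂ) →ₐ[ℂ] D :=
    { toFun := fun ψ => ⟨arensTensor 1 ψ, hconst ψ⟩
      map_one' := by ext p; simp [arensTensor]
      map_mul' := fun ψ φ => by ext p; simp [arensTensor]
      map_zero' := by ext p; simp [arensTensor]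
      map_add' := fun ψ φ => by ext p; simp [arensTensor]
      commutes' := fun z => by ext p; simp [arensTensor] }
  obtain ⟨s₀, hs₀⟩ : ∃ s₀ : unitInterval, ∀ ψ, χ (c ψ) = ψ s₀ := by
    obtain ⟨s₀, hs⟩ := (WeakDual.CharacterSpace.continuousMapEval_bijective unitInterval ℂ).2
      (WeakDual.CharacterSpace.equivAlgHom.symm (χ.comp c))
    refine ⟨s₀, fun ψ => ?_⟩
    have := congrArg (fun φ => φ ψ) hs
    exact this.symm
  have hvan : ∀ f : D, arensSlice s₀ (f : C(X × unitInterval, ℂ)) = 0 → χ f = 0 := by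
    intro f hf
    rw [← norm_le_zero_iff]
    refine le_of_forall_pos_le_add fun ε hε => ?_
    rw [zero_add]
    let F : C(unitInterval, C(X, ℂ)) :=
      ContinuousMap.curry ⟨fun p : unitInterval × X => (f : C(X × unitInterval, ℂ)) (p.2, p.1),
        by fun_prop⟩
    let φ : C(unitInterval, ℂ) := ⟨fun s => ((1 - min 1 (‖F s‖ / ε) : ℝ) : ℂ), by fun_prop⟩
    have hF0 : F s₀ = 0 := hf
    have hφ0 : φ s₀ = 1 := by
      show ((1 - min 1 (‖F s₀‖ / ε) : ℝ) : ℂ) = 1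
      rw [hF0]; simp
    have e : χ f = χ (f * c φ) := by rw [map_mul, hs₀, hφ0, mul_one]
    rw [e]
    refine (arens_char_le hcl χ _).trans ?_
    refine (ContinuousMap.norm_le _ hε.le).2 ?_
    rintro ⟨x, s⟩
    have e2 : ((f * c φ : D) : C(X × unitInterval, ℂ)) (x, s) =
      (f : C(X × unitInterval, ℂ)) (x, s) * (1 * φ s) := rfl
    rw [e2, one_mul, norm_mul]
    have h1 : ‖(f : C(X × unitInterval, ℂ)) (x, s)‖ ≤ ‖F s‖ :=
      ContinuousMap.norm_coe_le_norm (F s) x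
    have h2 : ‖φ s‖ = 1 - min 1 (‖F s‖ / ε) := by
      show ‖((1 - min 1 (‖F s‖ / ε) : ℝ) : ℂ)‖ = _
      rw [Complex.norm_real, Real.norm_of_nonneg]
      linarith [min_le_left 1 (‖F s‖ / ε)]
    rw [h2]
    have h3 : 0 ≤ ‖F s‖ := norm_nonneg _
    rcases le_total ‖F s‖ ε with h | h
    · have h4 : 0 ≤ min 1 (‖F s‖ / ε) := le_min zero_le_one (by positivity)
      have h5 : 0 ≤ 1 - min 1 (‖F s‖ / ε) := by linarith [min_le_left 1 (‖F s‖ / ε)]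
      nlinarith [norm_nonneg ((f : C(X × unitInterval, ℂ)) (x, s))]
    · have : min 1 (‖F s‖ / ε) = 1 := min_eq_left ((one_le_div hε).2 h)
      rw [this]; simp [hε.le]
  have hdep : ∀ f g : D, arensSlice s₀ (f : C(X × unitInterval, ℂ)) =
      arensSlice s₀ (g : C(X × unitInterval, ℂ)) → χ f = χ g := by
    intro f g hfg
    rw [← sub_eq_zero, ← map_sub]
    apply hvan
    rw [Subalgebra.coe_sub, map_sub, hfg, sub_self]
  -- reduction to a character on the slice
  have hfin : ∀ (B₀ : Subalgebra ℂ C(X, ℂ)) (ψ : C(unitInterval, ℂ)), ArensAlg B₀ → ψ s₀ = 1 →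
      (∀ b ∈ B₀, arensTensor b ψ ∈ D) →
      (∀ f : D, arensSlice s₀ (f : C(X × unitInterval, ℂ)) ∈ B₀) →
      ∃ p, ∀ f : D, χ f = (f : C(X × unitInterval, ℂ)) p := by
    intro B₀ ψ hB₀ hψ hmem hsl
    let l : B₀ →ₗ[ℂ] D :=
      { toFun := fun b => ⟨arensTensor (b : C(X, ℂ)) ψ, hmem b b.2⟩
        map_add' := fun b b' => by ext p; simp [arensTensor, add_mul]
        map_smul' := fun z b => by ext p; simp [arensTensor, mul_assoc] }
    have hl : ∀ b : B₀, arensSlice s₀ ((l b : D) : C(X × unitInterval, ℂ)) = b := by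
      intro b
      show arensSlice s₀ (arensTensor (b : C(X, ℂ)) ψ) = b
      rw [arensSlice_tensor, hψ, one_smul]
    let θ : B₀ →ₐ[ℂ] ℂ := AlgHom.ofLinearMap (χ.toLinearMap.comp l)
      (by
        show χ (l 1) = 1
        rw [← map_one χ]
        apply hdep
        rw [hl, OneMemClass.coe_one, OneMemClass.coe_one, map_one])
      (by
        intro b b'
        show χ (l (b * b')) = χ (l b) * χ (l b')
        rw [← map_mul]
        apply hdep
        rw [hl, MulMemClass.coe_mul, MulMemClass.coe_mul, map_mul, hl, hl])
    obtain ⟨x, hx⟩ := hB₀.2 θ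
    refine ⟨(x, s₀), fun f => ?_⟩
    have h1 := hx ⟨_, hsl f⟩
    have h2 : χ f = χ (l ⟨_, hsl f⟩) := hdep _ _ (by rw [hl])
    rw [h2]
    exact h1
  by_cases h : s₀ = 1
  · refine hfin B 1 hB (by simp) (fun b hb => ?_) (fun f => ?_)
    · refine mem_arensPath.2 ⟨fun s => ?_, ?_⟩ <;> rw [arensSlice_tensor]
      · exact B'.smul_mem (hBB hb) _
      · exact B.smul_mem hb _
    · rw [h]; exact (mem_arensPath.1 f.2).2
  · have hne : (1 : ℝ) - s₀ ≠ 0 := by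
      intro h'
      exact h (Subtype.ext (by rw [Set.Icc.coe_one]; linarith))
    have hne' : (1 : ℂ) - ((s₀ : ℝ) : ℂ) ≠ 0 := by
      intro h'; apply hne; exact_mod_cast h'
    refine hfin B' ⟨fun s => (1 - ((s : ℝ) : ℂ)) / (1 - ((s₀ : ℝ) : ℂ)), by fun_prop⟩ hB' ?_
      (fun b hb => ?_) (fun f => ?_)
    · exact div_self hne'
    · refine mem_arensPath.2 ⟨fun s => ?_, ?_⟩ <;> rw [arensSlice_tensor]
      · exact B'.smul_mem hb _
      · have : ((⟨fun s => (1 - ((s : ℝ) : ℂ)) / (1 - ((s₀ : ℝ) : ℂ)), by fun_prop⟩ :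
            C(unitInterval, ℂ)) 1) = 0 := by
          simp
        rw [this, zero_smul]
        exact B.zero_mem
    · exact (mem_arensPath.1 f.2).1 s₀

end FullAlg

end PartP5

section PartP6a

/-! ### Chains of segments, and invertible matrices over function algebras -/

section Chains

open Filter Topology Set

/-- Discretising a path in an open set along a dense subset. -/
lemma arens_chain {E : Type*} [NormedAddCommGroup E] [NormedSpace ℝ E] {U S : Set E}
    (hU : IsOpen U) {x y : E} (hx : x ∈ S) (hy : y ∈ S) (h : JoinedIn (U ∩ closure S) x y) :
    Relation.ReflTransGen (fun p q => p ∈ S ∧ q ∈ S ∧ segment ℝ p q ⊆ U) x y := by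
  obtain ⟨γ, hγ⟩ := h
  have hK : IsCompact (range γ) := isCompact_range γ.continuous
  obtain ⟨δ, hδ, hsub⟩ := hK.exists_thickening_subset_open hU
    (by rintro _ ⟨t, rfl⟩; exact (hγ t).1)
  have hball : ∀ t, Metric.ball (γ t) δ ⊆ U := fun t =>
    (Metric.ball_subset_thickening (mem_range_self t) δ).trans hsub
  have hseg : ∀ t p q, p ∈ Metric.ball (γ t) δ → q ∈ Metric.ball (γ t) δ → segment ℝ p q ⊆ U :=
    fun t p q hp hq => ((convex_ball _ _).segment_subset hp hq).trans (hball t)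
  set R : E → E → Prop := fun p q => p ∈ S ∧ q ∈ S ∧ segment ℝ p q ⊆ U with hR
  let T : Set unitInterval := {t | ∃ p ∈ S, γ t ∈ Metric.ball p δ ∧ Relation.ReflTransGen R x p}
  have hTo : IsOpen T := by
    have : T = ⋃ p ∈ {p | p ∈ S ∧ Relation.ReflTransGen R x p}, γ ⁻¹' Metric.ball p δ := by
      ext t
      simp only [T, mem_setOf_eq, mem_iUnion, mem_preimage, exists_prop]
      constructor
      · rintro ⟨p, h1, h2, h3⟩; exact ⟨p, ⟨h1, h3⟩, h2⟩
      · rintro ⟨p, ⟨h1, h3⟩, h2⟩; exact ⟨p, h1, h2, h3⟩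
    rw [this]
    exact isOpen_biUnion fun p _ => Metric.isOpen_ball.preimage γ.continuous
  have hTc : IsClosed T := by
    refine isClosed_of_closure_subset fun t ht => ?_
    obtain ⟨q, hq, hqt⟩ := Metric.mem_closure_iff.1 (hγ t).2 δ hδ
    have hn : γ ⁻¹' Metric.ball q δ ∈ 𝓝 t :=
      (Metric.isOpen_ball.preimage γ.continuous).mem_nhds hqt
    obtain ⟨t', ht', p, hp, hpt, hxp⟩ := mem_closure_iff_nhds.1 ht _ hn
    refine ⟨q, hq, hqt, hxp.tail ⟨hp, hq, hseg t' p q ?_ ?_⟩⟩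
    · rw [Metric.mem_ball_comm]; exact hpt
    · rw [Metric.mem_ball_comm]; exact ht'
  have h0 : (0 : unitInterval) ∈ T := by
    refine ⟨x, hx, ?_, Relation.ReflTransGen.refl⟩
    rw [γ.source]; exact Metric.mem_ball_self hδ
  have hT : T = univ := IsClopen.eq_univ ⟨hTc, hTo⟩ ⟨0, h0⟩
  obtain ⟨p, hp, hpt, hxp⟩ : (1 : unitInterval) ∈ T := hT ▸ mem_univ _
  refine hxp.tail ⟨hp, hy, hseg 1 p y ?_ ?_⟩
  · rw [Metric.mem_ball_comm]; exact hpt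
  · rw [γ.target]; exact Metric.mem_ball_self hδ

/-- Points close to a point of an open set in a normed space of matrices. -/
lemma arens_near {F : Type*} [NormedAddCommGroup F] [NormedSpace ℝ F] {n : ℕ}
    {U : Set (Fin n → Fin n → F)} (hU : IsOpen U) {N : Fin n → Fin n → F} (hN : N ∈ U) :
    ∃ η > 0, ∀ N' : Fin n → Fin n → F, (∀ i j, ‖N' i j - N i j‖ ≤ η) → segment ℝ N N' ⊆ U := by
  obtain ⟨ε, hε, h⟩ := Metric.isOpen_iff.1 hU N hN
  refine ⟨ε / 2, by linarith, fun N' hN' => ?_⟩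
  refine ((convex_ball N ε).segment_subset (Metric.mem_ball_self hε) ?_).trans h
  rw [Metric.mem_ball]
  refine lt_of_le_of_lt ?_ (half_lt_self hε)
  refine (dist_pi_le_iff (by linarith)).2 fun i => (dist_pi_le_iff (by linarith)).2 fun j => ?_
  rw [dist_eq_norm]; exact hN' i j

variable {X : Type*} [TopologicalSpace X] [CompactSpace X] {n : ℕ}

/-- Evaluation of a matrix of functions. -/
noncomputable def arensAt {Y : Type*} [TopologicalSpace Y] (y : Y)
    (M : Matrix (Fin n) (Fin n) C(Y, ℂ)) : Matrix (Fin n) (Fin n) ℂ :=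
  (ContinuousMap.evalAlgHom ℂ ℂ y : C(Y, ℂ) →ₐ[ℂ] ℂ).mapMatrix M

lemma arens_isUnit_iff {Y : Type*} [TopologicalSpace Y] (M : Matrix (Fin n) (Fin n) C(Y, ℂ)) :
    IsUnit M ↔ ∀ y, IsUnit (arensAt y M) := by
  constructor
  · intro h y
    exact h.map (ContinuousMap.evalAlgHom ℂ ℂ y : C(Y, ℂ) →ₐ[ℂ] ℂ).mapMatrix
  · intro h
    rw [Matrix.isUnit_iff_isUnit_det, ContinuousMap.isUnit_iff_forall_ne_zero]
    intro y
    have h1 := (Matrix.isUnit_iff_isUnit_det _).1 (h y)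
    have h2 : (arensAt y M).det = M.det y :=
      (AlgHom.map_det (ContinuousMap.evalAlgHom ℂ ℂ y : C(Y, ℂ) →ₐ[ℂ] ℂ) M).symm
    rw [h2] at h1
    exact h1.ne_zero

lemma arens_isOpen_units {R : Type*} [NormedCommRing R] [CompleteSpace R] :
    IsOpen {M : Matrix (Fin n) (Fin n) R | IsUnit M} := by
  have : {M : Matrix (Fin n) (Fin n) R | IsUnit M} =
      (fun M => M.det) ⁻¹' {d : R | IsUnit d} := by
    ext M; exact Matrix.isUnit_iff_isUnit_det M
  rw [this]
  exact Units.isOpen.preimage (continuous_id.matrix_det)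

/-- Invertible matrices over `C(X)` with entries in a subalgebra. -/
def ArensGL (n : ℕ) (B : Subalgebra ℂ C(X, ℂ)) : Set (Matrix (Fin n) (Fin n) C(X, ℂ)) :=
  {M | (∀ i j, M i j ∈ B) ∧ IsUnit M}

lemma ArensGL.mono {B B' : Subalgebra ℂ C(X, ℂ)} (h : B ≤ B') : ArensGL n B ⊆ ArensGL n B' :=
  fun _ hM => ⟨fun i j => h (hM.1 i j), hM.2⟩

lemma arens_real_smul {Y : Type*} [TopologicalSpace Y] (B : Subalgebra ℂ C(Y, ℂ)) (r : ℝ)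
    {f : C(Y, ℂ)} (hf : f ∈ B) : r • f ∈ B := by
  have : r • f = (r : ℂ) • f := by ext x; simp
  rw [this]
  exact B.smul_mem hf _

lemma arens_segment_mem {Y : Type*} [TopologicalSpace Y] {B : Subalgebra ℂ C(Y, ℂ)}
    {M N P : Matrix (Fin n) (Fin n) C(Y, ℂ)} (hM : ∀ i j, M i j ∈ B) (hN : ∀ i j, N i j ∈ B)
    (hP : P ∈ segment ℝ M N) (i j : Fin n) : P i j ∈ B := by
  obtain ⟨r, s, -, -, -, rfl⟩ := hP
  exact B.add_mem (arens_real_smul B r (hM i j)) (arens_real_smul B s (hN i j))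

lemma ArensGL.joined_of_segment {B : Subalgebra ℂ C(X, ℂ)}
    {M N : Matrix (Fin n) (Fin n) C(X, ℂ)} (hM : ∀ i j, M i j ∈ B) (hN : ∀ i j, N i j ∈ B)
    (h : segment ℝ M N ⊆ {P | IsUnit P}) : JoinedIn (ArensGL n B) M N :=
  JoinedIn.of_segment_subset fun P hP => ⟨arens_segment_mem hM hN hP, h hP⟩

lemma arens_unit_near {R : Type*} [NormedCommRing R] [NormedAlgebra ℝ R] [CompleteSpace R]
    {N : Matrix (Fin n) (Fin n) R} (hN : IsUnit N) :
    ∃ η > 0, ∀ N' : Matrix (Fin n) (Fin n) R, (∀ i j, ‖N' i j - N i j‖ ≤ η) →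
      segment ℝ N N' ⊆ {P | IsUnit P} :=
  arens_near (F := R) (U := {M : Matrix (Fin n) (Fin n) R | IsUnit M}) arens_isOpen_units hN

lemma arens_chain_matrix {R : Type*} [NormedCommRing R] [NormedAlgebra ℝ R] [CompleteSpace R]
    {S : Set (Matrix (Fin n) (Fin n) R)} {x y : Matrix (Fin n) (Fin n) R}
    (hx : x ∈ S) (hy : y ∈ S) (h : JoinedIn ({M | IsUnit M} ∩ closure S) x y) :
    Relation.ReflTransGen (fun p q => p ∈ S ∧ q ∈ S ∧ segment ℝ p q ⊆ {M | IsUnit M}) x y :=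
  arens_chain (E := Fin n → Fin n → R) (U := {M : Matrix (Fin n) (Fin n) R | IsUnit M})
    arens_isOpen_units hx hy h

lemma arens_mem_closure {R : Type*} [NormedCommRing R] {T : Set R}
    {M : Matrix (Fin n) (Fin n) R} (h : ∀ i j, M i j ∈ closure T) :
    M ∈ closure {N : Matrix (Fin n) (Fin n) R | ∀ i j, N i j ∈ T} := by
  have h2 : (M : Fin n → Fin n → R) ∈ closure (Set.pi univ fun _ => Set.pi univ fun _ => T) := by
    rw [closure_pi_set]
    intro i _
    rw [closure_pi_set]
    intro j _
    exact h i j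
  refine closure_mono ?_ h2
  intro N hN i j
  exact hN i (mem_univ _) j (mem_univ _)

lemma arensSlice_continuous_left (f : C(X × unitInterval, ℂ)) :
    Continuous fun s => arensSlice s f :=
  (ContinuousMap.curry ⟨fun p : unitInterval × X => f (p.2, p.1), by fun_prop⟩).continuous

end Chains

end PartP6a

section PartP6b

/-! ### The two steps: adjoining a real part -/

section Steps

open Filter Topology Set

variable {X : Type*} [TopologicalSpace X] [CompactSpace X] [T2Space X] {n : ℕ}

lemma arens_core_step {B B' : Subalgebra ℂ C(X, ℂ)} (hB : ArensAlg B) (hB' : ArensAlg B')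
    (hBB : B ≤ B') {a : C(X, ℂ)} (ha : a ∈ B) (Z : Set unitInterval)
    (Φ : Matrix (Fin n) (Fin n) C(ℝ × (X × unitInterval), ℂ))
    (hΦ : ∀ t i j, (Φ i j).curry t ∈ arensPath B B')
    (hΦZ : ∀ t x, ∀ s ∈ Z, ∀ i j, Φ i j (t, (x, s)) = Φ i j (0, (x, s)))
    (hΦu : ∀ x s, IsUnit (arensAt ((a x).re, (x, s)) Φ)) (η : ℝ) (hη : 0 < η) :
    ∃ M : Matrix (Fin n) (Fin n) C(X × unitInterval, ℂ), (∀ i j, M i j ∈ arensPath B B') ∧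
      (∀ s, IsUnit (M.map (arensSlice s))) ∧
      ∀ s ∈ Z, ∀ i j, ‖arensSlice s (M i j) - arensSlice s ((Φ i j).curry 0)‖ ≤ η := by
  have hP := arensPath_alg hB hB' hBB
  have _ := hP.complete
  let α : arensPath B B' := ⟨arensTensor a 1, by
    refine mem_arensPath.2 ⟨fun s => ?_, ?_⟩ <;> rw [arensSlice_tensor]
    · exact B'.smul_mem (hBB ha) _
    · exact B.smul_mem ha _⟩
  have hα : ∀ x s, arensEv (arensPath B B') (x, s) α = a x := fun x s => by
    show a x * 1 = a x
    rw [mul_one]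
  let G : ℝ → Matrix (Fin n) (Fin n) (arensPath B B') := fun t => Matrix.of fun i j =>
    ⟨(Φ i j).curry t, hΦ t i j⟩
  have hG : Continuous G := by
    refine continuous_matrix fun i j => ?_
    exact ((Φ i j).curry.continuous).subtype_mk _
  have hev : ∀ t p, (arensEv (arensPath B B') p).mapMatrix (G t) = arensAt (t, p) Φ :=
    fun t p => rfl
  obtain ⟨M, hM1, hM2⟩ := arens_RE hP.full
    (fun f => (f : C(X × unitInterval, ℂ)).continuous) α {p | p.2 ∈ Z} G hG
    (by
      rintro t ⟨x, s⟩ hs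
      ext i j
      exact hΦZ t x s hs i j)
    (by
      rintro ⟨x, s⟩
      rw [hev, hα]
      exact hΦu x s) η hη
  refine ⟨M.map Subtype.val, fun i j => (M i j).2, fun s => ?_, fun s hs i j => ?_⟩
  · rw [arens_isUnit_iff]
    intro x
    exact hM1 (x, s)
  · refine (ContinuousMap.norm_le _ hη.le).2 fun x => ?_
    exact hM2 (x, s) hs i j

lemma arens_joined_slices {B B' : Subalgebra ℂ C(X, ℂ)}
    {M : Matrix (Fin n) (Fin n) C(X × unitInterval, ℂ)} (h1 : ∀ i j, M i j ∈ arensPath B B')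
    (h2 : ∀ s, IsUnit (M.map (arensSlice s))) :
    JoinedIn (ArensGL n B') (M.map (arensSlice 0)) (M.map (arensSlice 1)) :=
  ⟨⟨⟨fun s => M.map (arensSlice s), continuous_matrix fun i j => arensSlice_continuous_left (M i j)⟩,
    rfl, rfl⟩, fun s => ⟨fun i j => (mem_arensPath.1 (h1 i j)).1 s, h2 s⟩⟩

/-- Substitution along the graph of `(1-s) Re a + s t`. -/
noncomputable def arensSub (a : C(X, ℂ)) (s : unitInterval) (t : ℝ) :
    C(ℝ × X, ℂ) →ₐ[ℂ] C(X, ℂ) :=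
  ContinuousMap.compRightAlgHom ℂ ℂ
    ⟨fun x => ((1 - (s : ℝ)) * (a x).re + s * t, x), by fun_prop⟩

lemma arensSub_apply (a : C(X, ℂ)) (s : unitInterval) (t : ℝ) (P : C(ℝ × X, ℂ)) (x : X) :
    arensSub a s t P x = P ((1 - (s : ℝ)) * (a x).re + s * t, x) := rfl

lemma arensSub_zero (a : C(X, ℂ)) (t : ℝ) (P : C(ℝ × X, ℂ)) (x : X) :
    arensSub a 0 t P x = P ((a x).re, x) := by
  rw [arensSub_apply]; simp

lemma arensSub_one (a : C(X, ℂ)) (t : ℝ) (P : C(ℝ × X, ℂ)) (x : X) :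
    arensSub a 1 t P x = P (t, x) := by
  rw [arensSub_apply]; simp

/-- The algebra of admissible polynomial-like functions on `ℝ × X`. -/
noncomputable def arensW (B B' : Subalgebra ℂ C(X, ℂ)) (a : C(X, ℂ)) : Subalgebra ℂ C(ℝ × X, ℂ) :=
  (⨅ s, ⨅ t, B'.comap (arensSub a s t)) ⊓ ⨅ t, B.comap (arensSub a 1 t)

lemma mem_arensW {B B' : Subalgebra ℂ C(X, ℂ)} {a : C(X, ℂ)} {P : C(ℝ × X, ℂ)} :
    P ∈ arensW B B' a ↔ (∀ s t, arensSub a s t P ∈ B') ∧ ∀ t, arensSub a 1 t P ∈ B := by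
  simp [arensW, Algebra.mem_inf, Algebra.mem_iInf]

/-- Pull back to `ℝ × X`. -/
noncomputable def arensPull (f : C(X, ℂ)) : C(ℝ × X, ℂ) := f.comp ⟨Prod.snd, continuous_snd⟩

lemma arensSub_pull (a : C(X, ℂ)) (s : unitInterval) (t : ℝ) (f : C(X, ℂ)) :
    arensSub a s t (arensPull f) = f := rfl

lemma arensPull_mem {B B' : Subalgebra ℂ C(X, ℂ)} (hBB : B ≤ B') {a f : C(X, ℂ)} (hf : f ∈ B) :
    arensPull f ∈ arensW B B' a :=
  mem_arensW.2 ⟨fun _ _ => hBB hf, fun _ => hf⟩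

lemma arensW_range (B : Subalgebra ℂ C(X, ℂ)) (a : C(X, ℂ)) {f : C(X, ℂ)}
    (hf : f ∈ Algebra.adjoin ℂ ((B : Set C(X, ℂ)) ∪ {arensRe a})) :
    ∃ P ∈ arensW B (arensAdj B a) a, arensSub a 0 0 P = f := by
  have : Algebra.adjoin ℂ ((B : Set C(X, ℂ)) ∪ {arensRe a}) ≤
      (arensW B (arensAdj B a) a).map (arensSub a 0 0) := by
    refine Algebra.adjoin_le ?_
    rintro g (hg | hg)
    · exact ⟨arensPull g, arensPull_mem (arensAdj_le B a) hg, rfl⟩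
    · rw [mem_singleton_iff] at hg
      subst hg
      refine ⟨⟨fun p => (p.1 : ℂ), by fun_prop⟩, mem_arensW.2 ⟨fun s t => ?_, fun t => ?_⟩, ?_⟩
      · have : arensSub a s t ⟨fun p => (p.1 : ℂ), by fun_prop⟩ =
            ((1 - (s : ℝ) : ℝ) : ℂ) • arensRe a + algebraMap ℂ C(X, ℂ) ((s * t : ℝ) : ℂ) := by
          ext x
          rw [arensSub_apply]
          simp [arensRe]
        rw [this]
        exact add_mem (Subalgebra.smul_mem _ (arensAdj_re B a) _) (Subalgebra.algebraMap_mem _ _)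
      · have : arensSub a 1 t ⟨fun p => (p.1 : ℂ), by fun_prop⟩ =
            algebraMap ℂ C(X, ℂ) (t : ℂ) := by
          ext x
          rw [arensSub_one]
          simp
        rw [this]
        exact Subalgebra.algebraMap_mem _ _
      · ext x
        show arensSub a 0 0 _ x = _
        rw [arensSub_zero]; rfl
  obtain ⟨P, hP, h⟩ := this hf
  exact ⟨P, hP, h⟩

/-- Matrices over `arensAdj B a` which come from admissible functions. -/
def ArensLift (n : ℕ) (B : Subalgebra ℂ C(X, ℂ)) (a : C(X, ℂ)) :
    Set (Matrix (Fin n) (Fin n) C(X, ℂ)) :=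
  {N | ∃ P : Matrix (Fin n) (Fin n) C(ℝ × X, ℂ), (∀ i j, P i j ∈ arensW B (arensAdj B a) a) ∧
    P.map (arensSub a 0 0) = N}

lemma arensLift_dense (B : Subalgebra ℂ C(X, ℂ)) (a : C(X, ℂ))
    {N : Matrix (Fin n) (Fin n) C(X, ℂ)} (hN : ∀ i j, N i j ∈ arensAdj B a) :
    N ∈ closure (ArensLift n B a) := by
  have hN' : ∀ i j, N i j ∈ closure ((Algebra.adjoin ℂ
      ((B : Set C(X, ℂ)) ∪ {arensRe a}) : Subalgebra ℂ C(X, ℂ)) : Set C(X, ℂ)) := hN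
  refine closure_mono ?_ (arens_mem_closure hN')
  intro M hM
  choose P hP1 hP2 using fun i j => arensW_range B a (hM i j)
  exact ⟨Matrix.of P, hP1, by ext1 i j; exact hP2 i j⟩

lemma arensLift_mem {B : Subalgebra ℂ C(X, ℂ)} {a : C(X, ℂ)}
    {N : Matrix (Fin n) (Fin n) C(X, ℂ)} (hN : N ∈ ArensLift n B a) (i j : Fin n) :
    N i j ∈ arensAdj B a := by
  obtain ⟨P, hP, rfl⟩ := hN
  exact (mem_arensW.1 (hP i j)).1 0 0

lemma arens_surj_step {B : Subalgebra ℂ C(X, ℂ)} (hB : ArensAlg B) {a : C(X, ℂ)} (ha : a ∈ B)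
    {N : Matrix (Fin n) (Fin n) C(X, ℂ)} (hN : N ∈ ArensGL n (arensAdj B a)) :
    ∃ M ∈ ArensGL n B, JoinedIn (ArensGL n (arensAdj B a)) N M := by
  have hBB := arensAdj_le B a
  obtain ⟨η, hη, hnear⟩ := arens_unit_near (R := C(X, ℂ)) hN.2
  -- approximate by a liftable matrix
  obtain ⟨N₀, hN₀, hseg₀⟩ : ∃ N₀ ∈ ArensLift n B a, segment ℝ N N₀ ⊆ {P | IsUnit P} := by
    have h1 := arensLift_dense B a hN.1
    have hopen : IsOpen {N' : Matrix (Fin n) (Fin n) C(X, ℂ) | ∀ i j, ‖N' i j - N i j‖ < η} := by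
      simp only [ofPred_forall]
      refine isOpen_iInter_of_finite fun i => isOpen_iInter_of_finite fun j => ?_
      refine isOpen_lt ?_ continuous_const
      exact ((continuous_id.matrix_elem i j).sub continuous_const).norm
    obtain ⟨N₀, h2, h3⟩ := mem_closure_iff.1 h1 _ hopen (by intro i j; simpa using hη)
    exact ⟨N₀, h3, hnear N₀ fun i j => (h2 i j).le⟩
  have hN₀m := arensLift_mem hN₀
  have hN₀u : IsUnit N₀ := hseg₀ (right_mem_segment ℝ N N₀)
  have hj0 := ArensGL.joined_of_segment hN.1 hN₀m hseg₀
  obtain ⟨P, hP, hPN⟩ := hN₀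
  obtain ⟨η', hη', hnear'⟩ := arens_unit_near (R := C(X, ℂ)) hN₀u
  let Φ : Matrix (Fin n) (Fin n) C(ℝ × (X × unitInterval), ℂ) := P.map fun f =>
    f.comp ⟨fun q : ℝ × (X × unitInterval) =>
      ((1 - (q.2.2 : ℝ)) * (a q.2.1).re + q.2.2 * q.1, q.2.1), by fun_prop⟩
  obtain ⟨M, hM1, hM2, hM3⟩ := arens_core_step hB (arensAdj_alg hB ha) hBB ha {0} Φ
    (by
      intro t i j
      refine mem_arensPath.2 ⟨fun s => (mem_arensW.1 (hP i j)).1 s t, (mem_arensW.1 (hP i j)).2 t⟩)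
    (by
      rintro t x s hs i j
      rw [mem_singleton_iff] at hs
      subst hs
      show P i j (_, x) = P i j (_, x)
      simp)
    (by
      intro x s
      have h1 := (arens_isUnit_iff N₀).1 hN₀u x
      convert h1 using 1
      ext i j
      rw [← hPN]
      show P i j ((1 - (s : ℝ)) * (a x).re + s * (a x).re, x) = arensSub a 0 0 (P i j) x
      rw [arensSub_zero]
      congr 2
      ring) η' hη'
  have hseg1 : segment ℝ N₀ (M.map (arensSlice 0)) ⊆ {P | IsUnit P} := by
    refine hnear' _ fun i j => ?_
    have h1 := hM3 0 rfl i j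
    have h2 : arensSlice 0 ((Φ i j).curry 0) = N₀ i j := by
      rw [← hPN]
      rfl
    rw [h2] at h1
    exact h1
  refine ⟨M.map (arensSlice 1), ⟨fun i j => (mem_arensPath.1 (hM1 i j)).2, hM2 1⟩, ?_⟩
  refine hj0.trans (JoinedIn.trans ?_ (arens_joined_slices hM1 hM2))
  exact ArensGL.joined_of_segment hN₀m (fun i j => (mem_arensPath.1 (hM1 i j)).1 0) hseg1

lemma arens_inj_step {B : Subalgebra ℂ C(X, ℂ)} (hB : ArensAlg B) {a : C(X, ℂ)} (ha : a ∈ B)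
    {M M' : Matrix (Fin n) (Fin n) C(X, ℂ)} (hM : M ∈ ArensGL n B) (hM' : M' ∈ ArensGL n B)
    (hj : JoinedIn (ArensGL n (arensAdj B a)) M M') : JoinedIn (ArensGL n B) M M' := by
  have hBB := arensAdj_le B a
  let UW : Set (Matrix (Fin n) (Fin n) C(ℝ × X, ℂ)) :=
    {P | (∀ i j, P i j ∈ arensW B (arensAdj B a) a) ∧ IsUnit (P.map (arensSub a 0 0))}
  have hlift : ∀ {N : Matrix (Fin n) (Fin n) C(X, ℂ)}, N ∈ ArensGL n B →
      (∀ i j, N.map arensPull i j ∈ arensW B (arensAdj B a) a) ∧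
        (N.map arensPull).map (arensSub a 0 0) = N := fun {N} hN =>
    ⟨fun i j => arensPull_mem hBB (hN.1 i j), by ext1 i j; rfl⟩
  have hchain := arens_chain_matrix (R := C(X, ℂ)) (S := ArensLift n B a)
    ⟨_, hlift hM⟩ ⟨_, hlift hM'⟩ (hj.mono fun N hN => ⟨hN.2, arensLift_dense B a hN.1⟩)
  have hsegW : ∀ P Q : Matrix (Fin n) (Fin n) C(ℝ × X, ℂ),
      (∀ i j, P i j ∈ arensW B (arensAdj B a) a) → (∀ i j, Q i j ∈ arensW B (arensAdj B a) a) →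
      segment ℝ (P.map (arensSub a 0 0)) (Q.map (arensSub a 0 0)) ⊆ {M | IsUnit M} →
      JoinedIn UW P Q := by
    intro P Q hP hQ h
    refine JoinedIn.of_segment_subset fun R hR => ⟨arens_segment_mem hP hQ hR, h ?_⟩
    obtain ⟨r, s, hr, hs, hrs, rfl⟩ := hR
    refine ⟨r, s, hr, hs, hrs, ?_⟩
    ext i j x
    rfl
  have hall : ∀ N, Relation.ReflTransGen (fun p q => p ∈ ArensLift n B a ∧ q ∈ ArensLift n B a ∧
      segment ℝ p q ⊆ {M | IsUnit M}) M N →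
      ∀ P : Matrix (Fin n) (Fin n) C(ℝ × X, ℂ), (∀ i j, P i j ∈ arensW B (arensAdj B a) a) →
        P.map (arensSub a 0 0) = N → JoinedIn UW (M.map arensPull) P := by
    intro N hN
    induction hN with
    | refl =>
      intro P hP hPM
      refine hsegW _ _ (hlift hM).1 hP ?_
      rw [(hlift hM).2, hPM, segment_same]
      rintro _ rfl
      exact hM.2
    | tail h1 h2 ih =>
      intro P hP hPM
      obtain ⟨⟨P', hP', hPN'⟩, -, hseg⟩ := h2
      refine (ih P' hP' hPN').trans (hsegW _ _ hP' hP ?_)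
      rw [hPN', hPM]
      exact hseg
  obtain ⟨γ, hγ⟩ := hall M' hchain (M'.map arensPull) (hlift hM').1 (hlift hM').2
  let Γ : Fin n → Fin n → C(unitInterval, C(ℝ × X, ℂ)) := fun i j =>
    ⟨fun s => γ s i j, γ.continuous.matrix_elem i j⟩
  let Φ : Matrix (Fin n) (Fin n) C(ℝ × (X × unitInterval), ℂ) := Matrix.of fun i j =>
    ⟨fun q => Γ i j q.2.2 (q.1, q.2.1), by
      have := ContinuousMap.continuous_uncurry_of_continuous (Γ i j)
      exact this.comp (f := fun q : ℝ × (X × unitInterval) => (q.2.2, (q.1, q.2.1))) (by fun_prop)⟩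
  have hΦ : ∀ i j t x s, Φ i j (t, (x, s)) = γ s i j (t, x) := fun i j t x s => rfl
  obtain ⟨η, hη, hnear⟩ := arens_unit_near (R := C(X, ℂ)) hM.2
  obtain ⟨η', hη', hnear'⟩ := arens_unit_near (R := C(X, ℂ)) hM'.2
  obtain ⟨Q, hQ1, hQ2, hQ3⟩ := arens_core_step hB hB le_rfl ha {0, 1} Φ
    (by
      intro t i j
      have : ∀ s, arensSlice s ((Φ i j).curry t) ∈ B := fun s => by
        have h1 := (mem_arensW.1 ((hγ s).1 i j)).2 t
        convert h1 using 1
        ext x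
        rw [arensSub_one]
        rfl
      exact mem_arensPath.2 ⟨this, this 1⟩)
    (by
      rintro t x s hs i j
      rw [hΦ, hΦ]
      rcases hs with rfl | hs
      · rw [γ.source]; rfl
      · rw [mem_singleton_iff] at hs
        subst hs
        rw [γ.target]; rfl)
    (by
      intro x s
      have h1 := (arens_isUnit_iff _).1 (hγ s).2 x
      convert h1 using 1
      ext i j
      show γ s i j ((a x).re, x) = arensSub a 0 0 (γ s i j) x
      rw [arensSub_zero]) (min η η') (lt_min hη hη')
  have hmem : ∀ s i j, arensSlice s (Q i j) ∈ B := fun s i j => (mem_arensPath.1 (hQ1 i j)).1 s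
  have hs0 : segment ℝ M (Q.map (arensSlice 0)) ⊆ {P | IsUnit P} := by
    refine hnear _ fun i j => ?_
    have h1 := hQ3 0 (by simp) i j
    have h2 : arensSlice 0 ((Φ i j).curry 0) = M i j := by
      ext x
      show γ 0 i j (0, x) = M i j x
      rw [γ.source]; rfl
    rw [h2] at h1
    exact h1.trans (min_le_left _ _)
  have hs1 : segment ℝ M' (Q.map (arensSlice 1)) ⊆ {P | IsUnit P} := by
    refine hnear' _ fun i j => ?_
    have h1 := hQ3 1 (by simp) i j
    have h2 : arensSlice 1 ((Φ i j).curry 0) = M' i j := by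
      ext x
      show γ 1 i j (0, x) = M' i j x
      rw [γ.target]; rfl
    rw [h2] at h1
    exact h1.trans (min_le_right _ _)
  refine (ArensGL.joined_of_segment hM.1 (hmem 0) hs0).trans
    ((arens_joined_slices hQ1 hQ2).trans ?_)
  exact (ArensGL.joined_of_segment hM'.1 (hmem 1) hs1).symm

end Steps

end PartP6b

section Final

open Filter Topology Set WeakDual

section Lists

variable {X : Type*} [TopologicalSpace X] [CompactSpace X] [T2Space X] {n : ℕ}

/-- Successively adjoining real parts. -/
noncomputable def arensList (B : Subalgebra ℂ C(X, ℂ)) : List C(X, ℂ) → Subalgebra ℂ C(X, ℂ)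
  | [] => B
  | a :: l => arensAdj (arensList B l) a

lemma arensList_ge (B : Subalgebra ℂ C(X, ℂ)) : ∀ l, B ≤ arensList B l
  | [] => le_rfl
  | a :: l => (arensList_ge B l).trans (arensAdj_le _ a)

lemma arensList_alg {B : Subalgebra ℂ C(X, ℂ)} (hB : ArensAlg B) :
    ∀ l, (∀ a ∈ l, a ∈ B) → ArensAlg (arensList B l)
  | [], _ => hB
  | a :: l, h => arensAdj_alg (arensList_alg hB l fun b hb => h b (List.mem_cons_of_mem _ hb))
      (arensList_ge B l (h a List.mem_cons_self))

lemma arensList_re (B : Subalgebra ℂ C(X, ℂ)) : ∀ l, ∀ a ∈ l, arensRe a ∈ arensList B l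
  | b :: l, a, h => by
    rcases List.mem_cons.1 h with rfl | h
    · exact arensAdj_re _ _
    · exact arensAdj_le _ _ (arensList_re B l a h)

lemma arensList_le {B C : Subalgebra ℂ C(X, ℂ)} (hC : IsClosed (C : Set C(X, ℂ))) (hBC : B ≤ C) :
    ∀ l, (∀ a ∈ l, arensRe a ∈ C) → arensList B l ≤ C
  | [], _ => hBC
  | a :: l, h => by
    refine Subalgebra.topologicalClosure_minimal (Algebra.adjoin_le ?_) hC
    rintro g (hg | hg)
    · exact arensList_le hC hBC l (fun b hb => h b (List.mem_cons_of_mem _ hb)) hg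
    · rw [mem_singleton_iff] at hg
      rw [hg]
      exact h a List.mem_cons_self

lemma arensList_mono {B : Subalgebra ℂ C(X, ℂ)} (hB : ArensAlg B) {l l' : List C(X, ℂ)}
    (hl' : ∀ a ∈ l', a ∈ B) (h : l ⊆ l') : arensList B l ≤ arensList B l' :=
  arensList_le (arensList_alg hB l' hl').1 (arensList_ge B l') l
    fun a ha => arensList_re B l' a (h ha)

lemma arensList_surj {B : Subalgebra ℂ C(X, ℂ)} (hB : ArensAlg B) :
    ∀ l, (∀ a ∈ l, a ∈ B) → ∀ N ∈ ArensGL n (arensList B l),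
      ∃ M ∈ ArensGL n B, JoinedIn (ArensGL n (arensList B l)) N M
  | [], _, N, hN => ⟨N, hN, JoinedIn.refl hN⟩
  | a :: l, h, N, hN => by
    have h' : ∀ b ∈ l, b ∈ B := fun b hb => h b (List.mem_cons_of_mem _ hb)
    obtain ⟨N', hN', hj⟩ := arens_surj_step (arensList_alg hB l h')
      (arensList_ge B l (h a List.mem_cons_self)) hN
    obtain ⟨M, hM, hj'⟩ := arensList_surj hB l h' N' hN'
    exact ⟨M, hM, hj.trans (hj'.mono (ArensGL.mono (arensAdj_le _ a)))⟩

lemma arensList_inj {B : Subalgebra ℂ C(X, ℂ)} (hB : ArensAlg B)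
    {M M' : Matrix (Fin n) (Fin n) C(X, ℂ)} (hM : M ∈ ArensGL n B) (hM' : M' ∈ ArensGL n B) :
    ∀ l, (∀ a ∈ l, a ∈ B) → JoinedIn (ArensGL n (arensList B l)) M M' →
      JoinedIn (ArensGL n B) M M'
  | [], _, hj => hj
  | a :: l, h, hj => by
    have h' : ∀ b ∈ l, b ∈ B := fun b hb => h b (List.mem_cons_of_mem _ hb)
    refine arensList_inj hB hM hM' l h' ?_
    exact arens_inj_step (arensList_alg hB l h') (arensList_ge B l (h a List.mem_cons_self))
      (ArensGL.mono (arensList_ge B l) hM) (ArensGL.mono (arensList_ge B l) hM') (by exact hj)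

/-- The union of all the algebras obtained by adjoining finitely many real parts. -/
def arensUnion (B : Subalgebra ℂ C(X, ℂ)) : Set C(X, ℂ) :=
  {f | ∃ l : List C(X, ℂ), (∀ a ∈ l, a ∈ B) ∧ f ∈ arensList B l}

lemma arensUnion_dense {B : Subalgebra ℂ C(X, ℂ)} (hB : ArensAlg B)
    (hsep : ∀ x y : X, x ≠ y → ∃ f ∈ B, f x ≠ f y) (f : C(X, ℂ)) : f ∈ closure (arensUnion B) := by
  let S : Set C(X, ℂ) := arensRe '' (B : Set C(X, ℂ))
  let 𝒮 : StarSubalgebra ℂ C(X, ℂ) := StarAlgebra.adjoin ℂ S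
  have hstar : ∀ g ∈ S, star g = g := by
    rintro _ ⟨a, -, rfl⟩
    ext x
    simp [arensRe]
  have hsub : (𝒮 : Set C(X, ℂ)) ⊆ arensUnion B := by
    intro g hg
    have hg' : g ∈ Algebra.adjoin ℂ (S ∪ star S) := hg
    have hSS : S ∪ star S = S := by
      refine union_eq_left.2 fun g hg => ?_
      have h1 : star g ∈ S := hg
      have h2 := hstar _ h1
      rw [star_star] at h2
      rw [h2]; exact h1
    rw [hSS] at hg'
    clear hg
    induction hg' using Algebra.adjoin_induction with
    | mem g hg =>
      obtain ⟨a, ha, rfl⟩ := hg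
      exact ⟨[a], by simpa using ha, arensList_re B [a] a (by simp)⟩
    | algebraMap z => exact ⟨[], by simp, Subalgebra.algebraMap_mem _ z⟩
    | add g g' hg hg' h h' =>
      obtain ⟨l, h1, h2⟩ := h
      obtain ⟨l', h1', h2'⟩ := h'
      have h3 : ∀ a ∈ l ++ l', a ∈ B := fun a ha =>
        (List.mem_append.1 ha).elim (h1 a) (h1' a)
      exact ⟨l ++ l', h3, Subalgebra.add_mem _
        (arensList_mono hB h3 (List.subset_append_left _ _) h2)
        (arensList_mono hB h3 (List.subset_append_right _ _) h2')⟩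
    | mul g g' hg hg' h h' =>
      obtain ⟨l, h1, h2⟩ := h
      obtain ⟨l', h1', h2'⟩ := h'
      have h3 : ∀ a ∈ l ++ l', a ∈ B := fun a ha =>
        (List.mem_append.1 ha).elim (h1 a) (h1' a)
      exact ⟨l ++ l', h3, Subalgebra.mul_mem _
        (arensList_mono hB h3 (List.subset_append_left _ _) h2)
        (arensList_mono hB h3 (List.subset_append_right _ _) h2')⟩
  have hsp : 𝒮.SeparatesPoints := by
    intro x y hxy
    obtain ⟨g, hg, hne⟩ := hsep x y hxy
    by_cases h : (g x).re = (g y).re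
    · have him : (g x).im ≠ (g y).im := fun h' => hne (Complex.ext h h')
      refine ⟨arensRe (Complex.I • g), ⟨_, StarAlgebra.subset_adjoin ℂ S
        ⟨_, B.smul_mem hg _, rfl⟩, rfl⟩, ?_⟩
      simpa [arensRe] using him
    · refine ⟨arensRe g, ⟨_, StarAlgebra.subset_adjoin ℂ S ⟨_, hg, rfl⟩, rfl⟩, ?_⟩
      simpa [arensRe] using h
  have htop := ContinuousMap.starSubalgebra_topologicalClosure_eq_top_of_separatesPoints 𝒮 hsp
  have hf : f ∈ 𝒮.topologicalClosure := htop ▸ (by trivial)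
  exact closure_mono hsub hf

lemma arensUnion_common {B : Subalgebra ℂ C(X, ℂ)} (hB : ArensAlg B)
    {M : Matrix (Fin n) (Fin n) C(X, ℂ)} (h : ∀ i j, M i j ∈ arensUnion B) :
    ∃ l : List C(X, ℂ), (∀ a ∈ l, a ∈ B) ∧ ∀ i j, M i j ∈ arensList B l := by
  choose l h1 h2 using h
  have h3 : ∀ a ∈ (List.finRange n).flatMap fun i => (List.finRange n).flatMap (l i), a ∈ B := by
    intro a ha
    simp only [List.mem_flatMap, List.mem_finRange, true_and] at ha
    obtain ⟨i, j, h⟩ := ha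
    exact h1 i j a h
  refine ⟨_, h3, fun i j => arensList_mono hB h3 (fun a ha => ?_) (h2 i j)⟩
  simp only [List.mem_flatMap, List.mem_finRange, true_and]
  exact ⟨i, j, ha⟩

/-- A dense set of matrices meets a neighbourhood of an invertible matrix. -/
lemma arens_exists_near {R : Type*} [NormedCommRing R] [NormedAlgebra ℝ R] [CompleteSpace R]
    {N : Matrix (Fin n) (Fin n) R} (hN : IsUnit N) {S : Set (Matrix (Fin n) (Fin n) R)}
    (hS : N ∈ closure S) : ∃ N₀ ∈ S, segment ℝ N N₀ ⊆ {P | IsUnit P} := by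
  obtain ⟨η, hη, hnear⟩ := arens_unit_near hN
  have hopen : IsOpen {N' : Matrix (Fin n) (Fin n) R | ∀ i j, ‖N' i j - N i j‖ < η} := by
    simp only [ofPred_forall]
    refine isOpen_iInter_of_finite fun i => isOpen_iInter_of_finite fun j => ?_
    refine isOpen_lt ?_ continuous_const
    exact ((continuous_id.matrix_elem i j).sub continuous_const).norm
  obtain ⟨N₀, h2, h3⟩ := mem_closure_iff.1 hS _ hopen (by intro i j; simpa using hη)
  exact ⟨N₀, h3, hnear N₀ fun i j => (h2 i j).le⟩

lemma arens_top_surj {B : Subalgebra ℂ C(X, ℂ)} (hB : ArensAlg B)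
    (hsep : ∀ x y : X, x ≠ y → ∃ f ∈ B, f x ≠ f y)
    {N : Matrix (Fin n) (Fin n) C(X, ℂ)} (hN : IsUnit N) :
    ∃ M ∈ ArensGL n B, JoinedIn {P | IsUnit P} N M := by
  obtain ⟨N₀, hN₀, hseg⟩ := arens_exists_near (R := C(X, ℂ)) hN
    (arens_mem_closure fun i j => arensUnion_dense hB hsep (N i j))
  obtain ⟨l, hl, hm⟩ := arensUnion_common hB hN₀
  obtain ⟨M, hM, hj⟩ := arensList_surj hB l hl N₀ ⟨hm, hseg (right_mem_segment ℝ N N₀)⟩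
  exact ⟨M, hM, (JoinedIn.of_segment_subset hseg).trans (hj.mono fun P hP => hP.2)⟩

lemma arens_top_inj {B : Subalgebra ℂ C(X, ℂ)} (hB : ArensAlg B)
    (hsep : ∀ x y : X, x ≠ y → ∃ f ∈ B, f x ≠ f y)
    {M M' : Matrix (Fin n) (Fin n) C(X, ℂ)} (hM : M ∈ ArensGL n B) (hM' : M' ∈ ArensGL n B)
    (hj : JoinedIn {P | IsUnit P} M M') : JoinedIn (ArensGL n B) M M' := by
  have hBU : ∀ f ∈ B, f ∈ arensUnion B := fun f hf => ⟨[], by simp, hf⟩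
  have hchain := arens_chain_matrix (R := C(X, ℂ)) (S := {N | ∀ i j, N i j ∈ arensUnion B})
    (fun i j => hBU _ (hM.1 i j)) (fun i j => hBU _ (hM'.1 i j))
    (hj.mono fun N hN => ⟨hN, arens_mem_closure fun i j => arensUnion_dense hB hsep (N i j)⟩)
  obtain ⟨l, hl, hjl⟩ : ∃ l : List C(X, ℂ), (∀ a ∈ l, a ∈ B) ∧
      JoinedIn (ArensGL n (arensList B l)) M M' := by
    clear hj hM'
    induction hchain with
    | refl => exact ⟨[], by simp, JoinedIn.refl hM⟩
    | @tail p q h1 h2 ih =>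
      obtain ⟨l, hl, hjl⟩ := ih
      obtain ⟨hp, hq, hseg⟩ := h2
      obtain ⟨l₁, hl₁, hp⟩ := arensUnion_common hB hp
      obtain ⟨l₂, hl₂, hq⟩ := arensUnion_common hB hq
      have h3 : ∀ a ∈ l ++ (l₁ ++ l₂), a ∈ B := by
        intro a ha
        simp only [List.mem_append] at ha
        rcases ha with h | h | h
        exacts [hl a h, hl₁ a h, hl₂ a h]
      have e0 : l ⊆ l ++ (l₁ ++ l₂) := fun a ha => by simp [ha]
      have e1 : l₁ ⊆ l ++ (l₁ ++ l₂) := fun a ha => by simp [ha]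
      have e2 : l₂ ⊆ l ++ (l₁ ++ l₂) := fun a ha => by simp [ha]
      refine ⟨_, h3, (hjl.mono (ArensGL.mono (arensList_mono hB h3 e0))).trans ?_⟩
      exact ArensGL.joined_of_segment (fun i j => arensList_mono hB h3 e1 (hp i j))
        (fun i j => arensList_mono hB h3 e2 (hq i j)) hseg
  exact arensList_inj hB hM hM' l hl hjl

lemma arens_char_dense {B : Subalgebra ℂ C(X, ℂ)} (hcl : IsClosed (B : Set C(X, ℂ)))
    (χ : B →ₐ[ℂ] ℂ) (x : X) {T : Set C(X, ℂ)} (hBT : (B : Set C(X, ℂ)) ⊆ closure T)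
    (hT : ∀ g ∈ T, ∃ h : g ∈ B, χ ⟨g, h⟩ = g x) (f : B) : χ f = (f : C(X, ℂ)) x := by
  obtain ⟨f, hf⟩ := f
  rw [← sub_eq_zero, ← norm_le_zero_iff]
  refine le_of_forall_pos_le_add fun ε hε => ?_
  obtain ⟨g, hgT, hfg⟩ := Metric.mem_closure_iff.1 (hBT hf) (ε / 2) (by linarith)
  obtain ⟨hg, hgx⟩ := hT g hgT
  rw [dist_eq_norm] at hfg
  have e1 : ‖χ (⟨f, hf⟩ - ⟨g, hg⟩)‖ ≤ ‖f - g‖ := arens_char_le hcl χ (⟨f, hf⟩ - ⟨g, hg⟩)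
  rw [arens_ch_sub, hgx] at e1
  have e2 := ContinuousMap.norm_coe_le_norm (f - g) x
  have e3 : χ ⟨f, hf⟩ - f x = (χ ⟨f, hf⟩ - g x) - (f - g) x := by
    rw [ContinuousMap.sub_apply]; ring
  show ‖χ ⟨f, hf⟩ - f x‖ ≤ _
  rw [e3]
  refine (norm_sub_le _ _).trans ?_
  linarith

lemma arens_top_surj_dense {B : Subalgebra ℂ C(X, ℂ)} (hB : ArensAlg B)
    (hsep : ∀ x y : X, x ≠ y → ∃ f ∈ B, f x ≠ f y) {S : Set (Matrix (Fin n) (Fin n) C(X, ℂ))}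
    (hS : ∀ N : Matrix (Fin n) (Fin n) C(X, ℂ), (∀ i j, N i j ∈ B) → N ∈ closure S)
    {N : Matrix (Fin n) (Fin n) C(X, ℂ)} (hN : IsUnit N) :
    ∃ M ∈ S, IsUnit M ∧ JoinedIn {P | IsUnit P} M N := by
  obtain ⟨N', hN', hj⟩ := arens_top_surj hB hsep hN
  obtain ⟨N₀, hN₀, hseg⟩ := arens_exists_near (R := C(X, ℂ)) hN'.2 (hS N' hN'.1)
  exact ⟨N₀, hN₀, hseg (right_mem_segment ℝ N' N₀),
    (hj.trans (JoinedIn.of_segment_subset hseg)).symm⟩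

end Lists

variable {A : Type*} [NormedCommRing A] [NormedAlgebra ℂ A] [CompleteSpace A] {n : ℕ}

/-- The closure of the range of the Gelfand transform. -/
noncomputable def arensBase (A : Type*) [NormedCommRing A] [NormedAlgebra ℂ A] [CompleteSpace A] :
    Subalgebra ℂ C(characterSpace ℂ A, ℂ) :=
  (gelfandTransform ℂ A).range.topologicalClosure

lemma arensBase_mem (a : A) : gelfandTransform ℂ A a ∈ arensBase A :=
  Subalgebra.le_topologicalClosure _ ⟨a, rfl⟩

lemma arensBase_alg : ArensAlg (arensBase A) := by
  have hcl : IsClosed (arensBase A : Set C(characterSpace ℂ A, ℂ)) :=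
    Subalgebra.isClosed_topologicalClosure _
  refine ⟨hcl, fun χ => ?_⟩
  let g : A →ₐ[ℂ] arensBase A := (gelfandTransform ℂ A).codRestrict (arensBase A) arensBase_mem
  let x : characterSpace ℂ A := CharacterSpace.equivAlgHom.symm (χ.comp g)
  have hx : ∀ a : A, χ (g a) = gelfandTransform ℂ A a x := fun a => rfl
  refine ⟨x, ?_⟩
  refine arens_char_dense hcl χ x (T := ((gelfandTransform ℂ A).range :
    Set C(characterSpace ℂ A, ℂ))) (fun f hf => hf) ?_
  rintro _ ⟨a, rfl⟩
  exact ⟨arensBase_mem a, hx a⟩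

lemma arensBase_sep (x y : characterSpace ℂ A) (h : x ≠ y) : ∃ f ∈ arensBase A, f x ≠ f y := by
  by_contra! hc
  apply h
  ext a
  exact hc _ (arensBase_mem a)

lemma arens_gelfand_isUnit {M : Matrix (Fin n) (Fin n) A}
    (h : IsUnit (M.map (gelfandTransform ℂ A))) : IsUnit M := by
  rw [Matrix.isUnit_iff_isUnit_det]
  by_contra hd
  obtain ⟨f, hf⟩ := CharacterSpace.exists_apply_eq_zero hd
  have h1 := (Matrix.isUnit_iff_isUnit_det _).1 h
  have h2 : (M.map (gelfandTransform ℂ A)).det = gelfandTransform ℂ A M.det :=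
    (AlgHom.map_det (gelfandTransform ℂ A) M).symm
  rw [h2, ContinuousMap.isUnit_iff_forall_ne_zero] at h1
  exact h1 f hf

lemma arens_gelfand_dense {N : Matrix (Fin n) (Fin n) C(characterSpace ℂ A, ℂ)}
    (hN : ∀ i j, N i j ∈ arensBase A) :
    N ∈ closure (range fun M : Matrix (Fin n) (Fin n) A => M.map (gelfandTransform ℂ A)) := by
  have hN' : ∀ i j, N i j ∈ closure
      ((gelfandTransform ℂ A).range : Set C(characterSpace ℂ A, ℂ)) := hN
  refine closure_mono ?_ (arens_mem_closure hN')
  intro N hN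
  choose M hM using hN
  exact ⟨Matrix.of M, by ext1 i j; exact hM i j⟩

lemma arens_gelfand_segment {P Q : Matrix (Fin n) (Fin n) A}
    (h : segment ℝ (P.map (gelfandTransform ℂ A)) (Q.map (gelfandTransform ℂ A)) ⊆
      {M | IsUnit M}) : JoinedIn {M | IsUnit M} P Q := by
  refine JoinedIn.of_segment_subset fun R hR => arens_gelfand_isUnit (h ?_)
  obtain ⟨r, s, hr, hs, hrs, rfl⟩ := hR
  refine ⟨r, s, hr, hs, hrs, ?_⟩
  ext i j x
  show (r : ℝ) • x (P i j) + (s : ℝ) • x (Q i j) = x (r • P i j + s • Q i j)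
  rw [map_add, ← Complex.coe_smul r (P i j), ← Complex.coe_smul s (Q i j), map_smul, map_smul]
  simp

lemma arens_gelfand_inj {M M' : Matrix (Fin n) (Fin n) A} (hM : IsUnit M) (hM' : IsUnit M')
    (hj : JoinedIn {P | IsUnit P} (M.map (gelfandTransform ℂ A))
      (M'.map (gelfandTransform ℂ A))) : JoinedIn {P | IsUnit P} M M' := by
  have hmem : ∀ {M : Matrix (Fin n) (Fin n) A}, IsUnit M →
      M.map (gelfandTransform ℂ A) ∈ ArensGL n (arensBase A) := fun {M} hM =>
    ⟨fun i j => arensBase_mem _, hM.map (gelfandTransform ℂ A).mapMatrix⟩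
  have hj' := arens_top_inj arensBase_alg arensBase_sep (hmem hM) (hmem hM') hj
  have hchain := arens_chain_matrix (R := C(characterSpace ℂ A, ℂ))
    (S := range fun M : Matrix (Fin n) (Fin n) A => M.map (gelfandTransform ℂ A))
    ⟨M, rfl⟩ ⟨M', rfl⟩ (hj'.mono fun N hN => ⟨hN.2, arens_gelfand_dense hN.1⟩)
  have hall : ∀ N, Relation.ReflTransGen (fun p q =>
      p ∈ (range fun M : Matrix (Fin n) (Fin n) A => M.map (gelfandTransform ℂ A)) ∧
      q ∈ (range fun M : Matrix (Fin n) (Fin n) A => M.map (gelfandTransform ℂ A)) ∧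
      segment ℝ p q ⊆ {M | IsUnit M}) (M.map (gelfandTransform ℂ A)) N →
      ∀ P : Matrix (Fin n) (Fin n) A, P.map (gelfandTransform ℂ A) = N →
        JoinedIn {P | IsUnit P} M P := by
    intro N hN
    induction hN with
    | refl =>
      intro P hP
      refine arens_gelfand_segment ?_
      rw [hP, segment_same]
      rintro _ rfl
      exact (hmem hM).2
    | tail h1 h2 ih =>
      intro P hP
      obtain ⟨⟨P', hP'⟩, -, hseg⟩ := h2
      refine (ih P' hP').trans (arens_gelfand_segment ?_)
      have hP'' : P'.map (gelfandTransform ℂ A) = _ := hP'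
      rw [hP'', hP]
      exact hseg
  exact hall _ hchain M' rfl

lemma arens_gelfand_surj {N : Matrix (Fin n) (Fin n) C(characterSpace ℂ A, ℂ)} (hN : IsUnit N) :
    ∃ M : Matrix (Fin n) (Fin n) A, IsUnit M ∧
      JoinedIn {P | IsUnit P} (M.map (gelfandTransform ℂ A)) N := by
  obtain ⟨_, ⟨M, rfl⟩, hu, hj⟩ := arens_top_surj_dense (B := arensBase A) arensBase_alg
    arensBase_sep (fun N hN => arens_gelfand_dense hN) hN
  exact ⟨M, arens_gelfand_isUnit hu, hj⟩

lemma arens_joined_iff {R : Type*} [Ring R] [TopologicalSpace R] (M M' : GLn R n) :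
    Joined M M' ↔ JoinedIn {P | IsUnit P} M.1 M'.1 := by
  constructor
  · rintro ⟨γ⟩
    exact ⟨γ.map continuous_subtype_val, fun s => (γ s).2⟩
  · rintro ⟨γ, hγ⟩
    exact ⟨⟨⟨fun s => ⟨γ s, hγ s⟩, γ.continuous.subtype_mk _⟩, Subtype.ext γ.source,
      Subtype.ext γ.target⟩⟩

end Final

/-- (Arens) For a unital commutative complex Banach algebra `A` and every `n ≥ 1`, the
Gelfand transform `A → C(X_A)` induces a bijection
`π₀(GL_n(A)) → π₀(GL_n(C(X_A)))` of path components of invertible matrix groups. -/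
theorem arens_pi0_bijective_of_gelfand (A : Type*)
    [NormedCommRing A] [NormedAlgebra ℂ A] [CompleteSpace A] (n : ℕ) (hn : 1 ≤ n) :
    Function.Bijective
      (pi0Map (continuous_glMap (WeakDual.gelfandTransform ℂ A).toRingHom n
        (gelfandTransform_continuous A))) := by
  constructor
  · intro q q' h
    induction q using Quotient.inductionOn with | _ M => ?_
    induction q' using Quotient.inductionOn with | _ M' => ?_
    have h1 : Joined (glMap (WeakDual.gelfandTransform ℂ A).toRingHom n M)
      (glMap (WeakDual.gelfandTransform ℂ A).toRingHom n M') := Quotient.exact h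
    exact Quotient.sound ((arens_joined_iff M M').2
      (arens_gelfand_inj M.2 M'.2 ((arens_joined_iff _ _).1 h1)))
  · intro q
    induction q using Quotient.inductionOn with | _ N => ?_
    obtain ⟨M, hM, hj⟩ := arens_gelfand_surj N.2
    refine ⟨Quotient.mk _ ⟨M, hM⟩, Quotient.sound ?_⟩
    exact (arens_joined_iff _ _).2 hj
end

section
/- (Karoubi–Swan, invertible part) Let φ : A → B be a dense and spectral morphism of unital complex Banach algebras. Then for every n ≥ 1 the induced map π₀(GL_n(A)) → π₀(GL_n(B)) between the sets of path components of the invertible n×n matrix groups is a bijection. -/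
open Topology Filter

section KaroubiSwanAux

/-- Open subsets of locally convex spaces have small open convex neighbourhoods. -/
lemma ks_exists_open_convex {S : Type*} [AddCommGroup S] [Module ℝ S] [TopologicalSpace S]
    [IsTopologicalAddGroup S] [ContinuousSMul ℝ S] [LocallyConvexSpace ℝ S]
    {V : Set S} (hV : IsOpen V) {v : S} (hv : v ∈ V) :
    ∃ N : Set S, IsOpen N ∧ Convex ℝ N ∧ v ∈ N ∧ N ⊆ V := by
  obtain ⟨N, ⟨hN, hc⟩, hNV⟩ :=
    (LocallyConvexSpace.convex_basis (𝕜 := ℝ) v).mem_iff.1 (hV.mem_nhds hv)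
  exact ⟨interior N, isOpen_interior, hc.interior, mem_interior_iff_mem_nhds.2 hN,
    interior_subset.trans hNV⟩

/-- Points with images in a common convex subset of `V` are joined in the preimage of `V`. -/
lemma ks_joined {R S : Type*} [AddCommGroup R] [Module ℝ R] [TopologicalSpace R]
    [IsTopologicalAddGroup R] [ContinuousSMul ℝ R] [AddCommGroup S] [Module ℝ S]
    (f : R →ₗ[ℝ] S) {V N : Set S} (hc : Convex ℝ N) (hN : N ⊆ V) {x y : R}
    (hx : f x ∈ N) (hy : f y ∈ N) : JoinedIn (f ⁻¹' V) x y :=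
  JoinedIn.of_segment_subset
    (((hc.linear_preimage f).segment_subset hx hy).trans (Set.preimage_mono hN))

/-- Lifting of path components along a continuous dense linear map. -/
lemma ks_lift {R S : Type*} [AddCommGroup R] [Module ℝ R] [TopologicalSpace R]
    [IsTopologicalAddGroup R] [ContinuousSMul ℝ R] [AddCommGroup S] [Module ℝ S]
    [TopologicalSpace S] [IsTopologicalAddGroup S] [ContinuousSMul ℝ S] [LocallyConvexSpace ℝ S]
    (f : R →ₗ[ℝ] S) (hd : DenseRange f) {V : Set S} (hV : IsOpen V) {x₀ x₁ : R}
    (h : JoinedIn V (f x₀) (f x₁)) : JoinedIn (f ⁻¹' V) x₀ x₁ := by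
  obtain ⟨p, hp⟩ := h
  have h0 : f x₀ ∈ V := by simpa using hp 0
  have h1 : f x₁ ∈ V := by simpa using hp 1
  let E : Set S := {v | ∃ N : Set S, IsOpen N ∧ Convex ℝ N ∧ v ∈ N ∧ N ⊆ V ∧
    ∃ x, JoinedIn (f ⁻¹' V) x₀ x ∧ f x ∈ N}
  have hE : IsOpen E := by
    refine isOpen_iff_mem_nhds.2 ?_
    rintro v ⟨N, hN, hc, hv, hNV, hx⟩
    exact mem_of_superset (hN.mem_nhds hv) fun w hw => ⟨N, hN, hc, hw, hNV, hx⟩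
  have hE' : IsOpen (V \ E) := by
    refine isOpen_iff_mem_nhds.2 ?_
    rintro v ⟨hv, hvE⟩
    obtain ⟨N, hN, hc, hvN, hNV⟩ := ks_exists_open_convex hV hv
    refine mem_of_superset (hN.mem_nhds hvN) fun w hw => ⟨hNV hw, ?_⟩
    rintro ⟨N', hN', hc', hw', hNV', x, hx, hxN'⟩
    obtain ⟨x', hx'⟩ := hd.exists_mem_open (hN.inter hN') ⟨w, hw, hw'⟩
    exact hvE ⟨N, hN, hc, hvN, hNV, x', hx.trans (ks_joined f hc' hNV' hxN' hx'.2), hx'.1⟩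
  have hcl : IsClopen (p ⁻¹' E) := by
    refine ⟨⟨?_⟩, hE.preimage p.continuous⟩
    convert hE'.preimage p.continuous using 1
    ext t
    simp [hp t]
  have hne : (p ⁻¹' E).Nonempty := by
    obtain ⟨N, hN, hc, hvN, hNV⟩ := ks_exists_open_convex hV h0
    exact ⟨0, N, hN, hc, by simpa using hvN, hNV, x₀, JoinedIn.refl h0, hvN⟩
  have h1E : (1 : unitInterval) ∈ p ⁻¹' E := by
    rw [hcl.eq_univ hne]; trivial
  obtain ⟨N, hN, hc, hvN, hNV, x, hx, hxN⟩ := h1E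
  exact hx.trans (ks_joined f hc hNV hxN (by simpa using hvN))

/-- The Schur complement of the lower right `1 × 1` block. -/
noncomputable def ksSchur {A : Type*} [Ring A] {n : Type*} (X : Matrix (n ⊕ Unit) (n ⊕ Unit) A) :
    Matrix n n A :=
  Matrix.of fun i j => X (.inl i) (.inl j) -
    X (.inl i) (.inr ()) * Ring.inverse (X (.inr ()) (.inr ())) * X (.inr ()) (.inl j)

lemma ks_isUnit_of_schur {A : Type*} [Ring A] {n : Type*} [Fintype n] [DecidableEq n]
    (X : Matrix (n ⊕ Unit) (n ⊕ Unit) A) (h1 : IsUnit (X (.inr ()) (.inr ())))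
    (h2 : IsUnit (ksSchur X)) : IsUnit X := by
  obtain ⟨u, hu⟩ := h1
  obtain ⟨s, hs⟩ := h2
  have hi : Ring.inverse (X (.inr ()) (.inr ())) = ↑u⁻¹ := by rw [← hu, Ring.inverse_unit]
  let d : Matrix Unit Unit A := Matrix.of fun _ _ => (u : A)
  let d' : Matrix Unit Unit A := Matrix.of fun _ _ => ((u⁻¹ : Aˣ) : A)
  have hd : d * d' = 1 := by ext; simp [d, d', Matrix.mul_apply]
  have hd' : d' * d = 1 := by ext; simp [d, d', Matrix.mul_apply]
  have hD : X.toBlocks₂₂ = d := by ext; simp [d, hu, Matrix.toBlocks₂₂]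
  have hS : (s : Matrix n n A) = X.toBlocks₁₁ - X.toBlocks₁₂ * d' * X.toBlocks₂₁ := by
    rw [hs]; ext i j; simp [ksSchur, d', Matrix.mul_apply, hi, Matrix.toBlocks₁₁, Matrix.toBlocks₁₂, Matrix.toBlocks₂₁]
  have hX : X = Matrix.fromBlocks 1 (X.toBlocks₁₂ * d') 0 1 * Matrix.fromBlocks (s : Matrix n n A) 0 0 d *
      Matrix.fromBlocks 1 0 (d' * X.toBlocks₂₁) 1 := by
    rw [hS, Matrix.fromBlocks_multiply, Matrix.fromBlocks_multiply]
    conv_lhs => rw [← Matrix.fromBlocks_toBlocks X, hD]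
    have e1 : X.toBlocks₁₂ * d' * d = X.toBlocks₁₂ := by rw [Matrix.mul_assoc, hd', Matrix.mul_one]
    have e2 : d * (d' * X.toBlocks₂₁) = X.toBlocks₂₁ := by
      rw [← Matrix.mul_assoc, hd, Matrix.one_mul]
    simp [e1, e2, Matrix.mul_assoc]
  rw [hX]
  refine (IsUnit.mul ?_ ?_).mul ?_
  · refine ⟨⟨Matrix.fromBlocks 1 (X.toBlocks₁₂ * d') 0 1, Matrix.fromBlocks 1 (-(X.toBlocks₁₂ * d')) 0 1, ?_, ?_⟩, rfl⟩ <;>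
      simp [Matrix.fromBlocks_multiply]
  · refine ⟨⟨Matrix.fromBlocks (s : Matrix n n A) 0 0 d, Matrix.fromBlocks (↑s⁻¹ : Matrix n n A) 0 0 d', ?_, ?_⟩, rfl⟩ <;>
      simp [Matrix.fromBlocks_multiply, hd, hd']
  · refine ⟨⟨Matrix.fromBlocks 1 0 (d' * X.toBlocks₂₁) 1, Matrix.fromBlocks 1 0 (-(d' * X.toBlocks₂₁)) 1, ?_, ?_⟩, rfl⟩ <;>
      simp [Matrix.fromBlocks_multiply]

/-- Every matrix over `A` whose image is close to `1` is invertible. -/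
def KsNear {A B : Type*} [NormedRing A] [NormedRing B] (φ : A →+* B)
    (n : Type) [Fintype n] [DecidableEq n] : Prop :=
  ∀ᶠ X in 𝓝 (1 : Matrix n n B), ∀ M : Matrix n n A, M.map φ = X → IsUnit M

lemma ks_near_equiv {A B : Type*} [NormedRing A] [NormedRing B] (φ : A →+* B)
    {m n : Type} [Fintype n] [DecidableEq n] [Fintype m] [DecidableEq m] (e : m ≃ n)
    (h : KsNear φ m) : KsNear φ n := by
  have hc : Continuous fun X : Matrix n n B => X.submatrix e e :=
    continuous_id.matrix_submatrix e e
  have ht := hc.tendsto (1 : Matrix n n B)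
  simp only [Matrix.submatrix_one_equiv] at ht
  filter_upwards [ht.eventually h] with X hX M hM
  have := hX (M.submatrix e e) (by rw [← hM]; rfl)
  have h2 := this.map (Matrix.reindexRingEquiv A e)
  convert h2
  ext; simp

lemma ks_near_succ {A B : Type*} [NormedRing A] [NormedRing B] [CompleteSpace B] (φ : A →+* B)
    (hu : ∀ a, IsUnit (φ a) → IsUnit a)
    {n : Type} [Fintype n] [DecidableEq n]
    (h : KsNear φ n) : KsNear φ (n ⊕ Unit) := by
  have hent : ∀ i j, Continuous fun X : Matrix (n ⊕ Unit) (n ⊕ Unit) B => X i j :=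
    fun i j => continuous_id.matrix_elem i j
  have hinv : ContinuousAt (fun X : Matrix (n ⊕ Unit) (n ⊕ Unit) B =>
      Ring.inverse (X (.inr ()) (.inr ()))) 1 := by
    refine ContinuousAt.comp (g := Ring.inverse) ?_ (hent _ _).continuousAt
    simpa using NormedRing.inverse_continuousAt (1 : Bˣ)
  have hS : Tendsto (ksSchur (A := B) (n := n)) (𝓝 1) (𝓝 1) := by
    have h1 : ksSchur (1 : Matrix (n ⊕ Unit) (n ⊕ Unit) B) = 1 := by
      ext i j; simp [ksSchur, Matrix.one_apply]
    have : ContinuousAt (ksSchur (A := B) (n := n)) 1 := by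
      refine continuousAt_pi.2 fun i => continuousAt_pi.2 fun j => ?_
      exact (hent _ _).continuousAt.sub
        (((hent _ _).continuousAt.mul hinv).mul (hent _ _).continuousAt)
    have h2 := this.tendsto
    rwa [h1] at h2
  have hU : ∀ᶠ X in 𝓝 (1 : Matrix (n ⊕ Unit) (n ⊕ Unit) B), IsUnit (X (.inr ()) (.inr ())) := by
    refine (hent _ _).continuousAt.eventually (Units.isOpen.mem_nhds ?_)
    simp
  filter_upwards [hS.eventually h, hU] with X hX hXU M hM
  subst hM
  have h1 := hu _ hXU
  refine ks_isUnit_of_schur M h1 (hX _ ?_)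
  have hinv' : φ (Ring.inverse (M (.inr ()) (.inr ()))) =
      Ring.inverse (φ (M (.inr ()) (.inr ()))) := by
    obtain ⟨u, hu⟩ := h1
    rw [← hu, Ring.inverse_unit]
    exact (Ring.inverse_unit (Units.map (φ : A →* B) u)).symm
  ext i j
  simp [ksSchur, hinv']

lemma ks_near {A B : Type*} [NormedRing A] [NormedRing B] [CompleteSpace B] (φ : A →+* B)
    (hu : ∀ a, IsUnit (φ a) → IsUnit a) (n : ℕ) : KsNear φ (Fin n) := by
  induction n with
  | zero => exact Eventually.of_forall fun X M _ => isUnit_of_subsingleton M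
  | succ n ih =>
    exact ks_near_equiv φ
      ((Equiv.optionEquivSumPUnit (Fin n)).symm.trans (finSuccEquiv n).symm)
      (ks_near_succ φ hu ih)

lemma ks_dense {A B : Type*} [NormedRing A] [NormedRing B] (φ : A →+* B)
    (hd : DenseRange φ) (n : ℕ) :
    DenseRange fun M : Matrix (Fin n) (Fin n) A => M.map φ :=
  DenseRange.piMap fun _ => DenseRange.piMap fun _ => hd

lemma ks_isUnit {A B : Type*} [NormedRing A] [NormedRing B] [CompleteSpace B] (φ : A →+* B)
    (hd : DenseRange φ) (hu : ∀ a, IsUnit (φ a) → IsUnit a) (n : ℕ)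
    (M : Matrix (Fin n) (Fin n) A) (hM : IsUnit (M.map φ)) : IsUnit M := by
  obtain ⟨u, huM⟩ := hM
  have hl : ∀ᶠ Y in 𝓝 (↑u⁻¹ : Matrix (Fin n) (Fin n) B),
      ∀ N : Matrix (Fin n) (Fin n) A, N.map φ = Y * M.map φ → IsUnit N := by
    have hc : Continuous fun Y : Matrix (Fin n) (Fin n) B => Y * M.map φ := by fun_prop
    have ht := hc.tendsto (↑u⁻¹ : Matrix (Fin n) (Fin n) B)
    rw [← huM, Units.inv_mul, huM] at ht
    exact ht.eventually (ks_near φ hu n)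
  have hr : ∀ᶠ Y in 𝓝 (↑u⁻¹ : Matrix (Fin n) (Fin n) B),
      ∀ N : Matrix (Fin n) (Fin n) A, N.map φ = M.map φ * Y → IsUnit N := by
    have hc : Continuous fun Y : Matrix (Fin n) (Fin n) B => M.map φ * Y := by fun_prop
    have ht := hc.tendsto (↑u⁻¹ : Matrix (Fin n) (Fin n) B)
    rw [← huM, Units.mul_inv, huM] at ht
    exact ht.eventually (ks_near φ hu n)
  obtain ⟨_, ⟨N, rfl⟩, h1, h2⟩ := (ks_dense φ hd n).inter_nhds_nonempty (hl.and hr)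
  obtain ⟨a, ha⟩ := h1 (N * M) (by simp [Matrix.map_mul])
  obtain ⟨b, hb⟩ := h2 (M * N) (by simp [Matrix.map_mul])
  refine isUnit_iff_exists_and_exists.2 ⟨⟨N * (b⁻¹).val, ?_⟩, ⟨(a⁻¹).val * N, ?_⟩⟩
  · rw [← mul_assoc, ← hb, Units.mul_inv]
  · rw [mul_assoc, ← ha, Units.inv_mul]

attribute [local instance] Matrix.linftyOpNormedRing

lemma ks_isOpen_units (B : Type*) [NormedRing B] [CompleteSpace B] (n : ℕ) :
    @IsOpen (Matrix (Fin n) (Fin n) B) instTopologicalSpaceMatrix {M | IsUnit M} := by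
  have : CompleteSpace (Matrix (Fin n) (Fin n) B) :=
    inferInstanceAs (CompleteSpace (Fin n → Fin n → B))
  have : HasSummableGeomSeries (Matrix (Fin n) (Fin n) B) :=
    @instHasSummableGeomSeriesOfCompleteSpace _ _ this
  exact Units.isOpen (R := Matrix (Fin n) (Fin n) B)

end KaroubiSwanAux

/-- (Karoubi–Swan, invertible part) A dense and spectral morphism of unital complex Banach
algebras induces, for every `n ≥ 1`, a bijection `π₀(GL_n(A)) → π₀(GL_n(B))`. -/
theorem karoubi_swan_pi0_GL {A B : Type*}
    [NormedRing A] [NormedAlgebra ℂ A] [CompleteSpace A]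
    [NormedRing B] [NormedAlgebra ℂ B] [CompleteSpace B]
    (φ : A →ₐ[ℂ] B) (hcont : Continuous φ) (hdense : DenseRange φ)
    (hspec : ∀ a : A, spectrum ℂ (φ a) = spectrum ℂ a) :
    ∀ n : ℕ, 1 ≤ n →
      Function.Bijective (pi0Map (continuous_glMap φ.toRingHom n hcont)) := by
  intro n _
  have hu : ∀ a, IsUnit (φ.toRingHom a) → IsUnit a := fun a ha => by
    have h0 : IsUnit (φ a) := ha
    rw [← spectrum.zero_notMem_iff ℂ, hspec, spectrum.zero_notMem_iff] at h0
    exact h0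
  have : LocallyConvexSpace ℝ (Matrix (Fin n) (Fin n) B) :=
    inferInstanceAs (LocallyConvexSpace ℝ (Fin n → Fin n → B))
  let f : Matrix (Fin n) (Fin n) A →ₗ[ℝ] Matrix (Fin n) (Fin n) B :=
    ((φ.toLinearMap.restrictScalars ℝ).mapMatrix)
  have hf : ∀ M, f M = M.map φ.toRingHom := fun M => rfl
  have hd : DenseRange f := ks_dense φ.toRingHom hdense n
  have hV := ks_isOpen_units B n
  have hpre : f ⁻¹' {M | IsUnit M} = {M | IsUnit M} := by
    ext M
    exact ⟨ks_isUnit φ.toRingHom hdense hu n M, fun h =>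
      (RingHom.mapMatrix (m := Fin n) φ.toRingHom).isUnit_map (a := M) h⟩
  constructor
  · intro a b
    induction a using Quotient.inductionOn with | _ a => ?_
    induction b using Quotient.inductionOn with | _ b => ?_
    intro hab
    have hj : Joined (glMap φ.toRingHom n a) (glMap φ.toRingHom n b) := Quotient.exact hab
    have hj2 := (joinedIn_iff_joined (F := {M : Matrix (Fin n) (Fin n) B | IsUnit M})
      (glMap φ.toRingHom n a).2 (glMap φ.toRingHom n b).2).2 hj
    have h3 := ks_lift f hd hV (x₀ := a.1) (x₁ := b.1) hj2
    rw [hpre] at h3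
    exact Quotient.sound ((joinedIn_iff_joined
      (F := {M : Matrix (Fin n) (Fin n) A | IsUnit M}) a.2 b.2).1 h3)
  · intro b
    induction b using Quotient.inductionOn with | _ b => ?_
    obtain ⟨N, hN, hc, hbN, hNV⟩ := ks_exists_open_convex hV b.2
    obtain ⟨x, hx⟩ := hd.exists_mem_open hN ⟨_, hbN⟩
    have hxU : IsUnit x := ks_isUnit φ.toRingHom hdense hu n x (hNV hx)
    refine ⟨Quotient.mk _ ⟨x, hxU⟩, Quotient.sound ?_⟩
    exact (joinedIn_iff_joined (F := {M : Matrix (Fin n) (Fin n) B | IsUnit M})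
      (hNV hx) b.2).1
      (JoinedIn.of_segment_subset ((hc.segment_subset hx hbN).trans hNV))
end

section
/- (Karoubi–Swan, idempotent part) Let φ : A → B be a dense and spectral morphism of unital complex Banach algebras. Then for every n ≥ 1 the induced map on path components [Idem(M_n(A))] → [Idem(M_n(B))] is a bijection, where Idem(M_n(A)) = {e ∈ M_n(A) : e² = e} carries the subspace topology. -/
/-- The map `Idem(M_n(A)) → Idem(M_n(B))` induced by a ring morphism `A → B`
(applied entrywise). -/
def idemMap {A B : Type*} [Ring A] [Ring B] (φ : A →+* B) (n : ℕ) :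
    {e : Matrix (Fin n) (Fin n) A // e * e = e} → {e : Matrix (Fin n) (Fin n) B // e * e = e} :=
  fun e => ⟨e.1.map φ, by
    show φ.mapMatrix e.1 * φ.mapMatrix e.1 = φ.mapMatrix e.1
    rw [← map_mul, e.2]⟩

lemma continuous_idemMap {A B : Type*} [Ring A] [Ring B]
    [TopologicalSpace A] [TopologicalSpace B] (φ : A →+* B) (n : ℕ) (hφ : Continuous φ) :
    Continuous (idemMap φ n) :=
  (continuous_subtype_val.matrix_map hφ).subtype_mk _

open Filter Topology unitInterval

/-- Topological core: bijectivity on path components from density and local joinedness. -/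
lemma ks_pi0_bij {X Y : Type*} [TopologicalSpace X] [TopologicalSpace Y] {f : X → Y}
    (hf : Continuous f) (hd : DenseRange f)
    (hY : ∀ y : Y, ∃ V ∈ 𝓝 y, ∀ z ∈ V, Joined z y)
    (hX : ∀ y : Y, ∃ V ∈ 𝓝 y, ∀ x x', f x ∈ V → f x' ∈ V → Joined x x') :
    Function.Bijective (pi0Map hf) := by
  constructor
  · intro a b
    induction a using Quotient.inductionOn with | _ x₀ => ?_
    induction b using Quotient.inductionOn with | _ x₁ => ?_
    intro h
    obtain ⟨p⟩ : Joined (f x₀) (f x₁) := Quotient.exact h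
    refine Quotient.sound ?_
    show Joined x₀ x₁
    let T : Set I := {t | ∀ᶠ y in 𝓝 (p t), ∀ x, f x = y → Joined x x₀}
    have hTo : IsOpen T := by
      rw [isOpen_iff_mem_nhds]
      intro t ht
      have := (p.continuous.tendsto t).eventually (eventually_eventually_nhds.2 ht)
      exact this
    have hTc : IsClosed T := by
      rw [← isOpen_compl_iff, isOpen_iff_mem_nhds]
      intro t ht
      obtain ⟨V, hV, hVj⟩ := hX (p t)
      have h1 := (p.continuous.tendsto t).eventually (eventually_mem_nhds_iff.2 hV)
      filter_upwards [h1] with t' ht' hT'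
      apply ht
      obtain ⟨_, ⟨x, rfl⟩, hy1, hy2⟩ := hd.inter_nhds_nonempty (Filter.inter_mem ht' hT')
      filter_upwards [hV] with z hz x' hx'
      exact (hVj x' x (hx' ▸ hz) hy1).trans (hy2 x rfl)
    have h0 : (0 : I) ∈ T := by
      obtain ⟨V, hV, hVj⟩ := hX (p 0)
      show ∀ᶠ y in 𝓝 (p 0), ∀ x, f x = y → Joined x x₀
      filter_upwards [hV] with z hz x hx
      refine hVj x x₀ (hx ▸ hz) ?_
      have := mem_of_mem_nhds hV
      rwa [p.source] at this
    have hT : T = Set.univ := IsClopen.eq_univ ⟨hTc, hTo⟩ ⟨0, h0⟩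
    have h1 : (1 : I) ∈ T := hT ▸ Set.mem_univ _
    exact (Eventually.self_of_nhds h1 x₁ p.target.symm).symm
  · intro b
    induction b using Quotient.inductionOn with | _ y => ?_
    obtain ⟨V, hV, hVj⟩ := hY y
    obtain ⟨_, ⟨x, rfl⟩, hz⟩ := hd.inter_nhds_nonempty hV
    exact ⟨Quotient.mk _ x, Quotient.sound (hVj _ hz)⟩

lemma ks_map_inverse {R S : Type*} [Ring R] [Ring S] (φ : R →+* S) {x : R} (hx : IsUnit x) :
    φ (Ring.inverse x) = Ring.inverse (φ x) := by
  obtain ⟨u, rfl⟩ := hx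
  rw [Ring.inverse_unit]
  have : φ (u : R) = ((Units.map (φ : R →* S) u : Sˣ) : S) := rfl
  rw [this, Ring.inverse_unit, ← map_inv]
  rfl

/-- Idempotents conjugate through a path of units are joined. -/
lemma ks_joined_s6 {R : Type*} [NormedRing R] [NormedAlgebra ℂ R] [CompleteSpace R]
    (e f : {e : R // e * e = e})
    (h : ∀ s : I, IsUnit (1 + ((s : ℝ) : ℂ) • (e.1 * f.1 + (1 - e.1) * (1 - f.1) - 1))) :
    Joined e f := by
  set u : R := e.1 * f.1 + (1 - e.1) * (1 - f.1) with hu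
  let w : I → R := fun s => 1 + ((s : ℝ) : ℂ) • (u - 1)
  have hw : Continuous w := by fun_prop
  have hwi : Continuous fun s => Ring.inverse (w s) := by
    rw [continuous_iff_continuousAt]
    intro s
    obtain ⟨v, hv⟩ := h s
    have : ContinuousAt Ring.inverse (w s) := by
      have := NormedRing.inverse_continuousAt v
      rwa [hv] at this
    exact ContinuousAt.comp this hw.continuousAt
  have huf : u * f.1 = e.1 * u := by
    have h1 := e.2
    have h2 := f.2
    have e1 : u * f.1 = e.1 * f.1 := by
      rw [hu]
      have : (1 - f.1) * f.1 = 0 := by rw [sub_mul, h2, one_mul, sub_self]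
      rw [add_mul, mul_assoc, h2, mul_assoc, this, mul_zero, add_zero]
    have e2 : e.1 * u = e.1 * f.1 := by
      rw [hu]
      have : e.1 * (1 - e.1) = 0 := by rw [mul_sub, h1, mul_one, sub_self]
      rw [mul_add, ← mul_assoc, h1, ← mul_assoc, this, zero_mul, add_zero]
    rw [e1, e2]
  have hc : ∀ s, Ring.inverse (w s) * w s = 1 := fun s => Ring.inverse_mul_cancel _ (h s)
  have hc' : ∀ s, w s * Ring.inverse (w s) = 1 := fun s => Ring.mul_inverse_cancel _ (h s)
  refine Joined.symm ⟨⟨⟨fun s => ⟨w s * f.1 * Ring.inverse (w s), ?_⟩, ?_⟩, ?_, ?_⟩⟩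
  · calc w s * f.1 * Ring.inverse (w s) * (w s * f.1 * Ring.inverse (w s))
        = w s * f.1 * (Ring.inverse (w s) * w s) * f.1 * Ring.inverse (w s) := by
          simp only [mul_assoc]
      _ = w s * (f.1 * f.1) * Ring.inverse (w s) := by rw [hc]; simp only [mul_assoc, one_mul]
      _ = _ := by rw [f.2]
  · exact Continuous.subtype_mk (by fun_prop) _
  · apply Subtype.ext
    simp [w]
  · apply Subtype.ext
    have h1 : w 1 = u := by simp [w]
    have h2 := hc' 1
    show w 1 * f.1 * Ring.inverse (w 1) = e.1
    rw [h1] at h2 ⊢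
    rw [huf, mul_assoc, h2, mul_one]

/-- Idempotents near a given one give invertible conjugating segments. -/
lemma ks_near_s6 {S : Type*} [NormedRing S] [NormedAlgebra ℂ S] [CompleteSpace S]
    (y : {e : S // e * e = e}) :
    ∃ V ∈ 𝓝 y, ∀ e ∈ V, ∀ f ∈ V, ∀ s : I,
      IsUnit (1 + ((s : ℝ) : ℂ) • (e.1 * f.1 + (1 - e.1) * (1 - f.1) - 1)) := by
  have hcont : Continuous fun q : {e : S // e * e = e} × {e : S // e * e = e} =>
      q.1.1 * q.2.1 + (1 - q.1.1) * (1 - q.2.1) - 1 := by fun_prop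
  have hev : ∀ᶠ q in 𝓝 (y, y), ‖(q.1.1 * q.2.1 + (1 - q.1.1) * (1 - q.2.1) - 1 : S)‖ < 1 := by
    apply (hcont.norm.tendsto (y, y)).eventually_lt_const
    have : y.1 * y.1 + (1 - y.1) * (1 - y.1) - 1 = 0 := by
      rw [sub_mul, mul_sub, mul_sub, y.2]; simp
    simp only [this]
    simp
  rw [nhds_prod_eq] at hev
  obtain ⟨V, hV, h0⟩ := (𝓝 y).basis_sets.prod_self.eventually_iff.1 hev
  have h : ∀ e ∈ V, ∀ f ∈ V, ‖(e.1 * f.1 + (1 - e.1) * (1 - f.1) - 1 : S)‖ < 1 :=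
    fun e he f hf => h0 (x := (e, f)) ⟨he, hf⟩
  refine ⟨V, hV, fun e he f hf s => ?_⟩
  have := h e he f hf
  set z : S := e.1 * f.1 + (1 - e.1) * (1 - f.1) - 1
  have h2 : ‖-(((s : ℝ) : ℂ) • z)‖ < 1 := by
    rw [norm_neg, norm_smul]
    have hs : ‖((s : ℝ) : ℂ)‖ ≤ 1 := by
      rw [Complex.norm_real, Real.norm_of_nonneg s.2.1]; exact s.2.2
    nlinarith [norm_nonneg z]
  have := isUnit_one_sub_of_norm_lt_one h2
  rwa [sub_neg_eq_add] at this

/-- Coefficients of `(1 + y)^(-1/2)`. -/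
lemma ks_coeff : ∃ c : ℕ → ℂ, c 0 = 1 ∧ (∀ k, ‖c k‖ ≤ 1) ∧
    ∀ n, ∑ q ∈ Finset.HasAntidiagonal.antidiagonal n, c q.1 * c q.2 = (-1) ^ n := by
  refine ⟨fun k => Ring.choose (-1/2 : ℂ) k, by simp, ?_, ?_⟩
  · intro k
    induction k with
    | zero => simp
    | succ k ih =>
      have h1 : Ring.choose (-1/2 : ℂ) (k+1) = Ring.choose (-1/2 : ℂ) k * ((-1/2 - k) / (k+1)) := by
        rw [Ring.choose_eq_smul, Ring.choose_eq_smul, descPochhammer_succ_right]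
        have : ((k+1 : ℕ).factorial : ℂ) = (k+1) * k.factorial := by
          push_cast [Nat.factorial_succ]; ring
        rw [this]
        have h2 : (k.factorial : ℂ) ≠ 0 := by exact_mod_cast k.factorial_ne_zero
        have h3 : (k + 1 : ℂ) ≠ 0 := by exact_mod_cast k.succ_ne_zero
        simp [Polynomial.smeval_mul, Polynomial.smeval_sub, Polynomial.smeval_natCast]
        field_simp
      simp only [h1, norm_mul]
      have : ‖((-1/2 - k) / (k+1) : ℂ)‖ ≤ 1 := by
        have : ((-1/2 - k) / (k+1) : ℂ) = ((-((1/2 + k) / (k+1)) : ℝ) : ℂ) := by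
          push_cast; ring
        rw [this, Complex.norm_real, norm_neg, Real.norm_of_nonneg (by positivity)]
        rw [div_le_one (by positivity)]
        linarith
      exact mul_le_one₀ ih (norm_nonneg _) this
  · intro n
    rw [← Ring.add_choose_eq n (Commute.all _ _)]
    have : (-1/2 + -1/2 : ℂ) = -1 := by norm_num
    rw [this, Ring.choose_neg']
    simp [Ring.multichoose_one, Units.smul_def]

lemma ks_summable {R : Type*} [NormedRing R] [NormedAlgebra ℂ R] [CompleteSpace R] {y : R}
    (hy : spectralRadius ℂ y < 1) : Summable fun n => ‖y ^ n‖ := by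
  obtain ⟨q, hq1, hq2⟩ := exists_between hy
  have hg := spectrum.pow_nnnorm_pow_one_div_tendsto_nhds_spectralRadius y
  lift q to NNReal using (hq2.trans ENNReal.one_lt_top).ne
  have hq2' : q < 1 := by exact_mod_cast hq2
  refine Summable.of_norm_bounded_eventually_nat
    (summable_geometric_of_lt_one q.2 (by exact_mod_cast hq2')) ?_
  filter_upwards [hg.eventually_lt_const hq1, eventually_gt_atTop 0] with n hn hn0
  have hn0' : (n : ℝ) ≠ 0 := by exact_mod_cast hn0.ne'
  have h1 := ENNReal.rpow_le_rpow hn.le (Nat.cast_nonneg n : (0:ℝ) ≤ n)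
  rw [← ENNReal.rpow_mul, one_div_mul_cancel hn0', ENNReal.rpow_one, ENNReal.rpow_natCast] at h1
  rw [norm_norm]
  exact_mod_cast h1

/-- Idempotents lift densely along a dense inverse-closed morphism. -/
lemma ks_dense_s6 {R S : Type*} [NormedRing R] [NormedAlgebra ℂ R] [CompleteSpace R]
    [NormedRing S] [NormedAlgebra ℂ S] [CompleteSpace S]
    (φ : R →ₐ[ℂ] S) (hcont : Continuous φ) (hdense : DenseRange φ)
    (hunit : ∀ a, IsUnit (φ a) → IsUnit a) (e : S) (he : e * e = e) (U : Set S) (hU : U ∈ 𝓝 e) :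
    ∃ f : R, f * f = f ∧ φ f ∈ U := by
  obtain ⟨c, c0, cn, cc⟩ := ks_coeff
  let g : S → S := fun z => ∑' k, c k • z ^ k
  have hg : ContinuousAt g 0 := by
    refine tendsto_tsum_of_dominated_convergence (bound := fun k => (‖(1:S)‖ + 1) * (1/2) ^ k)
      ((summable_geometric_of_lt_one (by norm_num) (by norm_num)).mul_left _) ?_ ?_
    · intro k
      have : Continuous fun z : S => c k • z ^ k := by fun_prop
      exact this.tendsto 0
    · have : ∀ᶠ z : S in 𝓝 0, ‖z‖ < 1/2 :=
        (continuous_norm.tendsto (0:S)).eventually_lt_const (by simp)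
      filter_upwards [this] with z hz k
      rw [norm_smul]
      have h1 : ‖z ^ k‖ ≤ (‖(1:S)‖ + 1) * (1/2) ^ k := by
        rcases Nat.eq_zero_or_pos k with rfl | hk
        · simp
        · calc ‖z ^ k‖ ≤ ‖z‖ ^ k := norm_pow_le' z hk
            _ ≤ (1/2) ^ k := by gcongr
            _ ≤ _ := le_mul_of_one_le_left (by positivity) (by linarith [norm_nonneg (1:S)])
      calc ‖c k‖ * ‖z ^ k‖ ≤ 1 * ‖z ^ k‖ := by gcongr; exact cn k
        _ ≤ _ := by rwa [one_mul]
  have hg0 : g 0 = 1 := by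
    show ∑' k, c k • (0:S) ^ k = 1
    rw [tsum_eq_single 0]
    · simp [c0]
    · intro k hk; simp [hk]
  let Y : S → S := fun b => (4:ℂ) • (b * b - b)
  have hYc : Continuous Y := by fun_prop
  have hYe : Y e = 0 := by simp [Y, he]
  let F : S → S := fun b => (1/2 : ℂ) • (1 + ((2:ℂ) • b - 1) * g (Y b))
  have hF : ContinuousAt F e := by
    have h1 : ContinuousAt (fun b => g (Y b)) e :=
      ContinuousAt.comp (f := Y) (g := g) (by rw [hYe]; exact hg) hYc.continuousAt
    have h2 : ContinuousAt (fun b : S => (2:ℂ) • b - 1) e := by fun_prop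
    exact (continuousAt_const.add (h2.mul h1)).const_smul _
  have hFe : F e = e := by
    show (1/2 : ℂ) • (1 + ((2:ℂ) • e - 1) * g (Y e)) = e
    rw [hYe, hg0, mul_one, add_sub_cancel, smul_smul]
    norm_num
  have ev1 : ∀ᶠ b in 𝓝 e, F b ∈ U := hF.eventually (by rw [hFe]; exact hU)
  have ev2 : ∀ᶠ b in 𝓝 e, ‖Y b‖ * ‖(1:S)‖ < 1 := by
    have : Continuous fun b => ‖Y b‖ * ‖(1:S)‖ := by fun_prop
    exact (this.tendsto e).eventually_lt_const (by simp [hYe])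
  obtain ⟨_, ⟨a, rfl⟩, hb1, hb2⟩ := hdense.inter_nhds_nonempty (ev1.and ev2)
  let y : R := (4:ℂ) • (a * a - a)
  have hφy : φ y = Y (φ a) := by simp [y, Y]
  have hspec : spectralRadius ℂ y < 1 := by
    have h1 : spectralRadius ℂ y = spectralRadius ℂ (φ y) := by
      have : spectrum ℂ (φ y) = spectrum ℂ y := by
        ext k
        rw [spectrum.mem_iff, spectrum.mem_iff, not_iff_not]
        have : algebraMap ℂ S k - φ y = φ (algebraMap ℂ R k - y) := by simp
        rw [this]
        exact ⟨hunit _, fun h => h.map φ⟩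
      simp [spectralRadius, this]
    rw [h1, hφy]
    refine lt_of_le_of_lt (spectrum.spectralRadius_le_pow_nnnorm_pow_one_div ℂ (Y (φ a)) 0) ?_
    simp
    exact_mod_cast hb2
  have hs := ks_summable hspec
  have hs' : Summable fun k => ‖c k • y ^ k‖ := by
    refine Summable.of_nonneg_of_le (fun _ => norm_nonneg _) (fun k => ?_) hs
    rw [norm_smul]
    exact mul_le_of_le_one_left (norm_nonneg _) (cn k)
  let γ : R := ∑' k, c k • y ^ k
  have hφγ : φ γ = g (Y (φ a)) := by
    show φ (∑' k, c k • y ^ k) = ∑' k, c k • (Y (φ a)) ^ k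
    rw [hs'.of_norm.map_tsum φ hcont]
    simp [hφy]
  have hγγ : γ * γ * (1 + y) = 1 := by
    have h1 : γ * γ = ∑' n, (-y) ^ n := by
      show (∑' k, c k • y ^ k) * (∑' k, c k • y ^ k) = _
      rw [tsum_mul_tsum_eq_tsum_sum_antidiagonal_of_summable_norm hs' hs']
      congr 1
      ext n
      rw [neg_pow, ← Int.cast_one, ← Int.cast_neg, ← Int.cast_pow]
      have : ∀ q ∈ Finset.HasAntidiagonal.antidiagonal n, c q.1 • y ^ q.1 * c q.2 • y ^ q.2
          = (c q.1 * c q.2) • y ^ n := by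
        intro q hq
        rw [smul_mul_smul_comm, ← pow_add, Finset.HasAntidiagonal.mem_antidiagonal.1 hq]
      rw [Finset.sum_congr rfl this, ← Finset.sum_smul, cc, ← zsmul_eq_mul,
        ← Int.cast_smul_eq_zsmul ℂ]
      simp
    have h2 : Summable fun n => (-y) ^ n := by
      refine Summable.of_norm (hs.congr fun n => ?_)
      rcases Nat.even_or_odd n with h | h
      · rw [h.neg_pow]
      · rw [h.neg_pow, norm_neg]
    rw [h1]
    have := h2.tsum_pow_mul_one_sub
    rwa [sub_neg_eq_add] at this
  have hcom : Commute a γ := by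
    refine Commute.tsum_right a fun k => ?_
    have : Commute a y := by
      show a * y = y * a
      simp [y, mul_sub, sub_mul, mul_assoc]
    exact (this.pow_right k).smul_right _
  set v : R := ((2:ℂ) • a - 1) * γ with hv
  have hvv : v * v = 1 := by
    have hc2 : Commute ((2:ℂ) • a - 1) γ := (hcom.smul_left _).sub_left (Commute.one_left _)
    have h1 : ((2:ℂ) • a - 1) * ((2:ℂ) • a - 1) = 1 + y := by
      simp only [y, mul_sub, sub_mul, smul_mul_smul_comm, mul_one, one_mul, smul_sub]
      module
    have hc3 : Commute (1 + y) (γ * γ) := by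
      rw [← h1]
      exact (hc2.mul_left hc2).mul_right (hc2.mul_left hc2)
    rw [hv, hc2.symm.mul_mul_mul_comm, h1, hc3.eq, hγγ]
  refine ⟨(1/2 : ℂ) • (1 + v), ?_, ?_⟩
  · rw [smul_mul_smul_comm, mul_add, add_mul, add_mul, hvv]
    simp only [mul_one, one_mul]
    module
  · have : φ ((1/2 : ℂ) • (1 + v)) = F (φ a) := by
      simp [F, hv, hφγ]
    rw [this]; exact hb1

/-- Abstract form of the theorem for a dense, inverse-closed morphism. -/
lemma ks_abstract {R S : Type*} [NormedRing R] [NormedAlgebra ℂ R] [CompleteSpace R]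
    [NormedRing S] [NormedAlgebra ℂ S] [CompleteSpace S]
    (φ : R →ₐ[ℂ] S) (hcont : Continuous φ) (hdense : DenseRange φ)
    (hunit : ∀ a, IsUnit (φ a) → IsUnit a)
    (f : {e : R // e * e = e} → {e : S // e * e = e}) (hf : Continuous f)
    (hfφ : ∀ x, (f x).1 = φ x.1) :
    Function.Bijective (pi0Map hf) := by
  apply ks_pi0_bij
  · intro y
    rw [mem_closure_iff_nhds]
    intro V hV
    rw [nhds_induced, mem_comap] at hV
    obtain ⟨U, hU, hUV⟩ := hV
    obtain ⟨x, hx, hxU⟩ := ks_dense_s6 φ hcont hdense hunit y.1 y.2 U hU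
    refine ⟨f ⟨x, hx⟩, hUV ?_, Set.mem_range_self _⟩
    show (f ⟨x, hx⟩).1 ∈ U
    rw [hfφ]; exact hxU
  · intro y
    obtain ⟨V, hV, h⟩ := ks_near_s6 y
    exact ⟨V, hV, fun z hz => ks_joined_s6 _ _ (h z hz y (mem_of_mem_nhds hV))⟩
  · intro y
    obtain ⟨V, hV, h⟩ := ks_near_s6 y
    refine ⟨V, hV, fun x x' hx hx' => ks_joined_s6 _ _ fun s => hunit _ ?_⟩
    have := h _ hx _ hx' s
    rw [hfφ, hfφ] at this
    simpa only [map_add, map_sub, map_mul, map_one, map_smul] using this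

lemma ks_G_cont {S : Type*} [NormedRing S] [CompleteSpace S] (E : S) :
    ContinuousAt (fun z => Ring.inverse (1 - z * E) * (z * (1 - E))) 0 := by
  have h1 : ContinuousAt (fun z : S => Ring.inverse (1 - z * E)) 0 := by
    refine ContinuousAt.comp (g := Ring.inverse) (f := fun z : S => 1 - z * E) ?_ ?_
    · have := NormedRing.inverse_continuousAt (1 : Sˣ)
      simpa using this
    · exact (continuous_const.sub (continuous_id.mul continuous_const)).continuousAt
  exact h1.mul (continuous_id.mul continuous_const).continuousAt

section
attribute [local instance] Matrix.linftyOpNormedRing Matrix.linftyOpNormedAlgebra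

lemma ks_complete {B : Type*} [NormedRing B] [CompleteSpace B] (n : ℕ) :
    @CompleteSpace (Matrix (Fin n) (Fin n) B)
      Matrix.linftyOpNormedRing.toPseudoMetricSpace.toUniformSpace :=
  (inferInstance : @CompleteSpace (Matrix (Fin n) (Fin n) B) (Matrix.instUniformSpace _ _ _))

/-- Invertibility of a matrix differing from the identity in one column. -/
lemma ks_column {A : Type*} [Ring A] {n : ℕ} (y : Matrix (Fin n) (Fin n) A) (k : Fin n)
    (h : IsUnit (1 - y k k)) : IsUnit (1 - y * Matrix.single k k (1 : A)) := by
  obtain ⟨w, h1, h2⟩ := isUnit_iff_exists.1 h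
  set c := y * Matrix.single k k (1 : A) with hc
  have hcj : ∀ i j, c i j = if j = k then y i k else 0 := by
    intro i j
    by_cases hj : j = k
    · subst hj; simp [hc]
    · simp [hc, hj, Matrix.mul_single_apply_of_ne]
  let D : Matrix (Fin n) (Fin n) A := Matrix.diagonal fun _ => y k k
  let W : Matrix (Fin n) (Fin n) A := Matrix.diagonal fun _ => w
  have e1 : c * c = c * D := by
    ext i j
    simp [Matrix.mul_apply, hcj, D, Matrix.diagonal_apply]
  have e2 : c * W * c = c * W * D := by
    ext i j
    simp [Matrix.mul_apply, hcj, D, W, Matrix.diagonal_apply]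
  have e3 : W - D * W = 1 := by
    have : w - y k k * w = 1 := by rw [← h1]; noncomm_ring
    simp only [W, D, Matrix.diagonal_mul_diagonal, Matrix.diagonal_sub, this, Matrix.diagonal_one]
  have e4 : W - W * D = 1 := by
    have : w - w * y k k = 1 := by rw [← h2]; noncomm_ring
    simp only [W, D, Matrix.diagonal_mul_diagonal, Matrix.diagonal_sub, this, Matrix.diagonal_one]
  refine isUnit_iff_exists.2 ⟨1 + c * W, ?_, ?_⟩
  · calc (1 - c) * (1 + c * W) = 1 - c + (c * W - c * c * W) := by noncomm_ring
      _ = 1 - c + c * (W - D * W) := by rw [e1]; noncomm_ring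
      _ = 1 := by rw [e3]; simp
  · calc (1 + c * W) * (1 - c) = 1 - c + (c * W - c * W * c) := by noncomm_ring
      _ = 1 - c + c * (W - W * D) := by rw [e2]; noncomm_ring
      _ = 1 := by rw [e4]; simp

/-- Matrices over a spectral morphism near the identity are invertible. -/
lemma ks_matrix_near {A B : Type*} [Ring A] [NormedRing B] [CompleteSpace B]
    (φ : A →+* B) (hunit : ∀ a, IsUnit (φ a) → IsUnit a) (n : ℕ) (s : Finset (Fin n)) :
    ∀ᶠ z in 𝓝 (0 : Matrix (Fin n) (Fin n) B), ∀ y : Matrix (Fin n) (Fin n) A,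
      φ.mapMatrix y = z → (∀ j ∉ s, ∀ i, y i j = 0) → IsUnit (1 - y) := by
  induction s using Finset.induction_on with
  | empty =>
    refine Eventually.of_forall fun z y _ h => ?_
    have : y = 0 := by ext i j; exact h j (by simp) i
    simp [this]
  | insert k s hk ih =>
    let E : Matrix (Fin n) (Fin n) B := Matrix.single k k 1
    let G : Matrix (Fin n) (Fin n) B → Matrix (Fin n) (Fin n) B :=
      fun z => Ring.inverse (1 - z * E) * (z * (1 - E))
    have hG : ContinuousAt G 0 :=
      @ks_G_cont (Matrix (Fin n) (Fin n) B) _ (ks_complete n) E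
    have hG0 : G 0 = 0 := by simp [G]
    have ev1 := hG.eventually (by rw [hG0]; exact ih)
    have ev2 : ∀ᶠ z in 𝓝 (0 : Matrix (Fin n) (Fin n) B), IsUnit (1 - z k k) := by
      have hc : Continuous fun z : Matrix (Fin n) (Fin n) B => 1 - z k k :=
        continuous_const.sub (Continuous.matrix_elem continuous_id k k)
      refine (hc.tendsto 0).eventually ?_
      have : (1 : B) - (0 : Matrix (Fin n) (Fin n) B) k k = 1 := by simp
      rw [this]
      exact Units.nhds (1 : Bˣ)
    filter_upwards [ev1, ev2] with z hz1 hz2 y hyz hy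
    have hu : IsUnit (1 - y k k) := by
      apply hunit
      rw [← hyz] at hz2
      simpa using hz2
    have hc := ks_column y k hu
    let E' : Matrix (Fin n) (Fin n) A := Matrix.single k k 1
    have hE : φ.mapMatrix E' = E := by simp [E, E']
    have key : IsUnit (1 - Ring.inverse (1 - y * E') * (y * (1 - E'))) := by
      apply hz1
      · rw [map_mul, ks_map_inverse _ hc, map_sub, map_mul, map_mul, map_sub, hE, hyz, map_one]
      · intro j hj i
        have : ∀ i, (y * (1 - E')) i j = 0 := by
          intro i
          by_cases hjk : j = k
          · subst hjk
            simp [mul_sub, E']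
          · have h1 := hy j (by simp [hjk, hj]) i
            simp [mul_sub, E', h1, Matrix.mul_single_apply_of_ne, hjk]
        rw [Matrix.mul_apply]
        exact Finset.sum_eq_zero fun l _ => by rw [this, mul_zero]
    have : 1 - y = (1 - y * E') * (1 - Ring.inverse (1 - y * E') * (y * (1 - E'))) := by
      rw [mul_sub, ← mul_assoc, Ring.mul_inverse_cancel _ hc]
      noncomm_ring
    rw [this]
    exact hc.mul key

lemma ks_matrix_dense {A B : Type*} [NormedRing A] [NormedRing B]
    (φ : A →+* B) (hdense : DenseRange φ) (n : ℕ) :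
    DenseRange (φ.mapMatrix : Matrix (Fin n) (Fin n) A → Matrix (Fin n) (Fin n) B) :=
  DenseRange.piMap fun _ => DenseRange.piMap fun _ => hdense

lemma ks_matrix_unit {A B : Type*} [NormedRing A] [NormedRing B] [CompleteSpace B]
    (φ : A →+* B) (hdense : DenseRange φ) (hunit : ∀ a, IsUnit (φ a) → IsUnit a) (n : ℕ)
    (x : Matrix (Fin n) (Fin n) A) (hx : IsUnit (φ.mapMatrix x)) : IsUnit x := by
  obtain ⟨v, h1, h2⟩ := isUnit_iff_exists.1 hx
  have hN := ks_matrix_near φ hunit n Finset.univ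
  have c1 : Continuous fun z : Matrix (Fin n) (Fin n) B => 1 - φ.mapMatrix x * z :=
    continuous_const.sub (continuous_const.matrix_mul continuous_id)
  have c2 : Continuous fun z : Matrix (Fin n) (Fin n) B => 1 - z * φ.mapMatrix x :=
    continuous_const.sub (continuous_id.matrix_mul continuous_const)
  have ev1 := (c1.tendsto v).eventually (by rw [h1, sub_self]; exact hN)
  have ev2 := (c2.tendsto v).eventually (by rw [h2, sub_self]; exact hN)
  obtain ⟨_, ⟨c, rfl⟩, hc1, hc2⟩ :=
    (ks_matrix_dense φ hdense n).inter_nhds_nonempty (ev1.and ev2)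
  have u1 := hc1 (1 - x * c) (by simp only [map_sub, map_mul, map_one]) (by simp)
  have u2 := hc2 (1 - c * x) (by simp only [map_sub, map_mul, map_one]) (by simp)
  rw [sub_sub_cancel] at u1 u2
  obtain ⟨p, hp, -⟩ := isUnit_iff_exists.1 u1
  obtain ⟨q, -, hq⟩ := isUnit_iff_exists.1 u2
  rw [mul_assoc] at hp
  rw [← mul_assoc] at hq
  refine isUnit_iff_exists.2 ⟨c * p, hp, ?_⟩
  rwa [← left_inv_eq_right_inv hq hp]

end

theorem karoubi_swan_pi0_idem {A B : Type*}
    [NormedRing A] [NormedAlgebra ℂ A] [CompleteSpace A]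
    [NormedRing B] [NormedAlgebra ℂ B] [CompleteSpace B]
    (φ : A →ₐ[ℂ] B) (hcont : Continuous φ) (hdense : DenseRange φ)
    (hspec : ∀ a : A, spectrum ℂ (φ a) = spectrum ℂ a) :
    ∀ n : ℕ, 1 ≤ n →
      Function.Bijective (pi0Map (continuous_idemMap φ.toRingHom n hcont)) := by
  intro n _
  have hunit : ∀ a, IsUnit (φ a) → IsUnit a := by
    intro a ha
    rw [← spectrum.zero_notMem_iff ℂ] at ha ⊢
    rwa [← hspec]
  have hmc : Continuous (φ.mapMatrix : Matrix (Fin n) (Fin n) A → Matrix (Fin n) (Fin n) B) :=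
    continuous_id.matrix_map hcont
  exact @ks_abstract (Matrix (Fin n) (Fin n) A) (Matrix (Fin n) (Fin n) B)
    Matrix.linftyOpNormedRing Matrix.linftyOpNormedAlgebra (ks_complete n)
    Matrix.linftyOpNormedRing Matrix.linftyOpNormedAlgebra (ks_complete n)
    φ.mapMatrix hmc (ks_matrix_dense φ.toRingHom hdense n)
    (ks_matrix_unit φ.toRingHom hdense hunit n) _
    (continuous_idemMap φ.toRingHom n hcont) (fun _ => rfl)
end
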